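/- arXiv:1707.02542 — 5 statements merged into one kernel-verified Lean document; each statement's English description precedes it below -/
import Mathlib

section
/- Let R be a noetherian local ring with dim R > 0 and S a nonzero Serre subcategory of the category of R-modules such that every module in S is finitely generated. If R has at least two distinct prime ideals of height dim R − 1, then no prime ideal of height at least dim R − 1 belongs to MP[S]. -/
/-!
Common framework: a *Serre class* is a class of (bundled) `R`-modules closed under
submodules, quotient modules and extensions.  `MelkerssonCondition R P I` is the
Melkersson condition `(C_I)`: if `Γ_I(M) = M` (every element of `M` is annihilated by
some power of `I`) and `(0 :_M I)` (the `I`-torsion-by-`I` submodule `torsionBySet`)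
belongs to the class, then `M` belongs to the class.  `MP R P` is the set of prime
ideals `p` such that the class satisfies `(C_p)`.
-/

open CategoryTheory

structure SerreClass (R : Type) [CommRing R] where
  mem : ModuleCat.{0} R → Prop
  mem_of_injective : ∀ {M N : ModuleCat.{0} R} (f : M →ₗ[R] N),
    Function.Injective f → mem N → mem M
  mem_of_surjective : ∀ {M N : ModuleCat.{0} R} (f : M →ₗ[R] N),
    Function.Surjective f → mem M → mem N
  mem_of_extension : ∀ {A M B : ModuleCat.{0} R} (f : A →ₗ[R] M) (g : M →ₗ[R] B),
    Function.Injective f → Function.Surjective g →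
    LinearMap.range f = LinearMap.ker g → mem A → mem B → mem M

variable (R : Type) [CommRing R]

/-- `Γ_I(M) = M`: every element of `M` is annihilated by some power of `I`. -/
def IsTorsionByPowers (I : Ideal R) (M : ModuleCat.{0} R) : Prop :=
  ∀ m : M, ∃ n : ℕ, ∀ x ∈ I ^ n, x • m = 0

/-- The Melkersson condition `(C_I)` for a class `P` of `R`-modules:
if `Γ_I(M) = M` and `(0 :_M I) ∈ P` then `M ∈ P`. -/
def MelkerssonCondition (P : ModuleCat.{0} R → Prop) (I : Ideal R) : Prop :=
  ∀ M : ModuleCat.{0} R, IsTorsionByPowers R I M →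
    P (ModuleCat.of R (Submodule.torsionBySet R M (I : Set R))) → P M

/-- `MP[P]`: the set of prime ideals `p` such that `P` satisfies `(C_p)`. -/
def MP (P : ModuleCat.{0} R → Prop) : Set (PrimeSpectrum R) :=
  { p | MelkerssonCondition R P p.asIdeal }

/-- The class `FG` of finitely generated `R`-modules. -/
def FGClass : ModuleCat.{0} R → Prop := fun M => Module.Finite R M

/-- Membership in the extension subcategory `P * Q`: `M` fits in a short exact
sequence `0 → A → M → B → 0` with `A ∈ P` and `B ∈ Q`. -/
def IsExtensionIn (P Q : ModuleCat.{0} R → Prop) (M : ModuleCat.{0} R) : Prop :=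
  ∃ (A B : ModuleCat.{0} R) (f : A →ₗ[R] M) (g : M →ₗ[R] B),
    Function.Injective f ∧ Function.Surjective g ∧
    LinearMap.range f = LinearMap.ker g ∧ P A ∧ Q B

/-- `Supp(P) = ⋃_{M ∈ P} Supp_R M`. -/
def SuppClass (P : ModuleCat.{0} R → Prop) : Set (PrimeSpectrum R) :=
  ⋃ (M : ModuleCat.{0} R) (_ : P M), Module.support R M

/-- `E` is an injective hull of `N`: `E` is injective and contains `N` as an
essential submodule. -/
def IsInjectiveHull (N E : ModuleCat.{0} R) : Prop :=
  Module.Injective R E ∧ ∃ f : N →ₗ[R] E, Function.Injective f ∧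
    ∀ W : Submodule R E, W ≠ ⊥ → W ⊓ LinearMap.range f ≠ ⊥

/-- `M` is `I`-cofinite: `Supp M ⊆ V(I)` and `Ext^i_R(R/I, M)` is a finitely
generated `R`-module for every `i`. -/
noncomputable def IsCofiniteWrt (I : Ideal R) (M : ModuleCat.{0} R) : Prop :=
  Module.support R M ⊆ PrimeSpectrum.zeroLocus (I : Set R) ∧
  ∀ i : ℕ, Module.Finite R
    (((Ext R (ModuleCat.{0} R) i).obj (Opposite.op (ModuleCat.of R (R ⧸ I)))).obj M)

/-- A specialization closed subset of `Spec R`. -/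
def SpecializationClosed (W : Set (PrimeSpectrum R)) : Prop :=
  ∀ p ∈ W, ∀ q : PrimeSpectrum R, p.asIdeal ≤ q.asIdeal → q ∈ W

lemma aux_exists_loc {R : Type} [CommRing R] (P : Ideal R) [hP : P.IsPrime] (x : R) (hx : x ∉ P) :
    ∃ (L : Type) (_ : AddCommGroup L) (_ : Module R L) (f : R →ₗ[R] L),
      (∀ s, f s = 0 ↔ s ∈ P) ∧ (∀ y : L, ∃ (k : ℕ) (s : R), x ^ k • y = f s) ∧
      (∀ (k : ℕ) (s : R), ∃ y : L, x ^ k • y = f s) ∧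
      (∀ (k : ℕ) (y : L), x ^ k • y = 0 → y = 0) := by
  let T := Submonoid.powers x
  let g := LocalizedModule.mkLinearMap T (R ⧸ P)
  refine ⟨LocalizedModule T (R ⧸ P), inferInstance, inferInstance, g ∘ₗ P.mkQ, ?_, ?_, ?_, ?_⟩
  · intro s
    rw [LinearMap.comp_apply, IsLocalizedModule.eq_zero_iff T g]
    constructor
    · rintro ⟨⟨_, k, rfl⟩, hc⟩
      have h2 : P.mkQ (x ^ k • s) = 0 := by rw [map_smul]; exact hc
      rw [Submodule.mkQ_apply, Submodule.Quotient.mk_eq_zero, smul_eq_mul] at h2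
      exact (hP.mem_or_mem h2).resolve_left fun h => hx (hP.mem_of_pow_mem _ h)
    · intro h
      refine ⟨1, ?_⟩
      rw [one_smul, Submodule.mkQ_apply, Submodule.Quotient.mk_eq_zero]
      exact h
  · intro y
    obtain ⟨⟨a, ⟨_, k, rfl⟩⟩, h⟩ := IsLocalizedModule.surj T g y
    obtain ⟨s, rfl⟩ := P.mkQ_surjective a
    exact ⟨k, s, h⟩
  · intro k s
    exact ⟨IsLocalizedModule.mk' g (P.mkQ s) (⟨x ^ k, k, rfl⟩ : T),
      IsLocalizedModule.mk'_cancel' g (P.mkQ s) (⟨x ^ k, k, rfl⟩ : T)⟩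
  · intro k y h
    refine IsLocalizedModule.smul_injective g (⟨x ^ k, k, rfl⟩ : T) ?_
    change x ^ k • y = x ^ k • (0 : LocalizedModule T (R ⧸ P))
    rw [h, smul_zero]

lemma aux_residue {R : Type} [CommRing R] [IsLocalRing R]
    (S : SerreClass R) (hS : ∃ M : ModuleCat.{0} R, S.mem M ∧ Nontrivial M) :
    S.mem (ModuleCat.of R (R ⧸ IsLocalRing.maximalIdeal R)) := by
  obtain ⟨M, hM, hn⟩ := hS
  obtain ⟨y, hy⟩ := exists_ne (0 : M)
  let φ : R →ₗ[R] M := LinearMap.toSpanSingleton R M y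
  have hle : LinearMap.ker φ ≤ IsLocalRing.maximalIdeal R := by
    apply IsLocalRing.le_maximalIdeal
    intro h
    apply hy
    have : (1 : R) ∈ LinearMap.ker φ := by rw [h]; trivial
    simpa [φ] using this
  have h1 : S.mem (ModuleCat.of R (R ⧸ LinearMap.ker φ)) :=
    S.mem_of_injective (M := ModuleCat.of R (R ⧸ LinearMap.ker φ)) (N := M)
      ((LinearMap.ker φ).liftQ φ le_rfl)
      (LinearMap.ker_eq_bot.mp (Submodule.ker_liftQ_eq_bot _ _ _ le_rfl)) hM
  exact S.mem_of_surjective (M := ModuleCat.of R (R ⧸ LinearMap.ker φ))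
    (N := ModuleCat.of R (R ⧸ IsLocalRing.maximalIdeal R))
    (Submodule.factor hle) (Submodule.factor_surjective hle) h1

lemma aux_finlen {R : Type} [CommRing R] [IsNoetherianRing R] [IsLocalRing R]
    (S : SerreClass R) (hS : ∃ M : ModuleCat.{0} R, S.mem M ∧ Nontrivial M)
    (N : Type) [AddCommGroup N] [Module R N] [hN : Module.Finite R N]
    (h : ∃ n : ℕ, ∀ a ∈ IsLocalRing.maximalIdeal R ^ n, ∀ y : N, a • y = 0) :
    S.mem (ModuleCat.of R N) := by
  have hk := aux_residue S hS
  revert h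
  refine IsNoetherianRing.induction_on_isQuotientEquivQuotientPrime R hN
    (motive := fun N _ _ _ => (∃ n : ℕ, ∀ a ∈ IsLocalRing.maximalIdeal R ^ n, ∀ y : N, a • y = 0) →
      S.mem (ModuleCat.of R N)) ?_ ?_ ?_
  · intro N _ _ _ _ _
    exact S.mem_of_injective (M := ModuleCat.of R N) (N := ModuleCat.of R _) (0 : N →ₗ[R] _)
      (fun a b _ => Subsingleton.elim (α := N) a b) hk
  · rintro N _ _ _ p e ⟨n, hn⟩
    have h1 : IsLocalRing.maximalIdeal R ^ n ≤ p.asIdeal := by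
      intro a ha
      have := hn a ha (e.symm (p.asIdeal.mkQ 1))
      rw [← map_smul, ← map_smul] at this
      have h3 := e.symm.map_eq_zero_iff.mp this
      simpa [Ideal.Quotient.eq_zero_iff_mem, Submodule.Quotient.mk_eq_zero] using h3
    have h2 : IsLocalRing.maximalIdeal R = p.asIdeal :=
      le_antisymm (p.isPrime.le_of_pow_le h1) (IsLocalRing.le_maximalIdeal p.isPrime.ne_top)
    rw [h2] at hk
    exact S.mem_of_injective (M := ModuleCat.of R N) (N := ModuleCat.of R _) e.toLinearMap
      e.injective hk
  · rintro N₁ _ _ _ N₂ _ _ _ N₃ _ _ _ f g hf hg hex h1 h3 ⟨n, hn⟩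
    refine S.mem_of_extension (A := ModuleCat.of R N₁) (M := ModuleCat.of R N₂)
      (B := ModuleCat.of R N₃) f g hf hg (LinearMap.exact_iff.mp hex).symm (h1 ⟨n, ?_⟩) (h3 ⟨n, ?_⟩)
    · intro a ha y
      apply hf
      rw [map_smul, map_zero, hn a ha]
    · intro a ha y
      obtain ⟨z, rfl⟩ := hg y
      rw [← map_smul, hn a ha, map_zero]

/-- Key case: a prime `P` directly below the maximal ideal, with `r` not inside `P`. -/
lemma aux_main {R : Type} [CommRing R] [IsNoetherianRing R] [IsLocalRing R]
    (S : SerreClass R) (hS : ∃ M : ModuleCat.{0} R, S.mem M ∧ Nontrivial M)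
    (hfg : ∀ M : ModuleCat.{0} R, S.mem M → Module.Finite R M)
    (P r : PrimeSpectrum R) (hr : ¬ r ≤ P)
    (hP : ∀ Q : PrimeSpectrum R, P < Q → Q.asIdeal = IsLocalRing.maximalIdeal R) :
    r ∉ MP R S.mem := by
  intro hmp
  obtain ⟨x, hxr, hxP⟩ : ∃ x ∈ r.asIdeal, x ∉ P.asIdeal := Set.not_subset.mp hr
  have hrm : r.asIdeal ≤ IsLocalRing.maximalIdeal R :=
    IsLocalRing.le_maximalIdeal r.isPrime.ne_top
  have hPm : P.asIdeal ≤ IsLocalRing.maximalIdeal R :=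
    IsLocalRing.le_maximalIdeal P.isPrime.ne_top
  have hpow : ∀ k : ℕ, ∃ n : ℕ, IsLocalRing.maximalIdeal R ^ n ≤
      P.asIdeal ⊔ Ideal.span {x ^ k} := by
    intro k
    apply Ideal.exists_pow_le_of_le_radical_of_fg _ (IsNoetherian.noetherian _)
    rw [Ideal.radical_eq_sInf]
    refine le_sInf ?_
    rintro Q ⟨hQ, hQp⟩
    have hxQ : x ∈ Q := hQp.mem_of_pow_mem k
      (hQ (Ideal.mem_sup_right (Ideal.mem_span_singleton_self _)))
    refine (hP ⟨Q, hQp⟩ (lt_of_le_of_ne (le_sup_left.trans hQ) ?_)).ge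
    rintro rfl
    exact hxP hxQ
  obtain ⟨L, _, _, f, hf0, hsurj, hdiv, hinj⟩ := aux_exists_loc P.asIdeal x hxP
  let W := LinearMap.range f
  -- torsion
  have htors : ∀ y : L ⧸ W, ∃ n : ℕ, ∀ b ∈ IsLocalRing.maximalIdeal R ^ n, b • y = 0 := by
    intro y
    obtain ⟨y, rfl⟩ := W.mkQ_surjective y
    obtain ⟨k, s, hs⟩ := hsurj y
    obtain ⟨n, hn⟩ := hpow k
    refine ⟨n, fun b hb => ?_⟩
    obtain ⟨c, hc, d, hd, rfl⟩ := Submodule.mem_sup.mp (hn hb)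
    obtain ⟨e, rfl⟩ := Ideal.mem_span_singleton.mp hd
    have hcy : c • y = 0 := by
      apply hinj k
      rw [smul_comm, hs, ← map_smul, hf0, smul_eq_mul]
      exact P.asIdeal.mul_mem_right _ hc
    rw [← map_smul, add_smul, hcy, zero_add, mul_comm, mul_smul, hs, ← map_smul,
      Submodule.mkQ_apply, Submodule.Quotient.mk_eq_zero]
    exact ⟨_, rfl⟩
  obtain ⟨u, hu⟩ := hdiv 1 1
  let N : Submodule R (L ⧸ W) := Submodule.span R {W.mkQ u}
  have hNS : S.mem (ModuleCat.of R N) := by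
    haveI : Module.Finite R N := Module.Finite.span_singleton R _
    apply aux_finlen S hS N
    obtain ⟨n, hn⟩ := htors (W.mkQ u)
    refine ⟨n, fun a ha => ?_⟩
    rintro ⟨y, hy⟩
    obtain ⟨c, rfl⟩ := Submodule.mem_span_singleton.mp hy
    apply Subtype.ext
    change a • c • W.mkQ u = 0
    rw [smul_comm, hn a ha, smul_zero]
  have hle : Submodule.torsionBySet R (L ⧸ W) (r.asIdeal : Set R) ≤ N := by
    intro y hy
    have hxy : x • y = 0 := (Submodule.mem_torsionBySet_iff _ _).mp hy ⟨x, hxr⟩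
    obtain ⟨y, rfl⟩ := W.mkQ_surjective y
    rw [← map_smul, Submodule.mkQ_apply, Submodule.Quotient.mk_eq_zero] at hxy
    obtain ⟨s, hs⟩ := hxy
    refine Submodule.mem_span_singleton.mpr ⟨s, ?_⟩
    rw [← map_smul]
    congr 1
    rw [← sub_eq_zero]
    apply hinj 1
    rw [smul_sub, smul_comm, hu, pow_one, ← hs, ← map_smul, smul_eq_mul, mul_one, sub_self]
  have hmem : S.mem (ModuleCat.of R (L ⧸ W)) := by
    apply hmp (ModuleCat.of R (L ⧸ W))
    · intro y
      obtain ⟨n, hn⟩ := htors y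
      exact ⟨n, fun a ha => hn a (Ideal.pow_right_mono hrm n ha)⟩
    · exact S.mem_of_injective (M := ModuleCat.of R _) (N := ModuleCat.of R N)
        (Submodule.inclusion hle) (Submodule.inclusion_injective hle) hNS
  haveI : Module.Finite R (L ⧸ W) := hfg _ hmem
  haveI : IsNoetherian R (L ⧸ W) := isNoetherian_of_isNoetherianRing_of_finite R _
  obtain ⟨n, hn⟩ := monotone_stabilizes_iff_noetherian.mpr ‹IsNoetherian R (L ⧸ W)›
    (LinearMap.iterateKer (LinearMap.lsmul R (L ⧸ W) x))
  have hn1 := hn (n + 1) (Nat.le_succ n)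
  have hit : ∀ (k : ℕ) (y : L ⧸ W), y ∈ LinearMap.iterateKer (LinearMap.lsmul R (L ⧸ W) x) k ↔
      x ^ k • y = 0 := by
    intro k y
    change (LinearMap.lsmul R (L ⧸ W) x ^ k) y = 0 ↔ _
    have : (LinearMap.lsmul R (L ⧸ W) x ^ k) y = x ^ k • y := by
      induction k with
      | zero => simp
      | succ k ih => rw [pow_succ', Module.End.mul_apply, ih, pow_succ', mul_smul]; rfl
    rw [this]
  obtain ⟨v, hv⟩ := hdiv (n + 1) 1
  have h1 : x ^ (n + 1) • W.mkQ v = 0 := by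
    rw [← map_smul, hv, Submodule.mkQ_apply, Submodule.Quotient.mk_eq_zero]
    exact ⟨_, rfl⟩
  have h2 : x ^ n • W.mkQ v = 0 := by
    rw [← hit, hn1, hit]; exact h1
  rw [← map_smul, Submodule.mkQ_apply, Submodule.Quotient.mk_eq_zero] at h2
  obtain ⟨s, hs⟩ := h2
  have h3 : f (x * s - 1) = 0 := by
    rw [map_sub, ← smul_eq_mul, map_smul, hs, ← hv, pow_succ', mul_smul, sub_self]
  rw [hf0] at h3
  have h4 : (1 : R) ∈ IsLocalRing.maximalIdeal R := by
    have := sub_mem (Ideal.mul_mem_right s _ (hrm hxr)) (hPm h3)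
    simpa using this
  exact (IsLocalRing.maximalIdeal R).ne_top_iff_one.mp
    (IsLocalRing.maximalIdeal.isMaximal R).ne_top h4

/-- Over a noetherian local ring of positive dimension with at least two primes of
height `dim R - 1`, a nonzero Serre class of finitely generated modules has no prime
of height at least `dim R - 1` in `MP[S]`. -/
theorem stmt_6 {R : Type} [CommRing R] [IsNoetherianRing R] [IsLocalRing R]
    (hdim : 0 < ringKrullDim R)
    (S : SerreClass R) (hS : ∃ M : ModuleCat.{0} R, S.mem M ∧ Nontrivial M)
    (hfg : ∀ M : ModuleCat.{0} R, S.mem M → Module.Finite R M)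
    (p q : PrimeSpectrum R) (hpq : p ≠ q)
    (hp : (Order.height p : WithBot ℕ∞) + 1 = ringKrullDim R)
    (hq : (Order.height q : WithBot ℕ∞) + 1 = ringKrullDim R) :
    ∀ r : PrimeSpectrum R, (Order.height r : WithBot ℕ∞) + 1 ≥ ringKrullDim R →
      r ∉ MP R S.mem := by
  have hfin : ∀ a : PrimeSpectrum R, Order.height a ≠ ⊤ := by
    intro a h
    have h1 := Ideal.height_ne_top_of_isPrime (I := a.asIdeal)
    rw [PrimeSpectrum.height_eq_orderHeight] at h1
    exact h1 h
  intro r hr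
  have key : ∀ P : PrimeSpectrum R, (Order.height P : WithBot ℕ∞) + 1 = ringKrullDim R →
      (∀ Q : PrimeSpectrum R, P < Q → Q.asIdeal = IsLocalRing.maximalIdeal R) ∧
      (r ≤ P → r = P) := by
    intro P hP
    constructor
    · intro Q hPQ
      by_contra hne
      have hlt : Q < IsLocalRing.closedPoint R :=
        lt_of_le_of_ne (IsLocalRing.le_maximalIdeal Q.isPrime.ne_top)
          (fun h => hne (by rw [h]; rfl))
      have h1 := Order.height_add_one_le hPQ
      have h2 := Order.height_add_one_le hlt
      have h3 : (Order.height (IsLocalRing.closedPoint R) : WithBot ℕ∞) ≤ ringKrullDim R :=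
        Order.height_le_krullDim _
      rw [← hP] at h3
      have h4 : Order.height (IsLocalRing.closedPoint R) ≤ Order.height P + 1 := by
        exact_mod_cast h3
      have h5 : Order.height Q + 1 ≤ Order.height Q := (h2.trans h4).trans h1
      exact absurd (ENat.add_one_le_iff (hfin Q) |>.mp h5) (lt_irrefl _)
    · intro hle
      by_contra hne
      have h1 := Order.height_strictMono (lt_of_le_of_ne hle hne) (hfin r).lt_top
      rw [← hP] at hr
      have h2 : Order.height P + 1 ≤ Order.height r + 1 := by exact_mod_cast hr
      exact absurd ((ENat.add_le_add_iff_right ENat.one_ne_top).mp h2) (not_le.mpr h1)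
  obtain ⟨hp1, hp2⟩ := key p hp
  obtain ⟨hq1, hq2⟩ := key q hq
  by_cases h : r ≤ p
  · refine aux_main S hS hfg q r (fun h' => hpq ?_) hq1
    rw [← hp2 h, ← hq2 h']
  · exact aux_main S hS hfg p r h hp1
end

section
/- Let R be a commutative noetherian ring and S a Serre subcategory of the category of R-modules. For every prime ideal p of R with height p > 0 and p ∉ Supp(S), the local cohomology module H^{ht p}_p(R) does not belong to the extension subcategory FG * S. -/
/-!
Common framework: a *Serre class* is a class of (bundled) `R`-modules closed under
submodules, quotient modules and extensions.  `MelkerssonCondition R P I` is the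
Melkersson condition `(C_I)`: if `Γ_I(M) = M` (every element of `M` is annihilated by
some power of `I`) and `(0 :_M I)` (the `I`-torsion-by-`I` submodule `torsionBySet`)
belongs to the class, then `M` belongs to the class.  `MP R P` is the set of prime
ideals `p` such that the class satisfies `(C_p)`.
-/

open CategoryTheory

variable (R : Type) [CommRing R]

namespace LC
section
variable {R : Type} [CommRing R]

/-- the module `R / I ^ t` -/
abbrev X (I : Ideal R) (t : ℕ) : ModuleCat.{0} R := ModuleCat.of R (R ⧸ I ^ t)

/-- transition map -/
noncomputable abbrev tr (I : Ideal R) {s t : ℕ} (h : s ≤ t) : X I t ⟶ X I s :=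
  ModuleCat.ofHom (Submodule.mapQ _ _ LinearMap.id (Ideal.pow_le_pow_right h))

lemma tr_self (I : Ideal R) (s : ℕ) : tr I (le_refl s) = 𝟙 _ := by
  refine ModuleCat.hom_ext (LinearMap.ext fun x => ?_)
  obtain ⟨x, rfl⟩ := Submodule.Quotient.mk_surjective _ x
  rfl

lemma tr_comp (I : Ideal R) {s t u : ℕ} (h : s ≤ t) (h' : t ≤ u) :
    tr I h' ≫ tr I h = tr I (h.trans h') := by
  refine ModuleCat.hom_ext (LinearMap.ext fun x => ?_)
  obtain ⟨x, rfl⟩ := Submodule.Quotient.mk_surjective _ x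
  rfl

noncomputable abbrev G (I : Ideal R) (i : ℕ) (M : ModuleCat.{0} R) (t : ℕ) : Type :=
  Abelian.Ext.{0} (X I t) M i

noncomputable abbrev gf (I : Ideal R) (i : ℕ) (M : ModuleCat.{0} R) (s t : ℕ) (h : s ≤ t) :
    G I i M s →ₗ[R] G I i M t :=
  (Abelian.Ext.mk₀ (tr I h)).precompOfLinear R M (zero_add i)

instance (I : Ideal R) (i : ℕ) (M : ModuleCat.{0} R) :
    DirectedSystem (G I i M) (fun s t h => gf I i M s t h) where
  map_self s x := by
    simp [tr_self]
  map_map s t u h h' x := by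
    simp [← tr_comp I h h']

/-- Local cohomology as a concrete direct limit. -/
noncomputable abbrev H (I : Ideal R) (i : ℕ) (M : ModuleCat.{0} R) : Type :=
  Module.DirectLimit (G I i M) (gf I i M)

noncomputable abbrev ι (I : Ideal R) (i : ℕ) (M : ModuleCat.{0} R) (t : ℕ) :
    G I i M t →ₗ[R] H I i M := Module.DirectLimit.of R ℕ (G I i M) (gf I i M) t

lemma ι_eq_zero {I : Ideal R} {i : ℕ} {M : ModuleCat.{0} R} {t : ℕ} {x : G I i M t}
    (hx : ι I i M t x = 0) : ∃ (u : ℕ) (h : t ≤ u), gf I i M t u h x = 0 :=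
  Module.DirectLimit.of.zero_exact hx

noncomputable def post (I : Ideal R) {M N : ModuleCat.{0} R} {k : ℕ} (β : Abelian.Ext.{0} M N k)
    {i j : ℕ} (h : i + k = j) : H I i M →ₗ[R] H I j N :=
  Module.DirectLimit.map (fun t => β.postcompOfLinear R (X I t) h) (by
    intro s t hst
    ext x
    simp
    rw [Abelian.Ext.comp_assoc]
    omega)

@[simp] lemma post_ι (I : Ideal R) {M N : ModuleCat.{0} R} {k : ℕ} (β : Abelian.Ext.{0} M N k)
    {i j : ℕ} (h : i + k = j) (t : ℕ) (x : G I i M t) :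
    post I β h (ι I i M t x) = ι I j N t (x.comp β h) :=
  Module.DirectLimit.map_apply_of ..

lemma exists_ι {I : Ideal R} {i : ℕ} {M : ModuleCat.{0} R} (x : H I i M) :
    ∃ t y, ι I i M t y = x := Module.DirectLimit.exists_of x

variable (I : Ideal R)

noncomputable abbrev Hmap (i : ℕ) {M N : ModuleCat.{0} R} (f : M ⟶ N) : H I i M →ₗ[R] H I i N :=
  post I (Abelian.Ext.mk₀ f) (add_zero i)

noncomputable abbrev Hδ (i : ℕ) {S : ShortComplex (ModuleCat.{0} R)} (hS : S.ShortExact) :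
    H I i S.X₃ →ₗ[R] H I (i+1) S.X₁ :=
  post I hS.extClass rfl

lemma ι_gf {i : ℕ} {M : ModuleCat.{0} R} {s t : ℕ} (h : s ≤ t) (x : G I i M s) :
    ι I i M t (gf I i M s t h x) = ι I i M s x := Module.DirectLimit.of_f

/-- generic exactness -/
lemma post_exact {M N P : ModuleCat.{0} R} {k l : ℕ} (β : Abelian.Ext.{0} M N k)
    (γ : Abelian.Ext.{0} N P l) {i j m : ℕ} (h : i + k = j) (h' : j + l = m)
    (h0 : β.comp γ rfl = 0)
    (hex : ∀ (Y : ModuleCat.{0} R) (x : Abelian.Ext.{0} Y N j), x.comp γ h' = 0 →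
      ∃ y : Abelian.Ext.{0} Y M i, y.comp β h = x) :
    Function.Exact (post I β h) (post I γ h') := by
  intro x
  constructor
  · intro hx
    obtain ⟨t, x, rfl⟩ := exists_ι x
    rw [post_ι] at hx
    obtain ⟨u, hu, hx⟩ := ι_eq_zero hx
    have : (gf I j N t u hu x).comp γ h' = 0 := by
      rw [← hx]
      simp
      rw [Abelian.Ext.comp_assoc]
      omega
    obtain ⟨y, hy⟩ := hex _ _ this
    refine ⟨ι I i M u y, ?_⟩
    rw [post_ι, hy, ι_gf]
  · rintro ⟨y, rfl⟩
    obtain ⟨t, y, rfl⟩ := exists_ι y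
    rw [post_ι, post_ι, Abelian.Ext.comp_assoc y β γ h rfl (by omega), h0]
    simp

lemma exact₂ {S : ShortComplex (ModuleCat.{0} R)} (hS : S.ShortExact) (i : ℕ) : Function.Exact (Hmap I i S.f) (Hmap I i S.g) :=
  post_exact I _ _ _ _ (by simp) (fun Y x hx => Abelian.Ext.covariant_sequence_exact₂ Y hS x hx)

lemma exact₃ {S : ShortComplex (ModuleCat.{0} R)} (hS : S.ShortExact) (i : ℕ) : Function.Exact (Hmap I i S.g) (Hδ I i hS) :=
  post_exact I _ _ _ _ (by simp) (fun Y x hx => Abelian.Ext.covariant_sequence_exact₃ Y hS x rfl hx)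

lemma exact₁ {S : ShortComplex (ModuleCat.{0} R)} (hS : S.ShortExact) (i : ℕ) : Function.Exact (Hδ I i hS) (Hmap I (i+1) S.f) :=
  post_exact I _ _ _ _ (by simp) (fun Y x hx => Abelian.Ext.covariant_sequence_exact₁ Y hS x hx rfl)

lemma Hmap_smul_id (i : ℕ) (M : ModuleCat.{0} R) (r : R) (x : H I i M) :
    Hmap I i (r • 𝟙 M) x = r • x := by
  obtain ⟨t, x, rfl⟩ := exists_ι x
  rw [Hmap, post_ι, ← Abelian.Ext.smul_eq_comp_mk₀, map_smul]

lemma H_torsion (i : ℕ) (M : ModuleCat.{0} R) (x : H I i M) : ∃ t, ∀ r ∈ I ^ t, r • x = 0 := by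
  obtain ⟨t, x, rfl⟩ := exists_ι x
  refine ⟨t, fun r hr => ?_⟩
  have h1 : r • 𝟙 (X I t) = 0 := by
    refine ModuleCat.hom_ext (LinearMap.ext fun x => ?_)
    obtain ⟨x, rfl⟩ := Submodule.Quotient.mk_surjective _ x
    change Submodule.Quotient.mk (r • x) = 0
    rw [Submodule.Quotient.mk_eq_zero]
    exact Ideal.mul_mem_right _ _ hr
  have h2 : r • x = 0 := by
    rw [← Abelian.Ext.mk₀_id_comp x, ← Abelian.Ext.smul_comp, ← Abelian.Ext.mk₀_smul, h1]
    simp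
  rw [← map_smul, h2, map_zero]

/-- degree zero -/
noncomputable def ev (M : ModuleCat.{0} R) (t : ℕ) : G I 0 M t →ₗ[R] M :=
  (LinearMap.applyₗ (R := R) (Submodule.Quotient.mk (1 : R) : R ⧸ I ^ t)) ∘ₗ
    ((ModuleCat.homLinearEquiv (S := R)).toLinearMap ∘ₗ
      (Abelian.Ext.linearEquiv₀ (R := R)).toLinearMap)

lemma ev_mk₀ (M : ModuleCat.{0} R) (t : ℕ) (f : X I t ⟶ M) :
    ev I M t (Abelian.Ext.mk₀ f) = f.hom (Submodule.Quotient.mk (1 : R)) := by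
  simp only [ev, LinearMap.comp_apply, LinearEquiv.coe_coe]
  rw [← Abelian.Ext.linearEquiv₀_symm_apply (R := R), LinearEquiv.apply_symm_apply]
  rfl

lemma exists_mk₀ (M N : ModuleCat.{0} R) (x : Abelian.Ext.{0} M N 0) :
    ∃ f, Abelian.Ext.mk₀ f = x := ⟨_, Abelian.Ext.mk₀_linearEquiv₀_apply (R := R) x⟩

noncomputable def H0 (M : ModuleCat.{0} R) : H I 0 M →ₗ[R] M :=
  Module.DirectLimit.lift R ℕ _ _ (ev I M) (by
    intro s t h x
    obtain ⟨f, rfl⟩ := exists_mk₀ _ _ x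
    simp [ev_mk₀])

lemma H0_ι (M : ModuleCat.{0} R) (t : ℕ) (x) : H0 I M (ι I 0 M t x) = ev I M t x :=
  Module.DirectLimit.lift_of ..

lemma H0_injective (M : ModuleCat.{0} R) : Function.Injective (H0 I M) := by
  refine Module.DirectLimit.lift_injective _ _ ?_
  intro t
  rw [← LinearMap.ker_eq_bot, LinearMap.ker_eq_bot']
  intro x hx
  obtain ⟨f, rfl⟩ := exists_mk₀ _ _ x
  rw [ev_mk₀] at hx
  have : f = 0 := by
    refine ModuleCat.hom_ext (LinearMap.ext fun x => ?_)
    obtain ⟨x, rfl⟩ := Submodule.Quotient.mk_surjective _ x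
    have : (Submodule.Quotient.mk x : R ⧸ I ^ t) = x • Submodule.Quotient.mk (1 : R) := by
      rw [← Submodule.Quotient.mk_smul]; simp
    rw [this, map_smul, hx]; simp
  simp [this]

lemma H0_natural {M N : ModuleCat.{0} R} (f : M ⟶ N) (x : H I 0 M) :
    H0 I N (Hmap I 0 f x) = f.hom (H0 I M x) := by
  obtain ⟨t, x, rfl⟩ := exists_ι x
  obtain ⟨g, rfl⟩ := exists_mk₀ _ _ x
  rw [Hmap, post_ι, H0_ι, H0_ι, Abelian.Ext.mk₀_comp_mk₀, ev_mk₀, ev_mk₀]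
  rfl

lemma H0_mem {M : ModuleCat.{0} R} (m : M) (t : ℕ) (hm : ∀ r ∈ I ^ t, r • m = 0) :
    ∃ x, H0 I M x = m := by
  refine ⟨ι I 0 M t (Abelian.Ext.mk₀ (ModuleCat.ofHom
    (Submodule.liftQ _ (LinearMap.toSpanSingleton R M m) ?_))), ?_⟩
  · intro r hr; exact hm r hr
  · rw [H0_ι, ev_mk₀]
    exact (Submodule.liftQ_apply _ _ _).trans (by simp)

end
end LC

namespace LC
section
variable {R : Type} [CommRing R]

/-- the `I`-power torsion submodule -/
def Gam (I : Ideal R) (M : Type) [AddCommGroup M] [Module R M] : Submodule R M where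
  carrier := {m | ∃ t, ∀ r ∈ I ^ t, r • m = 0}
  zero_mem' := ⟨0, by simp⟩
  add_mem' := by
    rintro a b ⟨t, ht⟩ ⟨u, hu⟩
    refine ⟨max t u, fun r hr => ?_⟩
    rw [smul_add, ht r (Ideal.pow_le_pow_right (le_max_left _ _) hr),
      hu r (Ideal.pow_le_pow_right (le_max_right _ _) hr), add_zero]
  smul_mem' := by
    rintro c a ⟨t, ht⟩
    refine ⟨t, fun r hr => ?_⟩
    rw [smul_comm, ht r hr, smul_zero]

lemma mem_Gam {I : Ideal R} {M : Type} [AddCommGroup M] [Module R M] {m : M} :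
    m ∈ Gam I M ↔ ∃ t, ∀ r ∈ I ^ t, r • m = 0 := Iff.rfl

/-- finitely generated torsion modules are killed by a power -/
lemma exists_pow_kill (I : Ideal R) {M : Type} [AddCommGroup M] [Module R M] [Module.Finite R M]
    (hM : ∀ m : M, ∃ t, ∀ r ∈ I ^ t, r • m = 0) : ∃ t, ∀ r ∈ I ^ t, ∀ m : M, r • m = 0 := by
  obtain ⟨s, hs⟩ := Module.Finite.fg_top (R := R) (M := M)
  choose t ht using hM
  refine ⟨s.sup t, fun r hr m => ?_⟩
  have hm : m ∈ Submodule.span R (s : Set M) := hs ▸ Submodule.mem_top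
  induction hm using Submodule.span_induction with
  | mem x hx => exact ht x r (Ideal.pow_le_pow_right (Finset.le_sup hx) hr)
  | zero => simp
  | add x y _ _ hx hy => rw [smul_add, hx, hy, add_zero]
  | smul a x _ hx => rw [smul_comm, hx, smul_zero]

lemma Gam_injective [IsNoetherianRing R] (I : Ideal R) (E : Type) [AddCommGroup E] [Module R E]
    [Module.Injective R E] : Module.Injective R (Gam I E) := by
  apply Module.Baer.injective
  intro J g
  have h1 : ∃ k, ∀ r ∈ I ^ k, ∀ m : J, r • g m = 0 := by
    obtain ⟨k, hk⟩ := exists_pow_kill I (M := LinearMap.range g) (by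
      rintro ⟨⟨m, t, hm⟩, hm'⟩
      refine ⟨t, fun r hr => ?_⟩
      ext
      exact hm r hr)
    refine ⟨k, fun r hr m => ?_⟩
    have := hk r hr ⟨g m, m, rfl⟩
    simpa [Subtype.ext_iff] using this
  obtain ⟨k, hk⟩ := h1
  obtain ⟨k0, hk0⟩ := Ideal.exists_pow_inf_eq_pow_smul I (J : Submodule R R)
  have h2 := hk0 (k + k0) (by omega)
  set n := k + k0 with hn
  have hle : (I ^ n • ⊤ ⊓ J : Submodule R R) ≤ I ^ k • J := by
    rw [h2]
    have : n - k0 = k := by omega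
    rw [this]
    exact Submodule.smul_mono le_rfl inf_le_right
  have hz : ∀ (x : R), x ∈ I ^ k • (J : Submodule R R) → ∀ hx : x ∈ J, g ⟨x, hx⟩ = 0 := by
    intro x hx
    refine Submodule.smul_induction_on' hx ?_ ?_
    · intro r hr m hm hx
      have : (⟨r • m, hx⟩ : J) = r • ⟨m, hm⟩ := rfl
      rw [this, map_smul, hk r hr]
    · intro x hx y hy h1 h2 h3
      have hx' : x ∈ J := Submodule.smul_le_right hx
      have hy' : y ∈ J := Submodule.smul_le_right hy
      have : (⟨x + y, h3⟩ : J) = ⟨x, hx'⟩ + ⟨y, hy'⟩ := rfl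
      rw [this, map_add, h1, h2, add_zero]
  let φ : J →ₗ[R] (R ⧸ I ^ n) := (Submodule.mkQ _) ∘ₗ J.subtype
  have hφ : LinearMap.ker φ ≤ LinearMap.ker ((Gam I E).subtype ∘ₗ g) := by
    rintro ⟨x, hx⟩ hxx
    have h3 : x ∈ I ^ n := by
      simpa [φ, Ideal.Quotient.eq_zero_iff_mem] using hxx
    have h4 := hz x (hle ⟨by simpa using h3, hx⟩) hx
    simp [h4]
  obtain ⟨h, hh⟩ := Module.Injective.out ((LinearMap.ker φ).liftQ φ le_rfl)
    (LinearMap.ker_eq_bot.1 (Submodule.ker_liftQ_eq_bot _ _ _ le_rfl))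
    ((LinearMap.ker φ).liftQ _ hφ)
  refine ⟨LinearMap.codRestrict _ (h ∘ₗ Submodule.mkQ _) ?_, ?_⟩
  · intro c
    refine ⟨n, fun r hr => ?_⟩
    rw [← map_smul]
    have : (r • c : R) ∈ I ^ n := Ideal.mul_mem_right _ _ hr
    rw [LinearMap.comp_apply, Submodule.mkQ_apply, (Submodule.Quotient.mk_eq_zero _).2 this, map_zero]
  · intro x hx
    ext
    exact hh (Submodule.Quotient.mk ⟨x, hx⟩)

lemma mkSES {A M B : ModuleCat.{0} R} (f : A →ₗ[R] M) (g : M →ₗ[R] B)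
    (hf : Function.Injective f) (hg : Function.Surjective g) (hfg : Function.Exact f g) :
    (ShortComplex.mk (ModuleCat.ofHom f) (ModuleCat.ofHom g)
      (ModuleCat.hom_ext hfg.linearMap_comp_eq_zero)).ShortExact where
  exact := (ShortComplex.ShortExact.moduleCat_exact_iff_function_exact _).2 hfg
  mono_f := (ModuleCat.mono_iff_injective _).2 hf
  epi_g := (ModuleCat.epi_iff_surjective _).2 hg

lemma exists_torsion_injective [IsNoetherianRing R] (I : Ideal R) (M : ModuleCat.{0} R)
    (hM : ∀ m : M, ∃ t, ∀ r ∈ I ^ t, r • m = 0) :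
    ∃ (J : ModuleCat.{0} R) (f : M →ₗ[R] J), Function.Injective f ∧ Injective J ∧
      ∀ m : J, ∃ t, ∀ r ∈ I ^ t, r • m = 0 := by
  let E : ModuleCat.{0} R := Injective.under M
  have hE' : Injective E := (inferInstance : Injective (Injective.under M))
  have hE : Injective (ModuleCat.of R E) := hE'
  have : Module.Injective R E := Module.injective_module_of_injective_object R E
  have := Gam_injective I E
  refine ⟨ModuleCat.of R (Gam I E), LinearMap.codRestrict (Gam I E) (Injective.ι M).hom ?_, ?_,
    Module.injective_object_of_injective_module R _, ?_⟩
  · intro m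
    obtain ⟨t, ht⟩ := hM m
    refine ⟨t, fun r hr => ?_⟩
    rw [← map_smul, ht r hr, map_zero]
  · rw [← LinearMap.ker_eq_bot, LinearMap.ker_codRestrict, LinearMap.ker_eq_bot]
    exact (ModuleCat.mono_iff_injective _).1 inferInstance
  · rintro ⟨m, t, ht⟩
    exact ⟨t, fun r hr => Subtype.ext (ht r hr)⟩

lemma H_injective_eq_zero (I : Ideal R) (i : ℕ) (J : ModuleCat.{0} R) [Injective J]
    (x : H I (i + 1) J) : x = 0 := by
  obtain ⟨t, x, rfl⟩ := exists_ι x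
  rw [Abelian.Ext.eq_zero_of_injective x, map_zero]

lemma H_vanish [IsNoetherianRing R] (I : Ideal R) (i : ℕ) : ∀ (M : ModuleCat.{0} R)
    (_ : ∀ m : M, ∃ t, ∀ r ∈ I ^ t, r • m = 0) (x : H I (i + 1) M), x = 0 := by
  induction i with
  | zero =>
    intro M hM x
    obtain ⟨J, f, hf, hJ, hJt⟩ := exists_torsion_injective I M hM
    have hS := mkSES (B := ModuleCat.of R (J ⧸ LinearMap.range f)) f (Submodule.mkQ _) hf
      (Submodule.mkQ_surjective _) (LinearMap.exact_map_mkQ_range f)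
    obtain ⟨y, rfl⟩ := (exact₁ I hS 0 x).1 (H_injective_eq_zero I 0 J _)
    rw [exact₃ I hS 0 y]
    obtain ⟨j, hj⟩ := Submodule.mkQ_surjective _ (H0 I _ y)
    obtain ⟨t, ht⟩ := hJt j
    obtain ⟨z, hz⟩ := H0_mem I j t ht
    refine ⟨z, H0_injective I _ ?_⟩
    refine (H0_natural I _ z).trans ?_
    rw [hz]
    exact hj
  | succ i ih =>
    intro M hM x
    obtain ⟨J, f, hf, hJ, hJt⟩ := exists_torsion_injective I M hM
    have hS := mkSES (B := ModuleCat.of R (J ⧸ LinearMap.range f)) f (Submodule.mkQ _) hf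
      (Submodule.mkQ_surjective _) (LinearMap.exact_map_mkQ_range f)
    obtain ⟨y, rfl⟩ := (exact₁ I hS (i + 1) x).1 (H_injective_eq_zero I (i + 1) J _)
    have : y = 0 := by
      refine ih _ ?_ y
      intro m
      obtain ⟨j, rfl⟩ := Submodule.mkQ_surjective _ m
      obtain ⟨t, ht⟩ := hJt j
      refine ⟨t, fun r hr => ?_⟩
      rw [← map_smul, ht r hr, map_zero]
    rw [this, map_zero]
end
end LC

namespace LC
section
variable {L : Type} [CommRing L] {N : Type} [AddCommGroup N] [Module L N]

/-- auxiliary: elements of `ker r` of the form `r ^ t u`, `u ∈ U`. -/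
def melkF (r : L) (U : Submodule L N) (t : ℕ) : Submodule L (LinearMap.ker (LinearMap.lsmul L N r)) :=
  (U.map (LinearMap.lsmul L N (r ^ t))).comap (Submodule.subtype _)

lemma mem_melkF {r : L} {U : Submodule L N} {t : ℕ} {x : LinearMap.ker (LinearMap.lsmul L N r)} :
    x ∈ melkF r U t ↔ ∃ u ∈ U, r ^ t • u = (x : N) := Iff.rfl

lemma melkF_anti (r : L) {U V : Submodule L N} {s t : ℕ} (hUV : V ≤ U) (hst : s ≤ t) :
    melkF r V t ≤ melkF r U s := by
  intro x hx
  obtain ⟨u, hu, hx⟩ := mem_melkF.1 hx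
  refine mem_melkF.2 ⟨r ^ (t - s) • u, U.smul_mem _ (hUV hu), ?_⟩
  rw [smul_smul, ← pow_add, ← hx]
  congr 2
  omega

lemma melk_aux (r : L) (ht : ∀ x : N, ∃ t : ℕ, r ^ t • x = 0) {U V : Submodule L N} (hVU : V ≤ U)
    (h : ∀ t, melkF r U t = melkF r V t) : U = V := by
  refine le_antisymm (fun x hx => ?_) hVU
  obtain ⟨t, hxt⟩ := ht x
  induction t generalizing x with
  | zero => simp at hxt; simp [hxt]
  | succ t ih =>
    have h1 : (⟨r ^ t • x, by simpa [pow_succ, mul_smul] using hxt⟩ :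
        LinearMap.ker (LinearMap.lsmul L N r)) ∈ melkF r U t := mem_melkF.2 ⟨x, hx, rfl⟩
    rw [h t] at h1
    obtain ⟨y, hy, hyx⟩ := mem_melkF.1 h1
    have h2 := ih (x - y) (U.sub_mem hx (hVU hy)) (by
      rw [smul_sub, hyx]; simp)
    simpa using V.add_mem h2 hy

/-- Melkersson's criterion. -/
lemma melk (r : L) (ht : ∀ x : N, ∃ t : ℕ, r ^ t • x = 0)
    [IsArtinian L (LinearMap.ker (LinearMap.lsmul L N r))] : IsArtinian L N := by
  rw [← monotone_stabilizes_iff_artinian]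
  intro f
  have key : ∀ g : ℕ →o (Submodule L (LinearMap.ker (LinearMap.lsmul L N r)))ᵒᵈ,
      ∃ n, ∀ m, n ≤ m → g n = g m := monotone_stabilizes_iff_artinian.2 inferInstance
  let F : ℕ → ℕ → Submodule L (LinearMap.ker (LinearMap.lsmul L N r)) :=
    fun s t => melkF r (OrderDual.ofDual (f s)) t
  have hF : ∀ {s s' t t'}, s ≤ s' → t ≤ t' → F s' t' ≤ F s t := fun h h' =>
    melkF_anti r (f.monotone h) h'
  obtain ⟨n, hn⟩ := key ⟨fun t => OrderDual.toDual (F t t), fun a b hab => hF hab hab⟩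
  have hn' : ∀ m, n ≤ m → F n n = F m m := hn
  have h2 : ∀ t, ∃ n, ∀ m, n ≤ m → F n t = F m t := fun t =>
    key ⟨fun s => OrderDual.toDual (F s t), fun a b hab => hF hab le_rfl⟩
  choose k hk using h2
  refine ⟨n + ∑ t ∈ Finset.range n, k t, fun m hm => ?_⟩
  set m0 := n + ∑ t ∈ Finset.range n, k t with hm0
  refine melk_aux r ht (f.monotone hm) (fun t => ?_)
  change F m0 t = F m t
  by_cases htn : n ≤ t
  · have h3 : ∀ s, n ≤ s → F s t = F n n := fun s hs =>
      le_antisymm (hF hs htn) (by rw [hn' (max s t) (hs.trans (le_max_left _ _))]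
                                  exact hF (le_max_left _ _) (le_max_right _ _))
    rw [h3 m0 (by omega), h3 m (by omega)]
  · have h4 : k t ≤ m0 := by
      have := Finset.single_le_sum (f := k) (fun _ _ => Nat.zero_le _)
        (Finset.mem_range.2 (not_le.1 htn))
      omega
    rw [← hk t m0 h4, ← hk t m (h4.trans hm)]

end

section
variable {L : Type} [CommRing L] [IsNoetherianRing L] [IsLocalRing L]
  {N : Type} [AddCommGroup N] [Module L N]

lemma artin_iff_of_kill (k : ℕ) (hk : ∀ r ∈ IsLocalRing.maximalIdeal L ^ k, ∀ x : N, r • x = 0) :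
    IsArtinian L N ↔ Module.Finite L N := by
  set m := IsLocalRing.maximalIdeal L
  have hk' : ∀ r ∈ m ^ (k + 1), ∀ x : N, r • x = 0 := fun r hr =>
    hk r (Ideal.pow_le_pow_right (Nat.le_succ k) hr)
  have hm1 : m ^ (k + 1) ≤ m := Ideal.pow_le_self (Nat.succ_ne_zero k)
  have hne : m ^ (k + 1) ≠ ⊤ := fun h => (IsLocalRing.maximalIdeal.isMaximal L).ne_top
    (top_le_iff.1 (h ▸ hm1))
  have : Nontrivial (L ⧸ m ^ (k + 1)) := Ideal.Quotient.nontrivial_iff.2 hne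
  have : IsLocalRing (L ⧸ m ^ (k + 1)) :=
    IsLocalRing.of_surjective' (Ideal.Quotient.mk _) Ideal.Quotient.mk_surjective
  have : IsArtinianRing (L ⧸ m ^ (k + 1)) := by
    rw [isArtinianRing_iff_isNilpotent_maximalIdeal]
    refine ⟨k + 1, ?_⟩
    have : IsLocalRing.maximalIdeal (L ⧸ m ^ (k + 1)) ≤ m.map (Ideal.Quotient.mk _) := by
      intro x hx
      obtain ⟨x, rfl⟩ := Ideal.Quotient.mk_surjective x
      refine Ideal.mem_map_of_mem _ ?_
      by_contra hx'
      have hu : IsUnit x := by simpa [m] using hx'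
      exact hx (hu.map _)
    rw [Ideal.zero_eq_bot, ← le_bot_iff]
    refine (Ideal.pow_right_mono this _).trans ?_
    rw [← Ideal.map_pow, Ideal.map_quotient_self]
  have hT : Module.IsTorsionBySet L N (m ^ (k + 1) : Ideal L) := fun x r => hk' r r.2 x
  let _ := hT.module
  have : IsScalarTower L (L ⧸ m ^ (k + 1)) N := hT.isScalarTower
  have e := (IsArtinianRing.tfae (L ⧸ m ^ (k + 1)) N).out 0 2
  constructor
  · intro h
    have h1 : IsArtinian (L ⧸ m ^ (k + 1)) N := isArtinian_of_tower L h
    have := e.2 h1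
    exact Module.Finite.trans (L ⧸ m ^ (k + 1)) N
  · intro h
    have : Module.Finite (L ⧸ m ^ (k + 1)) N := Module.Finite.of_restrictScalars_finite L _ _
    have := e.1 this
    exact isArtinian_of_surjective_algebraMap (R := L ⧸ m ^ (k + 1)) Ideal.Quotient.mk_surjective

lemma supIrred_dich {U : Submodule L N} [IsArtinian L N] (hU : SupIrred U) (r : L) :
    U.map (LinearMap.lsmul L N r) = U ∨ ∃ k : ℕ, ∀ x ∈ U, r ^ k • x = 0 := by
  let W : ℕ → Submodule L N := fun k => U.map (LinearMap.lsmul L N (r ^ k))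
  have hW : ∀ {a b}, a ≤ b → W b ≤ W a := by
    rintro a b hab _ ⟨u, hu, rfl⟩
    refine ⟨r ^ (b - a) • u, U.smul_mem _ hu, ?_⟩
    simp only [LinearMap.lsmul_apply, smul_smul, ← pow_add]
    congr 2
    omega
  have key : ∀ g : ℕ →o (Submodule L N)ᵒᵈ,
      ∃ n, ∀ m, n ≤ m → g n = g m := monotone_stabilizes_iff_artinian.2 inferInstance
  obtain ⟨n, hn⟩ := key ⟨fun t => OrderDual.toDual (W t), fun a b hab => hW hab⟩
  have hn' : ∀ m, n ≤ m → W n = W m := hn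
  have hWU : ∀ k, W k ≤ U := by
    rintro k _ ⟨u, hu, rfl⟩
    exact U.smul_mem _ hu
  have hsup : W (n + 1) ⊔ (U ⊓ LinearMap.ker (LinearMap.lsmul L N (r ^ (n + 1)))) = U := by
    refine le_antisymm (sup_le (hWU _) inf_le_left) (fun u hu => ?_)
    have h1 : r ^ (n + 1) • u ∈ W (n + 1) := ⟨u, hu, rfl⟩
    rw [← hn' (n + 1) (by omega), hn' ((n + 1) + (n + 1)) (by omega)] at h1
    obtain ⟨v, hv, hvu⟩ := h1
    rw [Submodule.mem_sup]
    refine ⟨r ^ (n + 1) • v, ⟨v, hv, rfl⟩, u - r ^ (n + 1) • v, ⟨U.sub_mem hu (U.smul_mem _ hv), ?_⟩,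
      by simp⟩
    change r ^ (n + 1) • (u - r ^ (n + 1) • v) = 0
    rw [LinearMap.lsmul_apply] at hvu
    rw [smul_sub, smul_smul, ← pow_add, hvu, sub_self]
  rcases hU.2 hsup with h | h
  · left
    refine le_antisymm ?_ ?_
    · have := hWU 1
      simpa [W] using this
    · have h1 : W (n + 1) ≤ W 1 := hW (by omega)
      rw [h] at h1
      simpa [W] using h1
  · right
    refine ⟨n + 1, fun x hx => ?_⟩
    rw [← h] at hx
    exact hx.2

lemma map_lsmul_mul (U : Submodule L N) (a b : L) : U.map (LinearMap.lsmul L N (a * b)) =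
    (U.map (LinearMap.lsmul L N b)).map (LinearMap.lsmul L N a) := by
  rw [← Submodule.map_comp]
  congr 1
  ext x
  simp [mul_smul, smul_comm a b x]

lemma supIrred_prime {U : Submodule L N} [IsArtinian L N] (hU : SupIrred U) :
    Module.Finite L U ∨ ∃ q : Ideal L, q.IsPrime ∧ q ≠ IsLocalRing.maximalIdeal L ∧
      ∀ r ∉ q, U.map (LinearMap.lsmul L N r) = U := by
  let q : Ideal L := (Module.annihilator L U).radical
  have hq : ∀ r, r ∈ q ↔ ∃ k : ℕ, ∀ x ∈ U, r ^ k • x = 0 := by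
    intro r
    simp [q, Ideal.mem_radical_iff, Module.mem_annihilator, Subtype.ext_iff]
  have hr : ∀ r ∉ q, U.map (LinearMap.lsmul L N r) = U := fun r h =>
    (supIrred_dich hU r).resolve_right (fun h' => h ((hq r).2 h'))
  have hU0 : U ≠ ⊥ := fun h => hU.1 (h ▸ isMin_bot)
  have hpow : ∀ r, U.map (LinearMap.lsmul L N r) = U → r ∉ q := by
    intro r h hrq
    obtain ⟨k, hk⟩ := (hq r).1 hrq
    have : ∀ k : ℕ, U.map (LinearMap.lsmul L N (r ^ k)) = U := by
      intro k
      induction k with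
      | zero => ext; simp
      | succ k ih =>
        rw [pow_succ', map_lsmul_mul, ih, h]
    apply hU0
    rw [eq_bot_iff]
    intro x hx
    rw [← this k] at hx
    obtain ⟨y, hy, rfl⟩ := hx
    exact hk y hy
  have hprime : q.IsPrime := by
    refine ⟨fun h => hpow 1 (by ext; simp) (h ▸ Submodule.mem_top), ?_⟩
    intro a b hab
    by_contra! hcon
    refine hpow (a * b) ?_ hab
    rw [map_lsmul_mul, hr b hcon.2, hr a hcon.1]
  by_cases hqm : q = IsLocalRing.maximalIdeal L
  · left
    obtain ⟨k, hk⟩ := Ideal.exists_radical_pow_le_of_fg (Module.annihilator L U)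
      (IsNoetherian.noetherian _)
    refine (artin_iff_of_kill k ?_).1 inferInstance
    intro r hr x
    exact Module.mem_annihilator.1 (hk (by change r ∈ q ^ k; rwa [hqm])) x
  · exact Or.inr ⟨q, hprime, hqm, hr⟩

lemma secondary [IsArtinian L N] : ∃ (P : Finset (Ideal L)) (K : Submodule L N), K.FG ∧
    (∀ q ∈ P, q.IsPrime ∧ q ≠ IsLocalRing.maximalIdeal L) ∧
    ∀ r, (∀ q ∈ P, r ∉ q) → K ⊔ LinearMap.range (LinearMap.lsmul L N r) = ⊤ := by
  classical
  obtain ⟨s, hs, hirr⟩ := exists_supIrred_decomposition (⊤ : Submodule L N)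
  suffices h : ∀ s : Finset (Submodule L N), (∀ U ∈ s, SupIrred U) →
      ∃ (P : Finset (Ideal L)) (K : Submodule L N), K.FG ∧
    (∀ q ∈ P, q.IsPrime ∧ q ≠ IsLocalRing.maximalIdeal L) ∧
    ∀ r, (∀ q ∈ P, r ∉ q) → s.sup id ≤ K ⊔ LinearMap.range (LinearMap.lsmul L N r) by
    obtain ⟨P, K, h1, h2, h3⟩ := h s (fun U hU => hirr hU)
    exact ⟨P, K, h1, h2, fun r hr => top_le_iff.1 (hs ▸ h3 r hr)⟩
  clear hs hirr s
  intro s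
  induction s using Finset.induction_on with
  | empty => exact fun _ => ⟨∅, ⊥, Submodule.fg_bot, by simp, by simp⟩
  | insert U s _ ih =>
    intro hs
    obtain ⟨P, K, h1, h2, h3⟩ := ih (fun V hV => hs V (Finset.mem_insert_of_mem hV))
    rcases supIrred_prime (hs U (Finset.mem_insert_self _ _)) with hU | ⟨q, hq, hqm, hr⟩
    · refine ⟨P, U ⊔ K, (Module.Finite.iff_fg.1 hU).sup h1, h2, fun r hr => ?_⟩
      rw [Finset.sup_insert, sup_assoc]
      exact sup_le_sup le_rfl (h3 r hr)
    · refine ⟨insert q P, K, h1, ?_, fun r hr' => ?_⟩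
      · intro q' hq'
        rcases Finset.mem_insert.1 hq' with rfl | h
        · exact ⟨hq, hqm⟩
        · exact h2 _ h
      · rw [Finset.sup_insert]
        refine sup_le ?_ (h3 r (fun q' h => hr' q' (Finset.mem_insert_of_mem h)))
        refine le_trans ?_ le_sup_right
        rw [id, ← hr r (hr' q (Finset.mem_insert_self _ _))]
        exact LinearMap.map_le_range
end
end LC

namespace LC
section
variable {R : Type} [CommRing R] [IsNoetherianRing R]

lemma Gam_quot (I : Ideal R) (M : Type) [AddCommGroup M] [Module R M] [Module.Finite R M] :
    Gam I (M ⧸ Gam I M) = ⊥ := by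
  obtain ⟨u, hu⟩ := exists_pow_kill I (M := Gam I M) (by
    rintro ⟨m, t, hm⟩
    exact ⟨t, fun r hr => Subtype.ext (hm r hr)⟩)
  rw [eq_bot_iff]
  rintro x ⟨t, ht⟩
  obtain ⟨x, rfl⟩ := Submodule.mkQ_surjective _ x
  rw [Submodule.mem_bot, Submodule.mkQ_apply, Submodule.Quotient.mk_eq_zero]
  refine ⟨u + t, fun r hr => ?_⟩
  rw [pow_add] at hr
  induction hr using Submodule.mul_induction_on' with
  | mem_mul_mem a ha b hb =>
    have h1 := ht b hb
    rw [Submodule.mkQ_apply, ← Submodule.Quotient.mk_smul, Submodule.Quotient.mk_eq_zero] at h1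
    have := hu a ha ⟨_, h1⟩
    rw [mul_smul]
    exact congrArg Subtype.val this
  | add a _ b _ ha hb => rw [add_smul, ha, hb, add_zero]

lemma exists_reg (p : Ideal R) (M : Type) [AddCommGroup M] [Module R M] [Module.Finite R M]
    (hM : Gam p M = ⊥) (P : Finset (Ideal R)) (hP : ∀ q ∈ P, q.IsPrime ∧ ¬ p ≤ q) :
    ∃ r ∈ p, IsSMulRegular M r ∧ ∀ q ∈ P, r ∉ q := by
  classical
  have hfin := associatedPrimes.finite R M
  let Q : Finset (Ideal R) := hfin.toFinset ∪ P
  have hass : ∀ q ∈ associatedPrimes R M, q.IsPrime ∧ ¬ p ≤ q := by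
    intro q hq
    refine ⟨(AssociatedPrimes.mem_iff.1 hq).1, fun hpq => ?_⟩
    obtain ⟨hq1, x, hx⟩ := isAssociatedPrime_iff.1 (AssociatedPrimes.mem_iff.1 hq)
    have hx0 : x ∈ Gam p M := ⟨1, fun r hr => by
      rw [pow_one] at hr
      have := hpq hr
      rw [hx] at this
      simpa [Submodule.mem_colon_singleton] using this⟩
    rw [hM, Submodule.mem_bot] at hx0
    subst hx0
    apply hq1.ne_top
    rw [hx]
    ext; simp
  have hQ : ∀ q ∈ Q, q.IsPrime ∧ ¬ p ≤ q := by
    intro q hq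
    rcases Finset.mem_union.1 hq with h | h
    · exact hass q (hfin.mem_toFinset.1 h)
    · exact hP q h
  have h := (Ideal.subset_union_prime (s := Q) (f := id) ⊥ ⊥ (fun q hq _ _ => (hQ q hq).1)
    (I := p)).not.2 (by
      rintro ⟨q, hq, hpq⟩
      exact (hQ q hq).2 hpq)
  obtain ⟨r, hr, hr'⟩ := Set.not_subset.1 h
  have hr2 : ∀ q ∈ Q, r ∉ q := by simpa using hr'
  refine ⟨r, hr, ?_, fun q hq => hr2 q (Finset.mem_union_right _ hq)⟩
  by_contra hcon
  have : r ∈ ⋃ p ∈ associatedPrimes R M, (p : Set R) := by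
    rw [biUnion_associatedPrimes_eq_compl_regular]; exact hcon
  simp only [Set.mem_iUnion] at this
  obtain ⟨q, hq, hrq⟩ := this
  exact hr2 q (Finset.mem_union_left _ (hfin.mem_toFinset.2 hq)) hrq

end

section
variable {R : Type} [CommRing R] (p : Ideal R) [p.IsPrime]

noncomputable abbrev L : Type := Localization p.primeCompl

lemma loc_tors {M : Type} [AddCommGroup M] [Module R M]
    (hM : ∀ m : M, ∃ t, ∀ r ∈ p ^ t, r • m = 0) (x : LocalizedModule p.primeCompl M) :
    ∃ t, ∀ r ∈ IsLocalRing.maximalIdeal (L p) ^ t, r • x = 0 := by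
  induction x using LocalizedModule.induction_on with
  | h m s =>
  obtain ⟨t, ht⟩ := hM m
  refine ⟨t, fun r hr => ?_⟩
  rw [← Localization.AtPrime.map_eq_maximalIdeal, ← Ideal.map_pow] at hr
  induction hr using Submodule.span_induction with
  | mem x hx =>
    obtain ⟨a, ha, rfl⟩ := hx
    rw [algebraMap_smul, LocalizedModule.smul'_mk, ht a ha, LocalizedModule.zero_mk]
  | zero => simp
  | add x y _ _ hx hy => rw [add_smul, hx, hy, add_zero]
  | smul a x _ hx => rw [smul_assoc, hx, smul_zero]

noncomputable abbrev T (i : ℕ) (M : ModuleCat.{0} R) : Type := LocalizedModule p.primeCompl (H p i M)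

noncomputable abbrev lm {M N : Type} [AddCommGroup M] [Module R M] [AddCommGroup N] [Module R N]
    (f : M →ₗ[R] N) : LocalizedModule p.primeCompl M →ₗ[L p] LocalizedModule p.primeCompl N :=
  LocalizedModule.map p.primeCompl f

variable {p} in
lemma lm_exact {M N P : Type} [AddCommGroup M] [Module R M] [AddCommGroup N] [Module R N]
    [AddCommGroup P] [Module R P] {f : M →ₗ[R] N} {g : N →ₗ[R] P} (h : Function.Exact f g) :
    Function.Exact (lm p f) (lm p g) := LocalizedModule.map_exact _ f g h

lemma T_tors (i : ℕ) (M : ModuleCat.{0} R) (x : T p i M) :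
    ∃ t, ∀ r ∈ IsLocalRing.maximalIdeal (L p) ^ t, r • x = 0 :=
  loc_tors p (H_torsion p i M) x

lemma lm_smul {M : Type} [AddCommGroup M] [Module R M] (r : R) (x : LocalizedModule p.primeCompl M) :
    lm p (LinearMap.lsmul R M r) x = algebraMap R (L p) r • x := by
  induction x using LocalizedModule.induction_on with
  | h m s =>
  rw [algebraMap_smul, LocalizedModule.smul'_mk, LocalizedModule.map_mk]
  rfl

lemma alg_mem {r : R} (hr : r ∈ p) : algebraMap R (L p) r ∈ IsLocalRing.maximalIdeal (L p) := by
  rw [← Localization.AtPrime.map_eq_maximalIdeal]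
  exact Ideal.mem_map_of_mem _ hr

/-- the short exact sequence of a regular element -/
lemma regSES (M : ModuleCat.{0} R) (r : R) (hr : IsSMulRegular M r) :
    (ShortComplex.mk (ModuleCat.ofHom (LinearMap.lsmul R M r))
      (ModuleCat.ofHom (Submodule.mkQ (LinearMap.range (LinearMap.lsmul R M r))))
      (ModuleCat.hom_ext (LinearMap.exact_map_mkQ_range _).linearMap_comp_eq_zero)).ShortExact :=
  mkSES (B := ModuleCat.of R (M ⧸ LinearMap.range (LinearMap.lsmul R M r)))
    (LinearMap.lsmul R M r) (Submodule.mkQ _) hr (Submodule.mkQ_surjective _) (LinearMap.exact_map_mkQ_range _)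

abbrev Mq (M : ModuleCat.{0} R) (r : R) : ModuleCat.{0} R :=
  ModuleCat.of R (M ⧸ LinearMap.range (LinearMap.lsmul R M r))

lemma Hmap_lsmul (I : Ideal R) (i : ℕ) (M : ModuleCat.{0} R) (r : R) :
    Hmap I i (ModuleCat.ofHom (LinearMap.lsmul R M r)) = LinearMap.lsmul R (H I i M) r := by
  exact LinearMap.ext (Hmap_smul_id I i M r)

lemma les' (I : Ideal R) (S : ShortComplex (ModuleCat.{0} R)) (A M B : ModuleCat.{0} R)
    (hA : S.X₁ = A) (hM : S.X₂ = M) (hB : S.X₃ = B) (f : A ⟶ M) (g : M ⟶ B)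
    (hf : HEq S.f f) (hg : HEq S.g g) (hS : S.ShortExact) (i : ℕ) :
    ∃ δ : H I i B →ₗ[R] H I (i + 1) A,
      Function.Exact (Hmap I i f) (Hmap I i g) ∧ Function.Exact (Hmap I i g) δ ∧
      Function.Exact δ (Hmap I (i + 1) f) := by
  subst hA hM hB
  obtain rfl := eq_of_heq hf
  obtain rfl := eq_of_heq hg
  exact ⟨Hδ I i hS, exact₂ I hS i, exact₃ I hS i, exact₁ I hS i⟩

lemma les (I : Ideal R) {A M B : ModuleCat.{0} R} (f : A ⟶ M) (g : M ⟶ B) (w : f ≫ g = 0)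
    (hS : (ShortComplex.mk f g w).ShortExact) (i : ℕ) : ∃ δ : H I i B →ₗ[R] H I (i + 1) A,
      Function.Exact (Hmap I i f) (Hmap I i g) ∧ Function.Exact (Hmap I i g) δ ∧
      Function.Exact δ (Hmap I (i + 1) f) :=
  les' I (ShortComplex.mk f g w) A M B rfl rfl rfl f g HEq.rfl HEq.rfl hS i

/-- long exact sequence of a regular element, packaged -/
lemma regLES_H (i : ℕ) (M : ModuleCat.{0} R) (r : R) (hr : IsSMulRegular M r) :
    ∃ (f : H p i M →ₗ[R] H p i (Mq M r)) (g : H p i (Mq M r) →ₗ[R] H p (i + 1) M),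
      Function.Exact (LinearMap.lsmul R (H p i M) r) f ∧
      Function.Exact f g ∧
      Function.Exact g (LinearMap.lsmul R (H p (i + 1) M) r) := by
  obtain ⟨δ, h1, h2, h3⟩ := les p _ _ _ (regSES M r hr) i
  rw [Hmap_lsmul] at h1 h3
  exact ⟨_, δ, h1, h2, h3⟩

lemma lm_lsmul (M : Type) [AddCommGroup M] [Module R M] (r : R) :
    LinearMap.lsmul (L p) (LocalizedModule p.primeCompl M) (algebraMap R (L p) r) =
      lm p (LinearMap.lsmul R M r) :=
  LinearMap.ext fun x => (lm_smul p r x).symm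

lemma regLES (i : ℕ) (M : ModuleCat.{0} R) (r : R) (hr : IsSMulRegular M r) :
    ∃ (f : T p i M →ₗ[L p] T p i (Mq M r)) (g : T p i (Mq M r) →ₗ[L p] T p (i + 1) M),
      Function.Exact (LinearMap.lsmul (L p) (T p i M) (algebraMap R (L p) r)) f ∧
      Function.Exact f g ∧
      Function.Exact g (LinearMap.lsmul (L p) (T p (i + 1) M) (algebraMap R (L p) r)) := by
  obtain ⟨f, g, h1, h2, h3⟩ := regLES_H p i M r hr
  refine ⟨lm p f, lm p g, ?_, lm_exact h2, ?_⟩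
  · rw [lm_lsmul]
    exact lm_exact h1
  · rw [lm_lsmul]
    exact lm_exact h3

abbrev Mb (M : ModuleCat.{0} R) : ModuleCat.{0} R := ModuleCat.of R (M ⧸ Gam p M)

lemma gamSES (M : ModuleCat.{0} R) :
    (ShortComplex.mk (X₁ := ModuleCat.of R (Gam p M)) (X₂ := M) (X₃ := Mb p M)
      (ModuleCat.ofHom (Gam p M).subtype) (ModuleCat.ofHom (Submodule.mkQ (Gam p M)))
      (ModuleCat.hom_ext (LinearMap.exact_subtype_mkQ _).linearMap_comp_eq_zero)).ShortExact :=
  mkSES (A := ModuleCat.of R (Gam p M)) (B := Mb p M) _ _ Subtype.val_injective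
    (Submodule.mkQ_surjective _) (LinearMap.exact_subtype_mkQ _)

lemma Gam_tors (I : Ideal R) (M : Type) [AddCommGroup M] [Module R M] (m : Gam I M) :
    ∃ t, ∀ r ∈ I ^ t, r • m = 0 := by
  obtain ⟨m, t, hm⟩ := m
  exact ⟨t, fun r hr => Subtype.ext (hm r hr)⟩

lemma H_bar [IsNoetherianRing R] (i : ℕ) (M : ModuleCat.{0} R) :
    ∃ f : H p (i + 1) M →ₗ[R] H p (i + 1) (Mb p M), Function.Bijective f := by
  obtain ⟨δ, h1, h2, -⟩ := les p _ _ _ (gamSES p M) (i + 1)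
  refine ⟨_, ?_, fun x => (h2 x).1 (H_vanish p (i + 1) _ (Gam_tors p M) _)⟩
  rw [injective_iff_map_eq_zero]
  intro x hx
  obtain ⟨y, rfl⟩ := (h1 x).1 hx
  rw [H_vanish p i (ModuleCat.of R (Gam p M)) (Gam_tors p M) y, map_zero]

lemma T_bar [IsNoetherianRing R] (i : ℕ) (M : ModuleCat.{0} R) :
    ∃ f : T p (i + 1) M →ₗ[L p] T p (i + 1) (Mb p M), Function.Bijective f := by
  obtain ⟨f, hf⟩ := H_bar p i M
  exact ⟨lm p f, LocalizedModule.map_injective _ _ hf.1, LocalizedModule.map_surjective _ _ hf.2⟩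

/-- Claim A -/
theorem T_artin [IsNoetherianRing R] (i : ℕ) : ∀ (M : ModuleCat.{0} R) (_ : Module.Finite R M),
    IsArtinian (L p) (T p i M) := by
  induction i with
  | zero =>
    intro M hM
    have hfin : Module.Finite (L p) (T p 0 M) :=
      Module.Finite.of_injective (lm p (H0 p M))
        (LocalizedModule.map_injective _ _ (H0_injective p M))
    obtain ⟨t, ht⟩ := exists_pow_kill (M := T p 0 M) (IsLocalRing.maximalIdeal (L p))
      (T_tors p 0 M)
    exact (artin_iff_of_kill t ht).2 hfin
  | succ i ih =>
    intro M hM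
    obtain ⟨f, hf⟩ := T_bar p i M
    suffices h : IsArtinian (L p) (T p (i + 1) (Mb p M)) from isArtinian_of_injective f hf.1
    obtain ⟨r, hrp, hr, -⟩ := exists_reg p (M ⧸ Gam p M) (Gam_quot p M) ∅ (by simp)
    obtain ⟨-, g, -, -, hg⟩ := regLES p i (Mb p M) r hr
    have := ih (Mq (Mb p M) r) (inferInstanceAs (Module.Finite R ((M ⧸ Gam p M) ⧸ _)))
    have : IsArtinian (L p) (LinearMap.ker (LinearMap.lsmul (L p) (T p (i + 1) (Mb p M))
        (algebraMap R (L p) r))) := by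
      rw [hg.linearMap_ker_eq]
      infer_instance
    refine melk (algebraMap R (L p) r) (fun x => ?_)
    obtain ⟨t, ht⟩ := T_tors p (i + 1) (Mb p M) x
    exact ⟨t, ht _ (Ideal.pow_mem_pow (alg_mem p hrp) t)⟩
end
end LC

namespace LC
section
variable {R : Type} [CommRing R] (p : Ideal R) [p.IsPrime]

abbrev loc (M : Type) [AddCommGroup M] [Module R M] : Type := LocalizedModule p.primeCompl M

lemma wb_aux {x : WithBot ℕ∞} {n : ℕ} (h : x + 1 = ((n + 1 : ℕ) : WithBot ℕ∞)) :
    x = (n : WithBot ℕ∞) := by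
  induction x using WithBot.recBotCoe with
  | bot => exact absurd h (by rw [WithBot.bot_add]; exact WithBot.bot_ne_coe)
  | coe x =>
    have h1 : x + 1 = ((n + 1 : ℕ) : ℕ∞) := by exact_mod_cast h
    have h2 : x = (n : ℕ∞) := by
      induction x using ENat.recTopCoe with
      | top => exact absurd h1 (by rw [top_add]; exact ENat.top_ne_natCast _)
      | coe m =>
        have : m + 1 = n + 1 := by exact_mod_cast h1
        have : m = n := by omega
        rw [this]
    rw [h2]
    rfl

lemma reg_loc {M : Type} [AddCommGroup M] [Module R M] {r : R} (hr : IsSMulRegular M r) :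
    IsSMulRegular (loc p M) (algebraMap R (L p) r) := by
  have h := LocalizedModule.map_injective p.primeCompl (LinearMap.lsmul R M r) hr
  intro x y hxy
  refine h ?_
  have h1 := lm_smul p r x
  have h2 := lm_smul p r y
  exact h1.trans (hxy.trans h2.symm)

open Pointwise in
lemma dim_q [IsNoetherianRing R] (M : ModuleCat.{0} R) [Module.Finite R M] {r : R} (hrp : r ∈ p)
    (hr : IsSMulRegular M r) :
    Module.supportDim (L p) (loc p (Mq M r)) + 1 = Module.supportDim (L p) (loc p M) := by
  rw [← Module.supportDim_quotSMulTop_succ_eq_supportDim (reg_loc p hr) (alg_mem p hrp)]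
  congr 1
  have h1 : Function.Exact (lm p (LinearMap.lsmul R M r))
    (lm p (Submodule.mkQ (LinearMap.range (LinearMap.lsmul R M r)))) :=
    lm_exact (LinearMap.exact_map_mkQ_range _)
  have h2 : Function.Surjective (lm p (Submodule.mkQ (LinearMap.range (LinearMap.lsmul R M r)))) :=
    LocalizedModule.map_surjective _ _ (Submodule.mkQ_surjective _)
  have h3 : algebraMap R (L p) r • (⊤ : Submodule (L p) (loc p M)) =
      LinearMap.ker (lm p (Submodule.mkQ (LinearMap.range (LinearMap.lsmul R M r)))) := by
    rw [h1.linearMap_ker_eq, ← lm_lsmul, LinearMap.range_eq_map]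
    rfl
  exact (Module.supportDim_eq_of_equiv ((Submodule.quotEquivOfEq _ _ h3).trans
    (LinearMap.quotKerEquivOfSurjective _ h2))).symm

lemma support_tors {A : Type} [CommRing A] [IsLocalRing A] {N : Type} [AddCommGroup N] [Module A N]
    (hN : ∀ x : N, ∃ t, ∀ r ∈ IsLocalRing.maximalIdeal A ^ t, r • x = 0) :
    Module.support A N ⊆ {IsLocalRing.closedPoint A} := by
  intro q hq
  rw [Module.mem_support_iff_exists_annihilator] at hq
  obtain ⟨x, hx⟩ := hq
  obtain ⟨t, ht⟩ := hN x
  have h1 : IsLocalRing.maximalIdeal A ^ t ≤ q.asIdeal := by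
    refine le_trans ?_ hx
    intro r hr
    rw [Submodule.mem_annihilator_span_singleton]
    exact ht r hr
  have h2 := q.2.le_of_pow_le h1
  rw [Set.mem_singleton_iff]
  ext1
  exact le_antisymm (IsLocalRing.le_maximalIdeal q.2.ne_top) h2

lemma dim_bar [IsNoetherianRing R] (M : ModuleCat.{0} R) [Module.Finite R M] (n : ℕ)
    (h : Module.supportDim (L p) (loc p M) = ((n + 1 : ℕ) : WithBot ℕ∞)) :
    Module.supportDim (L p) (loc p (Mb p M)) = ((n + 1 : ℕ) : WithBot ℕ∞) := by
  have h1 : Function.Exact (lm p (Gam p M).subtype) (lm p (Gam p M).mkQ) :=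
    lm_exact (LinearMap.exact_subtype_mkQ _)
  have hs := Module.support_of_exact h1
    (LocalizedModule.map_injective _ _ Subtype.val_injective)
    (LocalizedModule.map_surjective _ _ (Submodule.mkQ_surjective _))
  have ht := support_tors (loc_tors p (Gam_tors p M))
  rw [← h]
  unfold Module.supportDim at h ⊢
  rcases subsingleton_or_nontrivial (loc p (M ⧸ Gam p M)) with hsub | hnt
  · exfalso
    rw [Module.support_eq_empty_iff.2 hsub, Set.union_empty] at hs
    have h2 : Subsingleton (Module.support (L p) (loc p M)) := by
      rw [Set.subsingleton_coe, hs]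
      exact Set.subsingleton_of_subset_singleton ht
    have h3 := @Order.krullDim_nonpos_of_subsingleton (Module.support (L p) (loc p M)) _ h2
    rw [h] at h3
    have : n + 1 ≤ 0 := by exact_mod_cast h3
    omega
  · have h4 : Module.support (L p) (loc p M) = Module.support (L p) (loc p (Mb p M)) := by
      rw [hs]
      refine Set.union_eq_right.2 (ht.trans ?_)
      rw [Set.singleton_subset_iff]
      exact IsLocalRing.closedPoint_mem_support _ _
    rw [h4]

lemma dim_zero {A : Type} [CommRing A] [IsLocalRing A] [IsNoetherianRing A] {N : Type}
    [AddCommGroup N] [Module A N] [Module.Finite A N] (h : Module.supportDim A N ≤ 0) :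
    ∃ t, ∀ r ∈ IsLocalRing.maximalIdeal A ^ t, ∀ x : N, r • x = 0 := by
  have hle : IsLocalRing.maximalIdeal A ≤ (Module.annihilator A N).radical := by
    rcases subsingleton_or_nontrivial N with hsub | hnt
    · rw [Module.annihilator_eq_top_iff.2 hsub, Ideal.radical_top]
      exact le_top
    rw [Ideal.radical_eq_sInf]
    refine le_sInf ?_
    rintro q ⟨hq, hqp⟩
    unfold Module.supportDim at h
    rw [Order.krullDim_nonpos_iff_forall_isMax] at h
    have hqs : (⟨q, hqp⟩ : PrimeSpectrum A) ∈ Module.support A N := by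
      rw [Module.support_eq_zeroLocus]
      exact hq
    have h1 := @h ⟨_, hqs⟩ ⟨_, IsLocalRing.closedPoint_mem_support A N⟩
      (IsLocalRing.le_maximalIdeal hqp.ne_top)
    exact h1
  obtain ⟨t, ht⟩ := Ideal.exists_pow_le_of_le_radical_of_fg hle (IsNoetherian.noetherian _)
  exact ⟨t, fun r hr x => Module.mem_annihilator.1 (ht hr) x⟩

lemma T0_surj [IsNoetherianRing R] (M : ModuleCat.{0} R) [Module.Finite R M]
    (h : ∃ t, ∀ r ∈ IsLocalRing.maximalIdeal (L p) ^ t, ∀ x : loc p M, r • x = 0) :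
    Function.Surjective (lm p (H0 p M)) := by
  obtain ⟨t, ht⟩ := h
  intro x
  induction x using LocalizedModule.induction_on with
  | h m s =>
  let f : (p ^ t : Ideal R) →ₗ[R] M := (LinearMap.toSpanSingleton R M m).comp (Submodule.subtype _)
  have hz : Subsingleton (LocalizedModule p.primeCompl (LinearMap.range f)) := by
    rw [LocalizedModule.subsingleton_iff]
    rintro ⟨_, ⟨a, ha⟩, rfl⟩
    have h1 := ht (algebraMap R (L p) a) (by
      rw [← Localization.AtPrime.map_eq_maximalIdeal, ← Ideal.map_pow]
      exact Ideal.mem_map_of_mem _ ha) (LocalizedModule.mk m 1)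
    rw [algebraMap_smul, LocalizedModule.smul'_mk, ← LocalizedModule.zero_mk 1,
      LocalizedModule.mk_eq] at h1
    obtain ⟨u, hu⟩ := h1
    refine ⟨u, u.2, Subtype.ext ?_⟩
    rw [smul_zero, smul_zero, one_smul] at hu
    exact hu
  obtain ⟨u, hu, huf⟩ : ∃ u ∈ p.primeCompl, ∀ x : LinearMap.range f, u • x = 0 := by
    rw [LocalizedModule.subsingleton_iff] at hz
    obtain ⟨S, hS⟩ := Module.Finite.fg_top (R := R) (M := LinearMap.range f)
    choose c hc hc' using hz
    refine ⟨∏ y ∈ S, c y, Submonoid.prod_mem _ (fun y _ => hc y), fun x => ?_⟩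
    have hx : x ∈ Submodule.span R (S : Set (LinearMap.range f)) := hS ▸ Submodule.mem_top
    induction hx using Submodule.span_induction with
    | mem x hx =>
      classical
      rw [← Finset.prod_erase_mul _ _ hx, mul_smul, hc', smul_zero]
    | zero => simp
    | add x y _ _ hx hy => rw [smul_add, hx, hy, add_zero]
    | smul a x _ hx => rw [smul_comm, hx, smul_zero]
  obtain ⟨z, hz⟩ := H0_mem p (u • m) t (by
    intro r hr
    have := congrArg Subtype.val (huf ⟨f ⟨r, hr⟩, ⟨r, hr⟩, rfl⟩)
    rw [smul_comm]
    exact this)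
  refine ⟨LocalizedModule.mk z (⟨u, hu⟩ * s), ?_⟩
  rw [LocalizedModule.map_mk, hz, LocalizedModule.mk_eq]
  refine ⟨1, ?_⟩
  rw [one_smul, one_smul, mul_comm, mul_smul]
  rfl

/-- Claim B, torsion-free case reduces the general one -/
theorem T_not_fin [IsNoetherianRing R] (n : ℕ) : ∀ (M : ModuleCat.{0} R) (_ : Module.Finite R M),
    Module.supportDim (L p) (loc p M) = ((n + 1 : ℕ) : WithBot ℕ∞) →
    ¬ Module.Finite (L p) (T p (n + 1) M) := by
  have red : ∀ n : ℕ, (∀ (M : ModuleCat.{0} R) (_ : Module.Finite R M), Gam p M = ⊥ →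
    Module.supportDim (L p) (loc p M) = ((n + 1 : ℕ) : WithBot ℕ∞) →
    ¬ Module.Finite (L p) (T p (n + 1) M)) → ∀ (M : ModuleCat.{0} R) (_ : Module.Finite R M),
    Module.supportDim (L p) (loc p M) = ((n + 1 : ℕ) : WithBot ℕ∞) →
    ¬ Module.Finite (L p) (T p (n + 1) M) := by
    intro n h M hM hd hfin
    obtain ⟨f, hf⟩ := T_bar p n M
    exact h (Mb p M) (inferInstanceAs (Module.Finite R (M ⧸ Gam p M))) (Gam_quot p M)
      (dim_bar p M n hd) (Module.Finite.of_surjective f hf.2)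
  induction n with
  | zero =>
    refine red 0 ?_
    intro M hM hG hd hfin
    obtain ⟨k, hk⟩ := exists_pow_kill (M := T p 1 M) (IsLocalRing.maximalIdeal (L p))
      (T_tors p 1 M)
    obtain ⟨r, hrp, hr, -⟩ := exists_reg p M hG ∅ (by simp)
    have hr' : IsSMulRegular M (r ^ (k + 1)) := hr.pow _
    have hrp' : r ^ (k + 1) ∈ p := Ideal.pow_mem_of_mem _ hrp _ (Nat.succ_pos k)
    have hd' := dim_q p M hrp' hr'
    have hfq : Module.Finite R (Mq M (r ^ (k + 1))) := inferInstanceAs (Module.Finite R (M ⧸ _))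
    have hd0 : Module.supportDim (L p) (loc p (Mq M (r ^ (k + 1)))) ≤ 0 := by
      rw [hd] at hd'
      exact (wb_aux hd').le
    have hsurj := T0_surj p (Mq M (r ^ (k + 1))) (dim_zero hd0)
    obtain ⟨f, g, h1, h2, h3⟩ := regLES p 0 M _ hr'
    have hT0 : ∀ x : T p 0 M, x = 0 := by
      intro x
      induction x using LocalizedModule.induction_on with
      | h m s =>
      have : m = 0 := by
        refine H0_injective p M ?_
        rw [map_zero, ← Submodule.mem_bot R, ← hG]
        obtain ⟨t, ht⟩ := H_torsion p 0 M m
        exact ⟨t, fun r hr => by rw [← map_smul, ht r hr, map_zero]⟩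
      rw [this, LocalizedModule.zero_mk]
    have hg : Function.Injective g := by
      rw [injective_iff_map_eq_zero]
      intro x hx
      obtain ⟨y, rfl⟩ := (h2 x).1 hx
      rw [hT0 y, map_zero]
    set r' := algebraMap R (L p) r with hr'def
    have hr'm : r' ∈ IsLocalRing.maximalIdeal (L p) := alg_mem p hrp
    have hkill : ∀ x : loc p (Mq M (r ^ (k + 1))), r' ^ k • x = 0 := by
      intro x
      obtain ⟨y, rfl⟩ := hsurj x
      rw [← map_smul]
      have : r' ^ k • y = 0 := by
        refine hg ?_
        rw [map_smul, map_zero]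
        exact hk _ (Ideal.pow_mem_pow hr'm k) _
      rw [this, map_zero]
    have hex : Function.Exact (lm p (LinearMap.lsmul R M (r ^ (k + 1))))
      (lm p (Submodule.mkQ (LinearMap.range (LinearMap.lsmul R M (r ^ (k + 1)))))) :=
      lm_exact (LinearMap.exact_map_mkQ_range _)
    let N : Submodule (L p) (loc p M) :=
      LinearMap.range (LinearMap.lsmul (L p) (loc p M) (r' ^ k))
    have hN : N = ⊥ := by
      refine Submodule.eq_bot_of_le_smul_of_le_jacobson_bot (IsLocalRing.maximalIdeal (L p)) N
        (IsNoetherian.noetherian _) ?_ (IsLocalRing.maximalIdeal_le_jacobson _)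
      rintro _ ⟨x, rfl⟩
      have h5 : lm p (Submodule.mkQ (LinearMap.range (LinearMap.lsmul R M (r ^ (k + 1)))))
          (r' ^ k • x) = 0 := by
        rw [map_smul]
        exact hkill _
      obtain ⟨y, hy⟩ := (hex _).1 h5
      rw [lm_smul, map_pow, pow_succ', mul_smul] at hy
      rw [LinearMap.lsmul_apply, ← hy]
      exact Submodule.smul_mem_smul hr'm ⟨y, rfl⟩
    have hsub : Subsingleton (loc p M) := by
      refine subsingleton_of_forall_eq 0 (fun x => ?_)
      have : r' ^ k • x ∈ N := ⟨x, rfl⟩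
      rw [hN, Submodule.mem_bot] at this
      exact ((reg_loc p hr).pow k) (this.trans (smul_zero _).symm)
    rw [(Module.supportDim_eq_bot_iff_subsingleton _ _).2 hsub] at hd
    exact absurd hd (by simp)
  | succ n ih =>
    refine red (n + 1) ?_
    intro M hM hG hd hfin
    have := T_artin p (n + 1) M hM
    obtain ⟨P, K, hK, hP, hPK⟩ := secondary (L := L p) (N := T p (n + 1) M)
    classical
    obtain ⟨r, hrp, hr, hrP⟩ := exists_reg p M hG (P.image (Ideal.comap (algebraMap R (L p)))) (by
      intro q hq
      obtain ⟨q, hqP, rfl⟩ := Finset.mem_image.1 hq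
      have := (hP q hqP).1
      refine ⟨inferInstance, fun hle => (hP q hqP).2 ?_⟩
      refine le_antisymm (IsLocalRing.le_maximalIdeal this.ne_top) ?_
      rw [← Localization.AtPrime.map_eq_maximalIdeal]
      exact Ideal.map_le_iff_le_comap.2 hle)
    have hfq : Module.Finite R (Mq M r) := inferInstanceAs (Module.Finite R (M ⧸ _))
    have hd' := dim_q p M hrp hr
    refine ih (Mq M r) hfq ?_ ?_
    · rw [hd] at hd'
      exact wb_aux hd'
    · obtain ⟨f, g, h1, h2, -⟩ := regLES p (n + 1) M r hr
      have hKr := hPK (algebraMap R (L p) r) (fun q hq hrq => hrP _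
        (Finset.mem_image_of_mem _ hq) hrq)
      have hrange : LinearMap.range f = K.map f := by
        rw [LinearMap.range_eq_map, ← hKr, Submodule.map_sup]
        refine sup_eq_left.2 ?_
        rintro _ ⟨_, ⟨x, rfl⟩, rfl⟩
        rw [(h1 _).2 ⟨x, rfl⟩]
        exact Submodule.zero_mem _
      refine ⟨Submodule.fg_of_fg_map_of_fg_inf_ker g (IsNoetherian.noetherian _) ?_⟩
      rw [top_inf_eq, h2.linearMap_ker_eq, hrange]
      exact hK.map f
end
end LC

namespace LC
section
open Limits Opposite
variable {R : Type} [CommRing R]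

/-- the contravariant Hom functor -/
noncomputable abbrev FY (Y : ModuleCat.{0} R) : ModuleCat.{0} R ⥤ (ModuleCat.{0} R)ᵒᵖ :=
  ((linearYoneda R (ModuleCat.{0} R)).obj Y).rightOp

noncomputable abbrev KY {A : ModuleCat.{0} R} (P : ProjectiveResolution A) (Y : ModuleCat.{0} R) :
    ChainComplex (ModuleCat.{0} R)ᵒᵖ ℕ :=
  ((FY Y).mapHomologicalComplex _).obj P.complex

noncomputable abbrev WY {A : ModuleCat.{0} R} (P : ProjectiveResolution A) (Y : ModuleCat.{0} R)
    (n : ℕ) : ModuleCat.{0} R := ((KY P Y).opcycles n).unop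

/-- inclusion of cocycles -/
noncomputable def jY {A : ModuleCat.{0} R} (P : ProjectiveResolution A) (Y : ModuleCat.{0} R)
    (n : ℕ) : WY P Y n →ₗ[R] (P.complex.X n ⟶ Y) := ((KY P Y).pOpcycles n).unop.hom

lemma jY_cocycle {A : ModuleCat.{0} R} (P : ProjectiveResolution A) (Y : ModuleCat.{0} R)
    (n m : ℕ) (w : WY P Y n) : P.complex.d m n ≫ jY P Y n w = 0 := by
  have h := congrArg Quiver.Hom.unop ((KY P Y).d_pOpcycles m n)
  exact LinearMap.congr_fun (congrArg ModuleCat.Hom.hom h) w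

lemma jY_surj {A : ModuleCat.{0} R} (P : ProjectiveResolution A) (Y : ModuleCat.{0} R)
    (n : ℕ) (f : P.complex.X n ⟶ Y) (hf : P.complex.d (n + 1) n ≫ f = 0) :
    ∃ w, jY P Y n w = f := by
  let k : ModuleCat.of R R ⟶ ((KY P Y).X n).unop :=
    ModuleCat.ofHom (LinearMap.toSpanSingleton R (P.complex.X n ⟶ Y) f)
  have hk : (KY P Y).d (n + 1) n ≫ k.op = 0 := by
    apply Quiver.Hom.unop_inj
    refine ModuleCat.hom_ext (LinearMap.ext fun r => ?_)
    change P.complex.d (n + 1) n ≫ (r • f) = 0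
    rw [Linear.comp_smul, hf, smul_zero]
  let l := (KY P Y).descOpcycles k.op (n + 1) (by simp) hk
  have hl : (KY P Y).pOpcycles n ≫ l = k.op := (KY P Y).p_descOpcycles _ _ _ _
  refine ⟨l.unop.hom (1 : R), ?_⟩
  have h2 := LinearMap.congr_fun (congrArg ModuleCat.Hom.hom (congrArg Quiver.Hom.unop hl)) (1 : R)
  refine h2.trans ?_
  change (1 : R) • f = f
  rw [one_smul]

noncomputable def aY {A : ModuleCat.{0} R} (P : ProjectiveResolution A) (Y : ModuleCat.{0} R)
    (n : ℕ) : WY P Y n →ₗ[R] Abelian.Ext.{0} A Y n where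
  toFun w := P.extMk (jY P Y n w) (n + 1) rfl (jY_cocycle P Y n _ w)
  map_add' v w := by
    rw [P.add_extMk]
    congr 1
    exact map_add _ _ _
  map_smul' r w := by
    rw [RingHom.id_apply, Abelian.Ext.smul_eq_comp_mk₀, P.extMk_comp_mk₀]
    congr 1
    rw [map_smul, Linear.comp_smul, Category.comp_id]

lemma aY_surj {A : ModuleCat.{0} R} (P : ProjectiveResolution A) (Y : ModuleCat.{0} R)
    (n : ℕ) : Function.Surjective (aY P Y n) := by
  intro x
  obtain ⟨f, hf, rfl⟩ := P.extMk_surjective x (n + 1) rfl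
  obtain ⟨w, rfl⟩ := jY_surj P Y n f hf
  exact ⟨w, rfl⟩

noncomputable abbrev OldE (A : ModuleCat.{0} R) (Y : ModuleCat.{0} R) (n : ℕ) : ModuleCat.{0} R :=
  (((_root_.Ext R (ModuleCat.{0} R) n).obj (op A)).obj Y)

noncomputable def isoL {A : ModuleCat.{0} R} (P : ProjectiveResolution A) (Y : ModuleCat.{0} R)
    (n : ℕ) : op (OldE A Y n) ≅ (KY P Y).homology n :=
  P.isoLeftDerivedObj (FY Y) n

lemma isoL_nat {A B : ModuleCat.{0} R} (f : A ⟶ B) (Y : ModuleCat.{0} R) (n : ℕ)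
    (P : ProjectiveResolution A) (Q : ProjectiveResolution B)
    (φ : P.complex ⟶ Q.complex) (hφ : φ.f 0 ≫ Q.π.f 0 = P.π.f 0 ≫ f) :
    (((_root_.Ext R (ModuleCat.{0} R) n).map f.op).app Y).op ≫ (isoL Q Y n).hom =
      (isoL P Y n).hom ≫ HomologicalComplex.homologyMap
        (((FY Y).mapHomologicalComplex (ComplexShape.down ℕ)).map φ) n :=
  ProjectiveResolution.isoLeftDerivedObj_hom_naturality f P Q φ hφ (FY Y) n

noncomputable def qY {A : ModuleCat.{0} R} (P : ProjectiveResolution A) (Y : ModuleCat.{0} R)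
    (n : ℕ) : WY P Y n ⟶ OldE A Y n :=
  ((isoL P Y n).hom ≫ (KY P Y).homologyι n).unop

instance {A : ModuleCat.{0} R} (P : ProjectiveResolution A) (Y : ModuleCat.{0} R)
    (n : ℕ) : Epi (qY P Y n) := by
  unfold qY
  infer_instance

lemma aY_zero {A : ModuleCat.{0} R} (P : ProjectiveResolution A) (Y : ModuleCat.{0} R) (n : ℕ) :
    (ModuleCat.ofHom (aY P Y (n + 1))).op ≫ (KY P Y).fromOpcycles (n + 1) n = 0 := by
  apply Quiver.Hom.unop_inj
  refine ModuleCat.hom_ext (LinearMap.ext fun (g : P.complex.X n ⟶ Y) => ?_)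
  change aY P Y (n + 1) (((KY P Y).fromOpcycles (n + 1) n).unop.hom g) = 0
  refine (P.extMk_eq_zero_iff _ _ rfl (jY_cocycle P Y (n + 1) _ _) n rfl).2 ⟨g, ?_⟩
  have h := congrArg Quiver.Hom.unop ((KY P Y).p_fromOpcycles (n + 1) n)
  exact (LinearMap.congr_fun (congrArg ModuleCat.Hom.hom h) g).symm

lemma exists_e {A : ModuleCat.{0} R} (P : ProjectiveResolution A) (Y : ModuleCat.{0} R) (n : ℕ) :
    ∃ e : OldE A Y (n + 1) ⟶ ModuleCat.of R (Abelian.Ext.{0} A Y (n + 1)),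
      qY P Y (n + 1) ≫ e = ModuleCat.ofHom (aY P Y (n + 1)) := by
  have hk := (KY P Y).homologyIsKernel (n + 1) n (by simp)
  obtain ⟨l, hl⟩ := KernelFork.IsLimit.lift' hk _ (aY_zero P Y n)
  refine ⟨(l ≫ (isoL P Y (n + 1)).inv).unop, ?_⟩
  apply Quiver.Hom.op_inj
  rw [← hl]
  unfold qY
  change (l ≫ (isoL P Y (n + 1)).inv) ≫
    ((isoL P Y (n + 1)).hom ≫ (KY P Y).homologyι (n + 1)) =
      l ≫ (KY P Y).homologyι (n + 1)
  simp

noncomputable def eY (A : ModuleCat.{0} R) (Y : ModuleCat.{0} R) (n : ℕ) :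
    OldE A Y (n + 1) ⟶ ModuleCat.of R (Abelian.Ext.{0} A Y (n + 1)) :=
  (exists_e (projectiveResolution A) Y n).choose

lemma q_eY (A : ModuleCat.{0} R) (Y : ModuleCat.{0} R) (n : ℕ) :
    qY (projectiveResolution A) Y (n + 1) ≫ eY A Y n =
      ModuleCat.ofHom (aY (projectiveResolution A) Y (n + 1)) :=
  (exists_e (projectiveResolution A) Y n).choose_spec

lemma eY_surj (A : ModuleCat.{0} R) (Y : ModuleCat.{0} R) (n : ℕ) :
    Function.Surjective (eY A Y n).hom := by
  intro x
  obtain ⟨w, rfl⟩ := aY_surj (projectiveResolution A) Y (n + 1) x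
  exact ⟨(qY _ Y (n + 1)).hom w,
    LinearMap.congr_fun (congrArg ModuleCat.Hom.hom (q_eY A Y n)) w⟩

lemma eY_nat {A B : ModuleCat.{0} R} (f : A ⟶ B) (Y : ModuleCat.{0} R) (n : ℕ) :
    ((_root_.Ext R (ModuleCat.{0} R) (n + 1)).map f.op).app Y ≫ eY A Y n =
      eY B Y n ≫ ModuleCat.ofHom ((Abelian.Ext.mk₀ f).precompOfLinear R Y (zero_add (n + 1))) := by
  set P := projectiveResolution A with hP
  set Q := projectiveResolution B with hQ
  let φ := ProjectiveResolution.lift f P Q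
  have hφ : φ.f 0 ≫ Q.π.f 0 = P.π.f 0 ≫ f := ProjectiveResolution.lift_commutes_zero f P Q
  let Φ := ((FY Y).mapHomologicalComplex (ComplexShape.down ℕ)).map φ
  let ω : WY Q Y (n + 1) ⟶ WY P Y (n + 1) := (HomologicalComplex.opcyclesMap Φ (n + 1)).unop
  have h1 : qY Q Y (n + 1) ≫ ((_root_.Ext R (ModuleCat.{0} R) (n + 1)).map f.op).app Y =
      ω ≫ qY P Y (n + 1) := by
    apply Quiver.Hom.op_inj
    change (((_root_.Ext R (ModuleCat.{0} R) (n + 1)).map f.op).app Y).op ≫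
      ((isoL Q Y (n + 1)).hom ≫ (KY Q Y).homologyι (n + 1)) =
      ((isoL P Y (n + 1)).hom ≫ (KY P Y).homologyι (n + 1)) ≫
        HomologicalComplex.opcyclesMap Φ (n + 1)
    have := isoL_nat f Y (n + 1) P Q φ hφ
    rw [← Category.assoc, this, Category.assoc, Category.assoc,
      ← HomologicalComplex.homologyι_naturality]
  have h2 : ω ≫ ModuleCat.ofHom (aY P Y (n + 1)) = ModuleCat.ofHom (aY Q Y (n + 1)) ≫
      ModuleCat.ofHom ((Abelian.Ext.mk₀ f).precompOfLinear R Y (zero_add (n + 1))) := by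
    refine ModuleCat.hom_ext (LinearMap.ext fun w => ?_)
    let φ' : ProjectiveResolution.Hom P Q f := ⟨φ, by simpa using hφ⟩
    have h3 := ProjectiveResolution.mk₀_comp_extMk (jY Q Y (n + 1) w) (n + 2) rfl
      (jY_cocycle Q Y (n + 1) _ w) φ'
    refine Eq.trans ?_ h3.symm
    change P.extMk (jY P Y (n + 1) (ω.hom w)) (n + 2) rfl (jY_cocycle P Y (n + 1) _ _) = _
    congr 1
    have h4 := congrArg Quiver.Hom.unop (HomologicalComplex.p_opcyclesMap Φ (n + 1))
    exact LinearMap.congr_fun (congrArg ModuleCat.Hom.hom h4) w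
  rw [← cancel_epi (qY Q Y (n + 1)), ← Category.assoc, h1, Category.assoc, q_eY, h2,
    ← Category.assoc, q_eY]

end
end LC

namespace LC
section
open Limits Opposite
variable {R : Type} [CommRing R]

lemma exists_old_surj (p : Ideal R) (n : ℕ) (M : ModuleCat.{0} R) :
    ∃ f : ((localCohomology p (n + 1)).obj M) →ₗ[R] H p (n + 1) M, Function.Surjective f := by
  let D := localCohomology.diagram (localCohomology.idealPowersDiagram p) (n + 1)
  let c : Cocone D := colimit.cocone D
  let ev := (evaluation (ModuleCat.{0} R) (ModuleCat.{0} R)).obj M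
  have hc : IsColimit (ev.mapCocone c) := isColimitOfPreserves ev (colimit.isColimit D)
  let d : Cocone (D ⋙ ev) :=
    { pt := ModuleCat.of R (H p (n + 1) M)
      ι :=
        { app := fun t => eY (X p t.unop.unop) M n ≫ ModuleCat.ofHom (ι p (n + 1) M t.unop.unop)
          naturality := by
            intro s t f
            have hst : s.unop.unop ≤ t.unop.unop := f.unop.unop.down.down
            have h := eY_nat (tr p hst) M n
            change ((_root_.Ext R (ModuleCat.{0} R) (n + 1)).map (tr p hst).op).app M ≫
              (eY (X p t.unop.unop) M n ≫ ModuleCat.ofHom (ι p (n + 1) M t.unop.unop)) =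
              (eY (X p s.unop.unop) M n ≫ ModuleCat.ofHom (ι p (n + 1) M s.unop.unop)) ≫ 𝟙 _
            rw [← Category.assoc, h, Category.assoc, Category.comp_id]
            congr 1
            refine ModuleCat.hom_ext (LinearMap.ext fun x => ?_)
            exact Module.DirectLimit.of_f } }
  refine ⟨(hc.desc d).hom, fun x => ?_⟩
  obtain ⟨t, y, rfl⟩ := exists_ι x
  obtain ⟨z, rfl⟩ := eY_surj (X p t) M n y
  refine ⟨((ev.mapCocone c).ι.app (op (op t))).hom z, ?_⟩
  exact LinearMap.congr_fun (congrArg ModuleCat.Hom.hom (hc.fac d (op (op t)))) z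

lemma height_eq (p : PrimeSpectrum R) : Order.height p = p.asIdeal.height :=
  (PrimeSpectrum.height_eq_orderHeight p).symm

lemma supportDim_loc (p : PrimeSpectrum R) :
    Module.supportDim (L p.asIdeal) (loc p.asIdeal (ModuleCat.of R R)) =
      ((Order.height p : ℕ∞) : WithBot ℕ∞) := by
  rw [height_eq, ← IsLocalization.AtPrime.ringKrullDim_eq_height p.asIdeal (L p.asIdeal),
    ← Module.supportDim_self_eq_ringKrullDim]

lemma lm_surj (p : Ideal R) [p.IsPrime] {M N : Type} [AddCommGroup M] [Module R M]
    [AddCommGroup N] [Module R N] (f : M →ₗ[R] N) (hf : Function.Surjective f) :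
    Function.Surjective (lm p f) := LocalizedModule.map_surjective _ f hf

end
end LC

theorem LC.final_aux {R : Type} [CommRing R] [IsNoetherianRing R]
    (p : PrimeSpectrum R) (n : ℕ) (hn : 0 < n) (hht : Order.height p = (n : ℕ∞))
     (A B : ModuleCat.{0} R) (f : A →ₗ[R] ((localCohomology p.asIdeal n).obj (ModuleCat.of R R)))
    (g : ((localCohomology p.asIdeal n).obj (ModuleCat.of R R)) →ₗ[R] B)
    (hfg : LinearMap.range f = LinearMap.ker g) (hA : Module.Finite R A)
    (hB : p ∉ Module.support R B) : False := by
  obtain ⟨k, rfl⟩ := Nat.exists_eq_succ_of_ne_zero hn.ne'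
  obtain ⟨s, hs⟩ := LC.exists_old_surj p.asIdeal k (ModuleCat.of R R)
  refine LC.T_not_fin p.asIdeal k (ModuleCat.of R R) (inferInstanceAs (Module.Finite R R)) ?_ ?_
  · rw [LC.supportDim_loc, hht]; rfl
  · have hBs : Subsingleton (LocalizedModule p.asIdeal.primeCompl B) :=
      Module.notMem_support_iff.1 hB
    have hex : Function.Exact f g := LinearMap.exact_iff.2 hfg.symm
    have hex' := LC.lm_exact (p := p.asIdeal) hex
    have hsf : Function.Surjective (LC.lm p.asIdeal f) := fun y =>
      (hex' y).1 (Subsingleton.elim _ _)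
    have hfin : Module.Finite (LC.L p.asIdeal) (LocalizedModule p.asIdeal.primeCompl A) :=
      inferInstance
    exact Module.Finite.of_surjective ((LC.lm p.asIdeal s).comp (LC.lm p.asIdeal f))
      ((LC.lm_surj _ s hs).comp hsf)

/-- For a prime `p` of height `n > 0` with `p ∉ Supp(S)`, the local cohomology module
`H^{ht p}_p(R)` does not belong to `FG * S`. -/
theorem stmt_7 {R : Type} [CommRing R] [IsNoetherianRing R] (S : SerreClass R)
    (p : PrimeSpectrum R) (n : ℕ) (hn : 0 < n) (hht : Order.height p = (n : ℕ∞))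
    (hsupp : p ∉ SuppClass R S.mem) :
    ¬ IsExtensionIn R (FGClass R) S.mem
        ((localCohomology p.asIdeal n).obj (ModuleCat.of R R)) := by
  rintro ⟨A, B, f, g, -, -, hfg, hA, hB⟩
  refine LC.final_aux p n hn hht A B f g hfg hA fun h => hsupp ?_
  exact Set.mem_iUnion₂.2 ⟨B, hB, h⟩
end

section
/- Let R be a commutative noetherian ring. The extension subcategory FG * AR (the subcategory of Minimax R-modules) is a Melkersson subcategory if and only if dim R ≤ 1. -/
/-!
Common framework: a *Serre class* is a class of (bundled) `R`-modules closed under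
submodules, quotient modules and extensions.  `MelkerssonCondition R P I` is the
Melkersson condition `(C_I)`: if `Γ_I(M) = M` (every element of `M` is annihilated by
some power of `I`) and `(0 :_M I)` (the `I`-torsion-by-`I` submodule `torsionBySet`)
belongs to the class, then `M` belongs to the class.  `MP R P` is the set of prime
ideals `p` such that the class satisfies `(C_p)`.
-/

open CategoryTheory

variable (R : Type) [CommRing R]

namespace MMxAux

/-- Submodule formulation of minimax modules. -/
def MMx (A M : Type) [CommRing A] [AddCommGroup M] [Module A M] : Prop :=
  ∃ F : Submodule A M, F.FG ∧ IsArtinian A (M ⧸ F)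

section
variable {A M N B : Type} [CommRing A] [AddCommGroup M] [Module A M]
  [AddCommGroup N] [Module A N] [AddCommGroup B] [Module A B]

theorem fg_of_finite [IsNoetherianRing A] [Module.Finite A M] : MMx A M :=
  ⟨⊤, Module.Finite.fg_top, inferInstance⟩

theorem MMx.of_surj (f : M →ₗ[A] N) (hf : Function.Surjective f) (h : MMx A M) : MMx A N := by
  obtain ⟨F, hF, hA⟩ := h
  refine ⟨F.map f, hF.map f, ?_⟩
  refine isArtinian_of_surjective _ (F.mapQ (F.map f) f (Submodule.le_comap_map f F)) ?_
  intro y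
  obtain ⟨y, rfl⟩ := Submodule.Quotient.mk_surjective _ y
  obtain ⟨x, rfl⟩ := hf y
  exact ⟨Submodule.Quotient.mk x, rfl⟩

theorem MMx.of_inj [IsNoetherianRing A] (f : N →ₗ[A] M) (hf : Function.Injective f)
    (h : MMx A M) : MMx A N := by
  obtain ⟨F, hF, hA⟩ := h
  refine ⟨F.comap f, ?_, ?_⟩
  · have : IsNoetherian A F := isNoetherian_of_fg_of_noetherian F hF
    have : IsNoetherian A (F.comap f) :=
      isNoetherian_of_injective (f.restrict (p := F.comap f) (q := F) (fun x hx => hx)) (by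
        intro x y hxy
        apply Subtype.ext
        exact hf (congrArg Subtype.val hxy))
    exact Module.Finite.iff_fg.mp inferInstance
  · refine isArtinian_of_injective ((F.comap f).mapQ F f le_rfl) ?_
    rw [← LinearMap.ker_eq_bot, Submodule.ker_mapQ]
    simp

theorem MMx.ext [IsNoetherianRing A] (f : N →ₗ[A] M) (g : M →ₗ[A] B)
    (hfg : LinearMap.range f = LinearMap.ker g) (hN : MMx A N) (hB : MMx A B) : MMx A M := by
  obtain ⟨F, hF, hFA⟩ := hN
  obtain ⟨F', hF', hFA'⟩ := hB
  have : IsNoetherian A F' := isNoetherian_of_fg_of_noetherian F' hF'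
  have h1 : ((F' : Submodule A B) ⊓ LinearMap.range g).FG := by
    have : IsNoetherian A ((F' : Submodule A B) ⊓ LinearMap.range g : Submodule A B) :=
      isNoetherian_of_le (t := F') inf_le_left
    exact Module.Finite.iff_fg.mp inferInstance
  obtain ⟨s, hs⟩ := h1
  have h2 : ∀ x ∈ s, ∃ y, g y = x := by
    intro x hx
    have : x ∈ ((F' : Submodule A B) ⊓ LinearMap.range g) := hs ▸ Submodule.subset_span hx
    exact this.2
  classical
  choose! c hc using h2
  let G : Submodule A M := Submodule.span A (s.image c : Finset M)
  have hG : G.map g = (F' : Submodule A B) ⊓ LinearMap.range g := by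
    rw [← hs, Submodule.map_span]
    congr 1
    ext x
    simp only [Finset.coe_image, Set.mem_image, exists_exists_and_eq_and]
    constructor
    · rintro ⟨a, ha, rfl⟩; rw [hc a ha]; exact ha
    · intro hx; exact ⟨x, hx, hc x hx⟩
  have hGle : ∀ x ∈ G, g x ∈ F' := fun x hx => by
    have : g x ∈ G.map g := Submodule.mem_map_of_mem hx
    rw [hG] at this
    exact this.1
  have hgf : ∀ x, g (f x) = 0 := fun x => by
    have : f x ∈ LinearMap.ker g := hfg ▸ LinearMap.mem_range_self f x
    exact this
  refine ⟨F.map f ⊔ G, (hF.map f).sup ⟨_, rfl⟩, ?_⟩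
  refine isArtinian_of_range_eq_ker
    (F.mapQ (F.map f ⊔ G) f (fun x hx => Submodule.mem_sup_left (Submodule.mem_map_of_mem hx)))
    ((F.map f ⊔ G).mapQ F' g (sup_le ?_ hGle)) ?_
  · rintro _ ⟨x, hx, rfl⟩
    simp [hgf]
  · apply le_antisymm
    · rintro _ ⟨x, rfl⟩
      obtain ⟨x, rfl⟩ := Submodule.Quotient.mk_surjective _ x
      simp [hgf]
    · intro x hx
      obtain ⟨x, rfl⟩ := Submodule.Quotient.mk_surjective _ x
      have hx' : g x ∈ F' := by
        simpa using hx
      have : g x ∈ G.map g := by rw [hG]; exact ⟨hx', ⟨x, rfl⟩⟩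
      obtain ⟨y, hy, hyx⟩ := this
      have : x - y ∈ LinearMap.ker g := by simp [hyx]
      rw [← hfg] at this
      obtain ⟨z, hz⟩ := this
      refine ⟨Submodule.Quotient.mk z, ?_⟩
      rw [Submodule.mapQ_apply, Submodule.Quotient.eq, hz]
      apply Submodule.mem_sup_right
      simpa using hy

theorem MMx.pi {k : ℕ} (h : MMx A M) : MMx A (Fin k → M) := by
  obtain ⟨F, hF, hA⟩ := h
  refine ⟨Submodule.pi Set.univ (fun _ => F), Submodule.fg_pi (fun _ => hF), ?_⟩
  exact isArtinian_of_linearEquiv (Submodule.quotientPi (fun _ : Fin k => F)).symm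

theorem MMx.tors [IsNoetherianRing A] (J : Ideal A) (P Q : Submodule A M)
    (hJ : MMx A (Submodule.torsionBySet A M (J : Set A))) (hQ : MMx A Q)
    (h : ∀ x ∈ P, ∀ a ∈ J, a • x ∈ Q) : MMx A P := by
  obtain ⟨k, b, hb⟩ := Submodule.fg_iff_exists_fin_generating_family.mp (IsNoetherian.noetherian J)
  have hbJ : ∀ i, b i ∈ J := fun i => hb ▸ Submodule.subset_span ⟨i, rfl⟩
  let φ : P →ₗ[A] (Fin k → Q) := LinearMap.pi fun i =>
    (LinearMap.lsmul A M (b i)).restrict (p := P) (q := Q) (fun x hx => h x hx _ (hbJ i))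
  refine MMx.ext (LinearMap.ker φ).subtype φ (Submodule.range_subtype _) ?_ hQ.pi
  have hk : ∀ x : LinearMap.ker φ, ((x : P) : M) ∈ Submodule.torsionBySet A M (J : Set A) := by
    rintro ⟨⟨x, hxP⟩, hx⟩
    have h0 : ∀ i, b i • x = 0 := fun i => by
      have := congrArg Subtype.val (congrFun hx i)
      exact this
    rw [Submodule.mem_torsionBySet_iff]
    rintro ⟨a, ha⟩
    have : J ≤ LinearMap.ker (LinearMap.toSpanSingleton A M x) := by
      rw [← hb, Submodule.span_le]
      rintro _ ⟨i, rfl⟩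
      exact h0 i
    exact this ha
  refine MMx.of_inj ((P.subtype ∘ₗ (LinearMap.ker φ).subtype).codRestrict _ hk) ?_ hJ
  intro x y hxy
  have := congrArg Subtype.val hxy
  exact Subtype.ext (Subtype.ext this)

theorem exists_smul_eq_zero [IsArtinian A M] (p : Ideal A) [hp : p.IsPrime] (hm : ¬ p.IsMaximal)
    (x : M) : ∃ s, s ∉ p ∧ s • x = 0 := by
  by_contra! hcon
  have hle : LinearMap.ker (LinearMap.toSpanSingleton A M x) ≤ p := by
    intro s hs
    by_contra hsp
    exact hcon s hsp hs
  have h1 : IsArtinian A (A ⧸ LinearMap.ker (LinearMap.toSpanSingleton A M x)) :=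
    isArtinian_of_linearEquiv (LinearMap.quotKerEquivRange _).symm
  have h2 : IsArtinian A (A ⧸ p) :=
    isArtinian_of_surjective _ (Submodule.factor hle) (Submodule.factor_surjective hle)
  have h3 : IsArtinianRing (A ⧸ p) := isArtinian_of_tower A h2
  exact hm (Ideal.Quotient.maximal_of_isField p (IsArtinianRing.isField_of_isDomain _))

theorem artinian_of_local [IsNoetherianRing A] [Module.Finite A M]
    (h : ∀ p : Ideal A, p.IsPrime → ¬ p.IsMaximal → ∀ x : M, ∃ s, s ∉ p ∧ s • x = 0) :
    IsArtinian A M := by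
  have h1 : ∀ x : M, IsArtinian A (Submodule.span A {x}) := by
    intro x
    rw [← LinearMap.range_toSpanSingleton]
    let K : Ideal A := LinearMap.ker (LinearMap.toSpanSingleton A M x)
    have hK : Ring.KrullDimLE 0 (A ⧸ K) := by
      apply Ring.KrullDimLE.mk₀
      intro P hP
      have hc : (P.comap (Ideal.Quotient.mk K)).IsMaximal := by
        by_contra hm
        obtain ⟨s, hs, hsx⟩ := h _ (Ideal.comap_isPrime (Ideal.Quotient.mk K) P) hm x
        apply hs
        have : Ideal.Quotient.mk K s = 0 := Ideal.Quotient.eq_zero_iff_mem.mpr hsx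
        rw [Ideal.mem_comap, this]
        exact P.zero_mem
      have := Ideal.map_eq_top_or_isMaximal_of_surjective _
        (Ideal.Quotient.mk_surjective (I := K)) hc
      rw [Ideal.map_comap_of_surjective _ Ideal.Quotient.mk_surjective] at this
      exact this.resolve_left hP.ne_top
    have hR : IsArtinianRing (A ⧸ K) := isArtinianRing_iff_krullDimLE_zero.mpr hK
    have hA : IsArtinian A (A ⧸ K) :=
      (isArtinian_of_surjective_algebraMap (S := A) (R := A ⧸ K) (M := A ⧸ K)
        Ideal.Quotient.mk_surjective)
    exact isArtinian_of_linearEquiv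
      (LinearMap.quotKerEquivRange (LinearMap.toSpanSingleton A M x))
  obtain ⟨k, b, hb⟩ := Submodule.fg_iff_exists_fin_generating_family.mp
    (Module.Finite.fg_top (R := A) (M := M))
  have h2 : IsArtinian A (⨆ i, Submodule.span A {b i} : Submodule A M) := isArtinian_iSup
  rw [← Submodule.span_range_eq_iSup, hb] at h2
  exact isArtinian_of_linearEquiv Submodule.topEquiv

theorem MMx.artinian [IsNoetherianRing A] (hM : MMx A M)
    (h : ∀ p : Ideal A, p.IsPrime → ¬ p.IsMaximal → ∀ x : M, ∃ s, s ∉ p ∧ s • x = 0) :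
    IsArtinian A M := by
  obtain ⟨F, hF, hA⟩ := hM
  have : Module.Finite A F := Module.Finite.iff_fg.mpr hF
  have : IsArtinian A F := artinian_of_local fun p hp hm x => by
    obtain ⟨s, hs, hsx⟩ := h p hp hm x
    exact ⟨s, hs, Subtype.ext hsx⟩
  exact (isArtinian_iff_submodule_quotient F).mpr ⟨this, hA⟩

end
end MMxAux

namespace MMxAux
section
variable {A M N B : Type} [CommRing A] [AddCommGroup M] [Module A M]
  [AddCommGroup N] [Module A N] [AddCommGroup B] [Module A B]

/-- Melkersson's lemma for a principal ideal. -/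
theorem artinian_principal (a : A) (ht : ∀ m : M, ∃ n : ℕ, a ^ n • m = 0)
    [IsArtinian A (Submodule.torsionBy A M a)] : IsArtinian A M := by
  rw [← monotone_stabilizes_iff_artinian]
  intro f
  let g : ℕ → Submodule A M := fun i => OrderDual.ofDual (f i)
  have hg : ∀ i j, i ≤ j → g j ≤ g i := fun i j hij => f.monotone hij
  let T : ℕ → ℕ → Submodule A (Submodule.torsionBy A M a) := fun k i =>
    ((g i).map (LinearMap.lsmul A M (a ^ k))).comap (Submodule.torsionBy A M a).subtype
  have hT : ∀ k i x, x ∈ T k i ↔ ∃ y ∈ g i, a ^ k • y = (x : M) := fun k i x => Iff.rfl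
  have hT1 : ∀ k i j, i ≤ j → T k j ≤ T k i := by
    intro k i j hij x hx
    rw [hT] at hx ⊢
    obtain ⟨y, hy, h⟩ := hx
    exact ⟨y, hg _ _ hij hy, h⟩
  have hT2 : ∀ k l i, k ≤ l → T l i ≤ T k i := by
    intro k l i hkl x hx
    rw [hT] at hx ⊢
    obtain ⟨y, hy, h⟩ := hx
    refine ⟨a ^ (l - k) • y, Submodule.smul_mem _ _ hy, ?_⟩
    rw [smul_smul, ← pow_add, Nat.add_sub_cancel' hkl, h]
  obtain ⟨n0, hn0⟩ := IsArtinian.monotone_stabilizes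
    (⟨fun i => OrderDual.toDual (T i i), fun i j hij =>
      (hT1 j i j hij).trans (hT2 i j i hij)⟩ : ℕ →o (Submodule A (Submodule.torsionBy A M a))ᵒᵈ)
  have hn0 : ∀ m, n0 ≤ m → T n0 n0 = T m m := hn0
  have hst : ∀ k, ∃ n, ∀ m, n ≤ m → T k n = T k m := fun k =>
    IsArtinian.monotone_stabilizes
    (⟨fun i => OrderDual.toDual (T k i), fun i j hij => hT1 k i j hij⟩ :
      ℕ →o (Submodule A (Submodule.torsionBy A M a))ᵒᵈ)
  choose c hc using hst
  let n := n0 + (Finset.range n0).sup c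
  have key : ∀ k m, n ≤ m → T k n ≤ T k m := by
    intro k m hm
    by_cases hk : k < n0
    · have h1 : c k ≤ n := (Finset.le_sup (f := c) (Finset.mem_range.mpr hk)).trans
        (Nat.le_add_left _ _)
      rw [← hc k n h1, ← hc k m (h1.trans hm)]
    · push Not at hk
      have h1 : n0 ≤ n := Nat.le_add_right _ _
      calc T k n ≤ T n0 n := hT2 _ _ _ hk
        _ ≤ T n0 n0 := hT1 _ _ _ h1
        _ = T (max k m) (max k m) := hn0 _ (hk.trans (le_max_left _ _))
        _ ≤ T k (max k m) := hT2 _ _ _ (le_max_left _ _)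
        _ ≤ T k m := hT1 _ _ _ (le_max_right _ _)
  refine ⟨n, fun m hm => ?_⟩
  have hle : g n ≤ g m := by
    have : ∀ k, ∀ x ∈ g n, a ^ k • x = 0 → x ∈ g m := by
      intro k
      induction k with
      | zero => intro x _ h; simp at h; rw [h]; exact Submodule.zero_mem _
      | succ k ih =>
        intro x hx h
        have hX : a ^ k • x ∈ Submodule.torsionBy A M a := by
          rw [Submodule.mem_torsionBy_iff, smul_smul, ← pow_succ', h]
        have h1 : (⟨_, hX⟩ : Submodule.torsionBy A M a) ∈ T k n := (hT _ _ _).mpr ⟨x, hx, rfl⟩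
        obtain ⟨y, hy, hyx⟩ := (hT _ _ _).mp (key k m hm h1)
        have h2 : x - y ∈ g m := ih _ (Submodule.sub_mem _ hx (hg _ _ hm hy)) (by
          rw [smul_sub, hyx, sub_self])
        simpa using Submodule.add_mem _ h2 hy
    intro x hx
    obtain ⟨k, hk⟩ := ht x
    exact this k x hx hk
  have : g n = g m := le_antisymm hle (hg _ _ hm)
  exact this

theorem artinian_finset [DecidableEq A] (s : Finset A)
    (ht : ∀ a ∈ s, ∀ m : M, ∃ n : ℕ, a ^ n • m = 0)
    (h : IsArtinian A (Submodule.torsionBySet A M (s : Set A))) : IsArtinian A M := by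
  induction s using Finset.induction_on with
  | empty =>
    have : Submodule.torsionBySet A M ((∅ : Finset A) : Set A) = ⊤ := by
      ext x; simp
    rw [this] at h
    exact isArtinian_of_linearEquiv Submodule.topEquiv
  | insert a s ha ih =>
    refine ih (fun b hb => ht b (Finset.mem_insert_of_mem hb)) ?_
    have : IsArtinian A (Submodule.torsionBy A (Submodule.torsionBySet A M (s : Set A)) a) := by
      let φ : Submodule.torsionBy A (Submodule.torsionBySet A M (s : Set A)) a →ₗ[A]
          Submodule.torsionBySet A M ((insert a s : Finset A) : Set A) :=
        LinearMap.codRestrict _ ((Submodule.torsionBySet A M (s : Set A)).subtype ∘ₗ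
          (Submodule.torsionBy A (Submodule.torsionBySet A M (s : Set A)) a).subtype) (by
          rintro ⟨⟨x, hx⟩, hxa⟩
          rw [Submodule.mem_torsionBySet_iff] at hx ⊢
          rintro ⟨b, hb⟩
          rw [Finset.mem_coe, Finset.mem_insert] at hb
          rcases hb with rfl | hb
          · exact congrArg Subtype.val hxa
          · exact hx ⟨b, hb⟩)
      refine isArtinian_of_injective φ ?_
      intro x y hxy
      have h1 := congrArg Subtype.val hxy
      exact Subtype.ext (Subtype.ext h1)
    refine artinian_principal a ?_
    rintro ⟨m, hm⟩
    obtain ⟨n, hn⟩ := ht a (Finset.mem_insert_self a s) m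
    exact ⟨n, Subtype.ext hn⟩

theorem artinian_melkersson [IsNoetherianRing A] (I : Ideal A)
    (ht : ∀ m : M, ∃ n : ℕ, ∀ x ∈ I ^ n, x • m = 0)
    (h : IsArtinian A (Submodule.torsionBySet A M (I : Set A))) : IsArtinian A M := by
  classical
  obtain ⟨s, hs⟩ := IsNoetherian.noetherian I
  refine artinian_finset s ?_ ?_
  · intro a ha m
    obtain ⟨n, hn⟩ := ht m
    exact ⟨n, hn _ (Ideal.pow_mem_pow (hs ▸ Submodule.subset_span ha) n)⟩
  · have : Submodule.torsionBySet A M (s : Set A) = Submodule.torsionBySet A M (I : Set A) := by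
      rw [← hs]
      exact Submodule.torsionBySet_eq_torsionBySet_span _
    rwa [this]

theorem exists_kill [IsNoetherianRing A] : ∃ n : ℕ, ∀ p ∈ minimalPrimes A,
    ∃ t, t ∉ p ∧ ∀ a ∈ p ^ n, t * a = 0 := by
  obtain ⟨Z, hZ⟩ := PrimeSpectrum.exists_primeSpectrum_prod_le A ⊥
  refine ⟨Multiset.card Z, fun p hp => ?_⟩
  have hpp : p.IsPrime := hp.1.1
  have : ∀ Z : Multiset (PrimeSpectrum A), ∃ t, t ∉ p ∧
      Ideal.span {t} * p ^ (Multiset.card Z) ≤ (Z.map PrimeSpectrum.asIdeal).prod := by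
    intro Z
    induction Z using Multiset.induction_on with
    | empty => exact ⟨1, fun h => hpp.ne_top ((Ideal.eq_top_iff_one _).mpr h), by simp⟩
    | cons q Z ih =>
      obtain ⟨t, htp, ht⟩ := ih
      rw [Multiset.map_cons, Multiset.prod_cons, Multiset.card_cons, pow_succ']
      by_cases hq : q.asIdeal ≤ p
      · have hpq : p ≤ q.asIdeal := hp.2 ⟨q.isPrime, bot_le⟩ hq
        refine ⟨t, htp, ?_⟩
        rw [mul_left_comm]
        exact Ideal.mul_mono hpq ht
      · obtain ⟨s, hs, hsp⟩ := SetLike.not_le_iff_exists.mp hq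
        refine ⟨s * t, fun h => (hpp.mem_or_mem h).elim hsp htp, ?_⟩
        rw [← Ideal.span_singleton_mul_span_singleton, mul_assoc]
        refine Ideal.mul_mono ((Ideal.span_singleton_le_iff_mem _).mpr hs) ?_
        refine le_trans (Ideal.mul_mono le_rfl Ideal.mul_le_right) ht
  obtain ⟨t, htp, ht⟩ := this Z
  refine ⟨t, htp, fun a ha => ?_⟩
  exact hZ (ht (Ideal.mul_mem_mul (Ideal.mem_span_singleton_self t) ha))

theorem melkersson_of_dim [IsNoetherianRing A]
    (hd : ∀ p : Ideal A, p.IsPrime → p ∈ minimalPrimes A ∨ p.IsMaximal) (I : Ideal A)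
    (ht : ∀ m : M, ∃ n : ℕ, ∀ x ∈ I ^ n, x • m = 0)
    (h : MMx A (Submodule.torsionBySet A M (I : Set A))) : MMx A M := by
  obtain ⟨n, hn⟩ := exists_kill (A := A)
  have hMn : ∀ k, MMx A (Submodule.torsionBySet A M ((I ^ k : Ideal A) : Set A)) := by
    intro k
    induction k with
    | zero =>
      refine MMx.of_inj (Submodule.inclusion ?_) (Submodule.inclusion_injective _) h
      intro x hx
      rw [Submodule.mem_torsionBySet_iff] at hx
      have : (1 : A) • x = 0 := hx ⟨1, by simp⟩
      rw [one_smul] at this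
      rw [this]; exact Submodule.zero_mem _
    | succ k ih =>
      refine MMx.tors I _ _ h ih ?_
      intro x hx a ha
      rw [Submodule.mem_torsionBySet_iff] at hx ⊢
      rintro ⟨b, hb⟩
      have : (b * a) • x = 0 := hx ⟨b * a, by rw [pow_succ]; exact Ideal.mul_mem_mul hb ha⟩
      rw [← this, mul_smul]
  let M' := Submodule.torsionBySet A M ((I ^ n : Ideal A) : Set A)
  obtain ⟨F0, hF0, hA0⟩ : MMx A M' := hMn n
  let F : Submodule A M := F0.map M'.subtype
  have hF : F.FG := hF0.map _
  have hloc : ∀ p : Ideal A, p.IsPrime → ¬ p.IsMaximal → ∀ x : M, ∃ s, s ∉ p ∧ s • x ∈ F := by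
    intro p hp hm x
    by_cases hI : I ≤ p
    · obtain ⟨t, htp, hta⟩ := hn p ((hd p hp).resolve_right hm)
      have hx : t • x ∈ M' := by
        rw [Submodule.mem_torsionBySet_iff]
        rintro ⟨b, hb⟩
        change b • t • x = 0
        rw [smul_smul, mul_comm, hta b (Ideal.pow_right_mono hI n hb), zero_smul]
      obtain ⟨s, hsp, hs⟩ := exists_smul_eq_zero (M := M' ⧸ F0) p hm
        (Submodule.Quotient.mk ⟨t • x, hx⟩)
      refine ⟨s * t, fun h => (hp.mem_or_mem h).elim hsp htp, ?_⟩
      rw [← Submodule.Quotient.mk_smul, Submodule.Quotient.mk_eq_zero] at hs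
      exact ⟨_, hs, by simp [mul_smul]⟩
    · obtain ⟨s, hs, hsp⟩ := SetLike.not_le_iff_exists.mp hI
      obtain ⟨k, hk⟩ := ht x
      refine ⟨s ^ k, fun h => hsp (hp.mem_of_pow_mem _ h), ?_⟩
      rw [hk _ (Ideal.pow_mem_pow hs k)]
      exact Submodule.zero_mem _
  refine ⟨F, hF, artinian_melkersson I ?_ ?_⟩
  · intro m
    obtain ⟨m, rfl⟩ := Submodule.Quotient.mk_surjective _ m
    obtain ⟨k, hk⟩ := ht m
    exact ⟨k, fun x hx => by rw [← Submodule.Quotient.mk_smul, hk x hx]; rfl⟩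
  · let Y : Submodule A M := (Submodule.torsionBySet A (M ⧸ F) (I : Set A)).comap F.mkQ
    have hFfin : Module.Finite A F := Module.Finite.iff_fg.mpr hF
    have hY : MMx A Y := by
      refine MMx.tors I _ F h fg_of_finite ?_
      intro x hx a ha
      have := (Submodule.mem_torsionBySet_iff _ _).mp hx ⟨a, ha⟩
      exact (Submodule.Quotient.mk_eq_zero F).mp this
    refine MMx.artinian (hY.of_surj (F.mkQ.restrict (p := Y)
      (q := Submodule.torsionBySet A (M ⧸ F) (I : Set A)) (fun x hx => hx)) ?_) ?_
    · rintro ⟨y, hy⟩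
      obtain ⟨x, rfl⟩ := Submodule.Quotient.mk_surjective _ y
      exact ⟨⟨x, hy⟩, rfl⟩
    · rintro p hp hm ⟨y, hy⟩
      obtain ⟨x, rfl⟩ := Submodule.Quotient.mk_surjective _ y
      obtain ⟨s, hs, hsx⟩ := hloc p hp hm x
      refine ⟨s, hs, Subtype.ext ?_⟩
      exact (Submodule.Quotient.mk_eq_zero F).mpr hsx

/-- Existence of the counterexample when the dimension is at least two. -/
theorem exists_counter [IsNoetherianRing A] (p q : Ideal A) [hp : p.IsPrime] [hq : q.IsPrime]
    (x : A) (hxp : x ∉ p) (hxq : x ∈ q) (hpq : p ≤ q) (hm : ¬ q.IsMaximal) :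
    ∃ (M : Type) (_ : AddCommGroup M) (_ : Module A M),
      (∀ m : M, ∃ n : ℕ, ∀ y ∈ (Ideal.span {x}) ^ n, y • m = 0) ∧
      Module.Finite A (Submodule.torsionBySet A M ((Ideal.span {x} : Ideal A) : Set A)) ∧
      ¬ MMx A M := by
  let D := A ⧸ p
  let x' : D := Ideal.Quotient.mk p x
  have hx' : x' ≠ 0 := fun h => hxp (Ideal.Quotient.eq_zero_iff_mem.mp h)
  let L := Localization.Away x'
  have hinj : Function.Injective (algebraMap D L) :=
    IsLocalization.injective L (powers_le_nonZeroDivisors_of_noZeroDivisors hx')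
  let W : Submodule A L := LinearMap.range ((IsScalarTower.toAlgHom A D L).toLinearMap)
  have hW : ∀ z : L, z ∈ W ↔ ∃ d : D, algebraMap D L d = z := fun z => Iff.rfl
  have hsm : ∀ (a : A) (z : L), a • z = algebraMap D L (Ideal.Quotient.mk p a) * z := by
    intro a z
    rw [Algebra.smul_def, IsScalarTower.algebraMap_apply A D L]; rfl
  let u : L := IsLocalization.Away.invSelf x'
  have hu : algebraMap D L x' * u = 1 := IsLocalization.Away.mul_invSelf x'
  have htors : ∀ m : L ⧸ W, ∃ n : ℕ, x ^ n • m = 0 := by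
    intro m
    obtain ⟨z, rfl⟩ := Submodule.Quotient.mk_surjective _ m
    obtain ⟨n, d, hd⟩ := IsLocalization.Away.surj x' z
    refine ⟨n, ?_⟩
    rw [← Submodule.Quotient.mk_smul, Submodule.Quotient.mk_eq_zero, hW]
    refine ⟨d, ?_⟩
    rw [hsm, ← hd, mul_comm, map_pow, map_pow]
  have hdiv : ∀ (n : ℕ) (m : L ⧸ W), ∃ m', x ^ n • m' = m := by
    intro n m
    obtain ⟨z, rfl⟩ := Submodule.Quotient.mk_surjective _ m
    refine ⟨Submodule.Quotient.mk (u ^ n * z), ?_⟩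
    rw [← Submodule.Quotient.mk_smul]
    congr 1
    rw [hsm, map_pow, map_pow, ← mul_assoc, ← mul_pow, hu, one_pow, one_mul]
  refine ⟨L ⧸ W, inferInstance, inferInstance, ?_, ?_, ?_⟩
  · intro m
    obtain ⟨n, hn⟩ := htors m
    refine ⟨n, fun y hy => ?_⟩
    rw [Ideal.span_singleton_pow, Ideal.mem_span_singleton] at hy
    obtain ⟨c, rfl⟩ := hy
    rw [mul_comm, mul_smul, hn, smul_zero]
  · have hle : Submodule.torsionBySet A (L ⧸ W) ((Ideal.span {x} : Ideal A) : Set A) ≤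
        Submodule.span A {Submodule.Quotient.mk u} := by
      intro m hm
      obtain ⟨z, rfl⟩ := Submodule.Quotient.mk_surjective _ m
      have h1 := (Submodule.mem_torsionBySet_iff _ _).mp hm ⟨x, Ideal.mem_span_singleton_self x⟩
      change x • _ = _ at h1
      rw [← Submodule.Quotient.mk_smul, Submodule.Quotient.mk_eq_zero, hW] at h1
      obtain ⟨d, hd⟩ := h1
      obtain ⟨a, rfl⟩ := Ideal.Quotient.mk_surjective d
      rw [Submodule.mem_span_singleton]
      refine ⟨a, ?_⟩
      rw [← Submodule.Quotient.mk_smul]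
      congr 1
      rw [hsm, hd, hsm, mul_right_comm]
      change algebraMap D L x' * u * z = z
      rw [hu, one_mul]
    have : IsNoetherian A (Submodule.span A {(Submodule.Quotient.mk u : L ⧸ W)}) :=
      isNoetherian_span_of_finite A (Set.finite_singleton _)
    have := isNoetherian_of_le hle
    infer_instance
  · rintro ⟨F, ⟨s, hs⟩, hA⟩
    choose c hc using htors
    let n := s.sup c
    have hkill : F ≤ LinearMap.ker (LinearMap.lsmul A (L ⧸ W) (x ^ n)) := by
      rw [← hs, Submodule.span_le]
      intro m hm
      have : c m ≤ n := Finset.le_sup (f := c) hm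
      change x ^ n • m = 0
      rw [← Nat.sub_add_cancel this, pow_add, mul_smul, hc, smul_zero]
    have hArt : IsArtinian A (L ⧸ W) := by
      refine isArtinian_of_surjective _ (F.liftQ (LinearMap.lsmul A (L ⧸ W) (x ^ n)) hkill) ?_
      intro m
      obtain ⟨m', hm'⟩ := hdiv n m
      exact ⟨Submodule.Quotient.mk m', hm'⟩
    obtain ⟨t, htq, ht⟩ := exists_smul_eq_zero q hm (Submodule.Quotient.mk u : L ⧸ W)
    rw [← Submodule.Quotient.mk_smul, Submodule.Quotient.mk_eq_zero, hW] at ht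
    obtain ⟨d, hd⟩ := ht
    obtain ⟨a, rfl⟩ := Ideal.Quotient.mk_surjective d
    have h2 : algebraMap D L (Ideal.Quotient.mk p (x * a)) =
        algebraMap D L (Ideal.Quotient.mk p t) := by
      rw [map_mul, map_mul, hd, hsm, mul_left_comm]
      change _ * (algebraMap D L x' * u) = _
      rw [hu, mul_one]
    have h3 := hpq (Ideal.Quotient.eq.mp (hinj h2))
    apply htq
    have := Ideal.sub_mem _ (Ideal.mul_mem_right a q hxq) h3
    simpa using this

end

theorem isExt_iff {A : Type} [CommRing A] [IsNoetherianRing A] (M : ModuleCat.{0} A) :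
    IsExtensionIn A (FGClass A) (fun M : ModuleCat.{0} A => IsArtinian A M) M ↔ MMx A M := by
  constructor
  · rintro ⟨X, B, f, g, hf, hg, hfg, hX, hB⟩
    have hX : Module.Finite A X := hX
    have hB : IsArtinian A B := hB
    refine ⟨LinearMap.range f, Module.Finite.iff_fg.mp inferInstance, ?_⟩
    rw [hfg]
    exact isArtinian_of_linearEquiv (g.quotKerEquivOfSurjective hg).symm
  · rintro ⟨F, hF, hA⟩
    exact ⟨ModuleCat.of A F, ModuleCat.of A (M ⧸ F), F.subtype, F.mkQ, F.injective_subtype,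
      F.mkQ_surjective, by simp, Module.Finite.iff_fg.mpr hF, hA⟩

end MMxAux

/-- `FG * AR` (the Minimax modules) is a Melkersson subcategory iff `dim R ≤ 1`. -/
theorem stmt_11 {R : Type} [CommRing R] [IsNoetherianRing R] :
    (∀ I : Ideal R,
        MelkerssonCondition R
          (IsExtensionIn R (FGClass R) (fun M : ModuleCat.{0} R => IsArtinian R M)) I) ↔
      ringKrullDim R ≤ 1 := by
  have hdim : ringKrullDim R ≤ 1 ↔ ∀ p : Ideal R, p.IsPrime → p ∈ minimalPrimes R ∨ p.IsMaximal := by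
    rw [← Ring.krullDimLE_one_iff, Ring.KrullDimLE, Order.krullDimLE_iff]
    rfl
  rw [hdim]
  constructor
  · intro h q hq
    by_contra! hcon
    obtain ⟨p, hpm, hpq⟩ := Ideal.exists_minimalPrimes_le (I := (⊥ : Ideal R)) (J := q) bot_le
    have hp : p.IsPrime := hpm.1.1
    have hne : ¬ q ≤ p := fun hle => hcon.1 (le_antisymm hle hpq ▸ hpm)
    obtain ⟨x, hxq, hxp⟩ := SetLike.not_le_iff_exists.mp hne
    obtain ⟨M, _, _, h1, h2, h3⟩ := MMxAux.exists_counter p q x hxp hxq hpq hcon.2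
    apply h3
    refine (MMxAux.isExt_iff (ModuleCat.of R M)).mp (h (Ideal.span {x}) (ModuleCat.of R M) h1 ?_)
    rw [MMxAux.isExt_iff]
    have h2' : Module.Finite R (ModuleCat.of R
        (Submodule.torsionBySet R (ModuleCat.of R M) ((Ideal.span {x} : Ideal R) : Set R))) := h2
    exact MMxAux.fg_of_finite
  · intro hd I M hM h
    rw [MMxAux.isExt_iff] at h ⊢
    exact MMxAux.melkersson_of_dim hd I hM h
end

section
/- Let R be a semi-local commutative noetherian ring (a ring with only finitely many maximal ideals). The extension subcategory FG * FS (the subcategory of FSF R-modules) is a Melkersson subcategory if and only if dim R ≤ 2. -/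
/-!
Common framework: a *Serre class* is a class of (bundled) `R`-modules closed under
submodules, quotient modules and extensions.  `MelkerssonCondition R P I` is the
Melkersson condition `(C_I)`: if `Γ_I(M) = M` (every element of `M` is annihilated by
some power of `I`) and `(0 :_M I)` (the `I`-torsion-by-`I` submodule `torsionBySet`)
belongs to the class, then `M` belongs to the class.  `MP R P` is the set of prime
ideals `p` such that the class satisfies `(C_p)`.
-/

open CategoryTheory

variable (R : Type) [CommRing R]

section Helpers

/-- Internal description of FSF modules. -/
def FSF (R : Type) [CommRing R] (M : Type) [AddCommGroup M] [Module R M] : Prop :=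
  ∃ F : Submodule R M, F.FG ∧ (Module.support R (M ⧸ F)).Finite

theorem isExt_iff_FSF {R : Type} [CommRing R] (M : ModuleCat.{0} R) :
    IsExtensionIn R (FGClass R)
      (fun M : ModuleCat.{0} R => (Module.support R M).Finite) M ↔ FSF R M := by
  constructor
  · rintro ⟨A, B, f, g, hf, hg, hfg, hA, hB⟩
    have hA' : Module.Finite R A := hA
    refine ⟨LinearMap.ker g, ?_, ?_⟩
    · rw [← hfg]
      exact Module.Finite.iff_fg.mp (Module.Finite.range f)
    · rw [(g.quotKerEquivOfSurjective hg).support_eq]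
      exact hB
  · rintro ⟨F, hF, hS⟩
    exact ⟨ModuleCat.of R F, ModuleCat.of R (M ⧸ F), F.subtype, F.mkQ,
      F.injective_subtype, F.mkQ_surjective, by simp, Module.Finite.iff_fg.mpr hF, hS⟩

theorem FSF.of_support {R : Type} [CommRing R] {M : Type} [AddCommGroup M] [Module R M]
    (h : (Module.support R M).Finite) : FSF R M :=
  ⟨⊥, Submodule.fg_bot, h.subset
    (Module.support_subset_of_surjective (Submodule.mkQ ⊥) (Submodule.mkQ_surjective _))⟩

theorem FSF.of_ker {R : Type} [CommRing R] [IsNoetherianRing R]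
    {M N : Type} [AddCommGroup M] [Module R M] [AddCommGroup N] [Module R N]
    (f : M →ₗ[R] N) (hk : FSF R (LinearMap.ker f)) (hN : FSF R N) : FSF R M := by
  obtain ⟨F', hF', hS'⟩ := hk
  obtain ⟨F, hF, hS⟩ := hN
  -- the part of `F` in the range of `f` is finitely generated
  have hFin : Module.Finite R F := Module.Finite.iff_fg.mpr hF
  have hG : (F ⊓ LinearMap.range f).FG := by
    have h1 := IsNoetherian.noetherian (Submodule.comap F.subtype (LinearMap.range f))
    have h2 := h1.map F.subtype
    rwa [Submodule.map_comap_subtype] at h2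
  obtain ⟨s, hs⟩ := hG
  have hsr : (s : Set N) ⊆ f '' Set.univ := by
    intro y hy
    have : y ∈ F ⊓ LinearMap.range f := hs ▸ Submodule.subset_span hy
    obtain ⟨x, hx⟩ := this.2
    exact ⟨x, trivial, hx⟩
  classical
  obtain ⟨t, -, ht⟩ := Finset.subset_set_image_iff.mp hsr
  have hmap : (Submodule.span R (t : Set M)).map f = F ⊓ LinearMap.range f := by
    rw [Submodule.map_span, ← Finset.coe_image, ht, hs]
  refine ⟨F'.map (LinearMap.ker f).subtype ⊔ Submodule.span R (t : Set M),
    (hF'.map _).sup ⟨t, rfl⟩, (hS'.union hS).subset ?_⟩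
  intro q hq
  by_contra hcon
  rw [Set.mem_union, not_or, Module.notMem_support_iff', Module.notMem_support_iff'] at hcon
  obtain ⟨h1, h2⟩ := hcon
  refine absurd hq ?_
  rw [Module.notMem_support_iff']
  intro m
  obtain ⟨m, rfl⟩ := Submodule.mkQ_surjective _ m
  obtain ⟨r, hr, hrm⟩ := h2 (F.mkQ (f m))
  rw [← map_smul, Submodule.mkQ_apply, Submodule.Quotient.mk_eq_zero] at hrm
  have h3 : r • f m ∈ F ⊓ LinearMap.range f := ⟨hrm, r • m, by simp⟩
  rw [← hmap] at h3
  obtain ⟨h, hh, hfh⟩ := h3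
  have h4 : r • m - h ∈ LinearMap.ker f := by
    rw [LinearMap.mem_ker, map_sub, map_smul, hfh, sub_self]
  obtain ⟨r', hr', hrm'⟩ := h1 (F'.mkQ ⟨_, h4⟩)
  rw [← map_smul, Submodule.mkQ_apply, Submodule.Quotient.mk_eq_zero] at hrm'
  refine ⟨r' * r, fun h5 => (q.2.mem_or_mem h5).elim hr' hr, ?_⟩
  rw [← map_smul, Submodule.mkQ_apply, Submodule.Quotient.mk_eq_zero]
  have h6 : r' • (r • m - h) ∈ F'.map (LinearMap.ker f).subtype := ⟨_, hrm', rfl⟩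
  have h7 : (r' * r) • m = r' • (r • m - h) + r' • h := by
    rw [smul_sub, mul_smul]; abel
  rw [h7]
  exact Submodule.add_mem_sup h6 (Submodule.smul_mem _ _ hh)

theorem FSF.of_injective {R : Type} [CommRing R] [IsNoetherianRing R]
    {M N : Type} [AddCommGroup M] [Module R M] [AddCommGroup N] [Module R N]
    (f : M →ₗ[R] N) (hf : Function.Injective f) (hN : FSF R N) : FSF R M := by
  refine FSF.of_ker f ?_ hN
  rw [LinearMap.ker_eq_bot.mpr hf]
  apply FSF.of_support
  rw [Module.support_eq_empty]
  exact Set.finite_empty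

theorem FSF.of_torsion_aux {R : Type} [CommRing R] [IsNoetherianRing R]
    {M : Type} [AddCommGroup M] [Module R M] (L : Submodule R M) (hL : FSF R L)
    (s : Finset R) : ∀ (K : Submodule R M), (∀ x ∈ s, ∀ m ∈ K, x • m ∈ L) →
      FSF R (K ⊓ Submodule.torsionBySet R M (s : Set R) : Submodule R M) → FSF R K := by
  classical
  induction s using Finset.induction_on with
  | empty =>
    intro K _ h
    refine FSF.of_injective (Submodule.inclusion ?_) (Submodule.inclusion_injective _) h
    intro m hm
    refine ⟨hm, ?_⟩
    rw [SetLike.mem_coe, Submodule.mem_torsionBySet_iff]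
    rintro ⟨a, ha⟩
    simp at ha
  | insert a s _ ih =>
    intro K hK h
    refine ih K (fun x hx => hK x (Finset.mem_insert_of_mem hx)) ?_
    let K' : Submodule R M := K ⊓ Submodule.torsionBySet R M (s : Set R)
    let g : K' →ₗ[R] L := ((LinearMap.lsmul R M a).comp K'.subtype).codRestrict L
      (fun m => hK a (Finset.mem_insert_self _ _) m.1 m.2.1)
    refine FSF.of_ker g ?_ hL
    let j : LinearMap.ker g →ₗ[R]
        (K ⊓ Submodule.torsionBySet R M ((insert a s : Finset R) : Set R) : Submodule R M) :=
      (K'.subtype.comp (LinearMap.ker g).subtype).codRestrict _ (by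
        rintro ⟨⟨m, hm1, hm2⟩, hm3⟩
        refine ⟨hm1, ?_⟩
        rw [SetLike.mem_coe, Submodule.mem_torsionBySet_iff] at hm2 ⊢
        rintro ⟨b, hb⟩
        rw [Finset.mem_coe, Finset.mem_insert] at hb
        rcases hb with rfl | hb
        · exact congrArg Subtype.val hm3
        · exact hm2 ⟨b, hb⟩)
    refine FSF.of_injective j ?_ h
    intro x y hxy
    have := congrArg Subtype.val hxy
    exact Subtype.ext (Subtype.ext this)

theorem FSF.of_torsion {R : Type} [CommRing R] [IsNoetherianRing R]
    {M : Type} [AddCommGroup M] [Module R M] (J : Ideal R) (L K : Submodule R M) (hL : FSF R L)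
    (hK : ∀ x ∈ J, ∀ m ∈ K, x • m ∈ L)
    (h : FSF R (K ⊓ Submodule.torsionBySet R M (J : Set R) : Submodule R M)) : FSF R K := by
  obtain ⟨s, hs⟩ := IsNoetherian.noetherian J
  have hs' : Ideal.span (s : Set R) = J := hs
  refine FSF.of_torsion_aux L hL s K
    (fun x hx => hK x (hs' ▸ Ideal.subset_span hx)) ?_
  rwa [Submodule.torsionBySet_eq_torsionBySet_span, hs']

theorem FSF.torsion_pow {R : Type} [CommRing R] [IsNoetherianRing R]
    {M : Type} [AddCommGroup M] [Module R M] (I : Ideal R)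
    (h : FSF R (Submodule.torsionBySet R M (I : Set R))) (n : ℕ) :
    FSF R (Submodule.torsionBySet R M ((I ^ n : Ideal R) : Set R)) := by
  induction n with
  | zero =>
    refine FSF.of_injective (Submodule.inclusion ?_) (Submodule.inclusion_injective _) h
    exact Submodule.torsionBySet_le_torsionBySet_of_subset (by simp)
  | succ n ih =>
    refine FSF.of_torsion I _ _ ih ?_ ?_
    · intro x hx m hm
      rw [Submodule.mem_torsionBySet_iff] at hm ⊢
      rintro ⟨a, ha⟩
      have := hm ⟨a * x, by rw [pow_succ]; exact Ideal.mul_mem_mul ha hx⟩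
      simpa [mul_smul] using this
    · exact FSF.of_injective (Submodule.inclusion inf_le_right) (Submodule.inclusion_injective _) h

theorem three_le_dim {R : Type} [CommRing R] (a b c d : PrimeSpectrum R)
    (h1 : a < b) (h2 : b < c) (h3 : c < d) : ¬ ringKrullDim R ≤ 2 := by
  intro h
  let l : LTSeries (PrimeSpectrum R) := ((((RelSeries.singleton _ a).snoc b (by simpa using h1)).snoc c
    (by simpa using h2)).snoc d (by simpa using h3))
  have hl := (Order.LTSeries.length_le_krullDim l).trans h
  have : l.length = 3 := rfl
  rw [this] at hl
  exact absurd hl (by decide)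

theorem finite_V {R : Type} [CommRing R] [IsNoetherianRing R]
    (hsl : {m : Ideal R | m.IsMaximal}.Finite) (hd : ringKrullDim R ≤ 2)
    (I p : Ideal R) [p.IsPrime] (hI : ¬ I ≤ p) :
    (PrimeSpectrum.zeroLocus ((I ⊔ p : Ideal R) : Set R)).Finite := by
  have hfin : ((I ⊔ p).minimalPrimes ∪ {m : Ideal R | m.IsMaximal}).Finite :=
    ((I ⊔ p).finite_minimalPrimes_of_isNoetherianRing).union hsl
  refine Set.Finite.subset (hfin.preimage
    (f := PrimeSpectrum.asIdeal) (fun a _ b _ h => PrimeSpectrum.ext h)) ?_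
  intro q hq
  have hq' : I ⊔ p ≤ q.asIdeal := hq
  by_contra hcon
  rw [Set.mem_preimage, Set.mem_union, not_or] at hcon
  obtain ⟨h1, h2⟩ := hcon
  obtain ⟨q0, hq0, hq0q⟩ := Ideal.exists_minimalPrimes_le hq'
  obtain ⟨m, hm, hqm⟩ := Ideal.exists_le_maximal q.asIdeal q.2.ne_top
  have hlt : q0 < q.asIdeal := lt_of_le_of_ne hq0q (fun h => h1 (h ▸ hq0))
  have hlt2 : q.asIdeal < m := lt_of_le_of_ne hqm (fun h => h2 (by rw [h]; exact hm))
  have hlt0 : p < q0 := lt_of_le_of_ne (le_sup_right.trans hq0.1.2)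
    (fun h => hI (h ▸ le_sup_left.trans hq0.1.2))
  exact three_le_dim ⟨p, inferInstance⟩ ⟨q0, hq0.1.1⟩ q ⟨m, hm.isPrime⟩ hlt0 hlt hlt2 hd

theorem forward_FSF {R : Type} [CommRing R] [IsNoetherianRing R]
    (hsl : {m : Ideal R | m.IsMaximal}.Finite) (hd : ringKrullDim R ≤ 2)
    (I : Ideal R) (M : Type) [AddCommGroup M] [Module R M]
    (hM : ∀ m : M, ∃ n : ℕ, ∀ x ∈ I ^ n, x • m = 0)
    (h : FSF R (Submodule.torsionBySet R M (I : Set R))) : FSF R M := by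
  let S : Set (Ideal R) := {p | p ∈ minimalPrimes R ∧ ¬ I ≤ p}
  have hS : S.Finite := (minimalPrimes.finite_of_isNoetherianRing R).subset (fun p hp => hp.1)
  let K : Ideal R := sInf S
  have hIK : I * K ≤ nilradical R := by
    rw [nilradical, ← Ideal.sInf_minimalPrimes]
    refine le_sInf fun p hp => ?_
    by_cases hIp : I ≤ p
    · exact Ideal.mul_le_left.trans hIp
    · exact Ideal.mul_le_right.trans (sInf_le ⟨hp, hIp⟩)
  obtain ⟨n, hn⟩ := IsNoetherianRing.isNilpotent_nilradical R
  have hn' : I ^ n * K ^ n = ⊥ := by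
    rw [← mul_pow]
    exact le_bot_iff.mp ((Ideal.pow_right_mono hIK n).trans hn.le)
  have hfin : (⋃ p ∈ S, PrimeSpectrum.zeroLocus ((I ⊔ p : Ideal R) : Set R)).Finite := by
    refine hS.biUnion fun p hp => ?_
    have := hp.1.1.1
    exact finite_V hsl hd I p hp.2
  let L : Submodule R M := I ^ n • ⊤
  have hL : (Module.support R L).Finite := by
    refine hfin.subset ?_
    intro q hq
    rw [Module.mem_support_iff'] at hq
    obtain ⟨⟨m, hm⟩, hq⟩ := hq
    have hIq : I ≤ q.asIdeal := by
      obtain ⟨k, hk⟩ := hM m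
      refine (Ideal.IsPrime.pow_le_iff (n := k + 1) (by simp)).mp ?_
      intro x hx
      by_contra hxq
      exact hq x hxq (Subtype.ext (hk x (Ideal.pow_le_pow_right (Nat.le_succ k) hx)))
    have hKq : K ≤ q.asIdeal := by
      refine (Ideal.IsPrime.pow_le_iff (n := n + 1) (by simp)).mp ?_
      intro x hx
      by_contra hxq
      refine hq x hxq (Subtype.ext ?_)
      have hx' : x ∈ K ^ n := Ideal.pow_le_pow_right (Nat.le_succ n) hx
      change x • m = 0
      have h1 : x • m ∈ K ^ n • (I ^ n • (⊤ : Submodule R M)) := Submodule.smul_mem_smul hx' hm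
      rw [← Submodule.mul_smul, mul_comm, hn', Submodule.bot_smul] at h1
      simpa using h1
    have : ∃ p ∈ S, p ≤ q.asIdeal := by
      have h2 : hS.toFinset.inf id ≤ q.asIdeal := by
        refine le_trans (le_sInf fun p hp => ?_) hKq
        exact Finset.inf_le (f := id) (hS.mem_toFinset.mpr hp)
      obtain ⟨p, hp, hpq⟩ := (Ideal.IsPrime.inf_le' q.2).mp h2
      exact ⟨p, hS.mem_toFinset.mp hp, hpq⟩
    obtain ⟨p, hp, hpq⟩ := this
    exact Set.mem_biUnion hp (show (I ⊔ p : Ideal R) ≤ q.asIdeal from sup_le hIq hpq)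
  have htop : FSF R (⊤ : Submodule R M) := by
    refine FSF.of_torsion (I ^ n) L ⊤ (FSF.of_support hL)
      (fun x hx m hm => Submodule.smul_mem_smul hx hm) ?_
    rw [top_inf_eq]
    exact FSF.torsion_pow I h n
  exact FSF.of_injective Submodule.topEquiv.symm.toLinearMap Submodule.topEquiv.symm.injective htop

theorem infinite_V {R : Type} [CommRing R] [IsNoetherianRing R]
    (a b c : PrimeSpectrum R) (h1 : a < b) (h2 : b < c) :
    (PrimeSpectrum.zeroLocus (a.asIdeal : Set R)).Infinite := by
  intro hfin
  let T : Set (PrimeSpectrum R) :=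
    {q | q ∈ PrimeSpectrum.zeroLocus (a.asIdeal : Set R) ∧ ¬ c.asIdeal ≤ q.asIdeal}
  have hT : T.Finite := hfin.subset (fun q hq => hq.1)
  have havoid : ¬ ((c.asIdeal : Set R) ⊆ ⋃ q ∈ (hT.toFinset : Set (PrimeSpectrum R)), q.asIdeal) := by
    rw [Ideal.subset_union_prime a a (fun q _ _ _ => q.2)]
    rintro ⟨q, hq, hcq⟩
    exact (hT.mem_toFinset.mp hq).2 hcq
  obtain ⟨x, hxc, hx⟩ := Set.not_subset.mp havoid
  have hle : a.asIdeal ⊔ Ideal.span {x} ≤ c.asIdeal :=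
    sup_le (h1.trans h2).le ((Ideal.span_singleton_le_iff_mem _).mpr hxc)
  obtain ⟨q, hq, hqc⟩ := Ideal.exists_minimalPrimes_le hle
  have hcq : c.asIdeal ≤ q := by
    by_contra hcon
    apply hx
    refine Set.mem_biUnion (x := (⟨q, hq.1.1⟩ : PrimeSpectrum R)) ?_ ?_
    · exact hT.mem_toFinset.mpr ⟨(le_sup_left.trans hq.1.2 : a.asIdeal ≤ q), hcon⟩
    · exact (le_sup_right.trans hq.1.2 : Ideal.span {x} ≤ q) (Ideal.mem_span_singleton_self x)
  obtain rfl : q = c.asIdeal := le_antisymm hqc hcq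
  have hht := Ideal.map_height_le_one_of_mem_minimalPrimes hq
  let f := Ideal.Quotient.mk a.asIdeal
  have hf : Function.Surjective f := Ideal.Quotient.mk_surjective
  have hk : RingHom.ker f = a.asIdeal := Ideal.mk_ker
  have hb' : (b.asIdeal.map f).IsPrime :=
    Ideal.map_isPrime_of_surjective hf (by rw [hk]; exact h1.le)
  have hc' : (c.asIdeal.map f).IsPrime :=
    Ideal.map_isPrime_of_surjective hf (by rw [hk]; exact (h1.trans h2).le)
  have hcomap : ∀ q : PrimeSpectrum R, a ≤ q → (q.asIdeal.map f).comap f = q.asIdeal := by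
    intro q haq
    rw [Ideal.comap_map_of_surjective f hf, ← RingHom.ker_eq_comap_bot, hk, sup_eq_left]
    exact haq
  have hbc : b.asIdeal.map f < c.asIdeal.map f := by
    refine lt_of_le_of_ne (Ideal.map_mono h2.le) fun h => h2.ne (PrimeSpectrum.ext ?_)
    rw [← hcomap b h1.le, ← hcomap c (h1.trans h2).le, h]
  have hab : (⊥ : Ideal (R ⧸ a.asIdeal)) < b.asIdeal.map f := by
    refine bot_lt_iff_ne_bot.mpr fun h => h1.ne (PrimeSpectrum.ext ?_)
    rw [← hcomap b h1.le, h, ← RingHom.ker_eq_comap_bot, hk]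
  have e1 := Ideal.height_add_one_le_of_lt_of_isPrime hab
  have e2 := Ideal.height_add_one_le_of_lt_of_isPrime hbc
  have : (2 : ℕ∞) ≤ 1 := calc
    (2 : ℕ∞) = 0 + 1 + 1 := by norm_num
    _ ≤ (⊥ : Ideal (R ⧸ a.asIdeal)).height + 1 + 1 := by gcongr; exact zero_le
    _ ≤ (b.asIdeal.map f).height + 1 := by gcongr
    _ ≤ _ := e2
    _ ≤ 1 := hht
  exact absurd this (by decide)

theorem counterexample {R : Type} [CommRing R] [IsNoetherianRing R]
    (p0 p1 : PrimeSpectrum R) (h1 : p0 < p1)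
    (hinf : (PrimeSpectrum.zeroLocus (p1.asIdeal : Set R)).Infinite) :
    ∃ (I : Ideal R) (M : Type) (_ : AddCommGroup M) (_ : Module R M),
      (∀ m : M, ∃ n : ℕ, ∀ x ∈ I ^ n, x • m = 0) ∧
      FSF R (Submodule.torsionBySet R M (I : Set R)) ∧ ¬ FSF R M := by
  obtain ⟨x, hx1, hx0⟩ := Set.exists_of_ssubset (show (p0.asIdeal : Set R) ⊂ p1.asIdeal from h1)
  let K := FractionRing (R ⧸ p0.asIdeal)
  let φ : R →+* K := algebraMap R K
  have hφ : ∀ r, φ r = 0 ↔ r ∈ p0.asIdeal := by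
    intro r
    change algebraMap R K r = 0 ↔ _
    rw [IsScalarTower.algebraMap_apply R (R ⧸ p0.asIdeal) K,
      FaithfulSMul.algebraMap_eq_zero_iff, Ideal.Quotient.algebraMap_eq,
      Ideal.Quotient.eq_zero_iff_mem]
  have hsm : ∀ (r : R) (k : K), r • k = φ r * k := fun r k => Algebra.smul_def r k
  have hxne : φ x ≠ 0 := fun h => hx0 ((hφ x).mp h)
  let D : Submodule R K := LinearMap.range (Algebra.linearMap R K)
  let M : Submodule R (K ⧸ D) := Submodule.torsion' R (K ⧸ D) (Submonoid.powers x)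
  have hMtor : ∀ m : M, ∃ n : ℕ, x ^ n • m = 0 := by
    rintro ⟨m, ⟨⟨_, n, rfl⟩, hn⟩⟩
    exact ⟨n, Subtype.ext hn⟩
  have hu : ∀ n : ℕ, D.mkQ ((φ x ^ (n + 1))⁻¹) ∈ M := by
    intro n
    refine ⟨⟨x ^ (n + 1), n + 1, rfl⟩, ?_⟩
    change x ^ (n + 1) • D.mkQ _ = 0
    rw [← map_smul, Submodule.mkQ_apply, Submodule.Quotient.mk_eq_zero, hsm, map_pow,
      mul_inv_cancel₀ (pow_ne_zero _ hxne)]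
    exact ⟨1, by simp⟩
  refine ⟨Ideal.span {x}, M, inferInstance, inferInstance, ?_, ?_, ?_⟩
  · intro m
    obtain ⟨n, hn⟩ := hMtor m
    refine ⟨n, fun y hy => ?_⟩
    rw [Ideal.span_singleton_pow, Ideal.mem_span_singleton'] at hy
    obtain ⟨c, rfl⟩ := hy
    rw [mul_smul, hn, smul_zero]
  · let T := Submodule.torsionBySet R M ((Ideal.span {x} : Ideal R) : Set R)
    have key : ∀ t : T, ((t : M) : K ⧸ D) ∈ Submodule.span R {D.mkQ ((φ x)⁻¹)} := by
      rintro ⟨⟨m, hm⟩, ht⟩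
      rw [Submodule.mem_torsionBySet_iff] at ht
      have h2 : x • m = 0 :=
        congrArg Subtype.val (ht ⟨x, Ideal.mem_span_singleton_self x⟩)
      obtain ⟨k, rfl⟩ := Submodule.mkQ_surjective _ m
      rw [← map_smul, Submodule.mkQ_apply, Submodule.Quotient.mk_eq_zero, hsm] at h2
      obtain ⟨r, hr⟩ := h2
      have hr' : φ r = φ x * k := hr
      refine Submodule.mem_span_singleton.mpr ⟨r, ?_⟩
      rw [← map_smul, hsm, hr']
      rw [mul_comm (φ x) k, mul_assoc, mul_inv_cancel₀ hxne, mul_one]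
    let j : T →ₗ[R] Submodule.span R {D.mkQ ((φ x)⁻¹)} :=
      (M.subtype.comp T.subtype).codRestrict _ key
    have hj : Function.Injective j := by
      intro a b hab
      have hab' := congrArg Subtype.val hab
      exact Subtype.ext (Subtype.ext hab')
    have hfinT : Module.Finite R T := Module.Finite.of_injective j hj
    refine ⟨⊤, Module.finite_def.mp hfinT, ?_⟩
    rw [Module.support_eq_empty]
    exact Set.finite_empty
  · rintro ⟨F, hF, hS⟩
    -- a power of `x` kills `F`
    have hkill : ∃ n : ℕ, ∀ m ∈ F, x ^ n • m = 0 := by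
      obtain ⟨s, rfl⟩ := hF
      choose e he using hMtor
      refine ⟨s.sup e, fun m hm => ?_⟩
      induction hm using Submodule.span_induction with
      | mem y hy =>
        obtain ⟨d, hd⟩ := Nat.exists_eq_add_of_le (Finset.le_sup (f := e) hy)
        rw [hd, add_comm, pow_add, mul_smul, he, smul_zero]
      | zero => simp
      | add y z _ _ hy hz => rw [smul_add, hy, hz, add_zero]
      | smul c y _ hy => rw [smul_comm, hy, smul_zero]
    obtain ⟨n, hn⟩ := hkill
    refine hinf (hS.subset fun q hq => ?_)
    have hq' : p1.asIdeal ≤ q.asIdeal := hq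
    rw [Module.mem_support_iff']
    refine ⟨F.mkQ ⟨_, hu n⟩, fun r hr h0 => hr ?_⟩
    rw [← map_smul, Submodule.mkQ_apply, Submodule.Quotient.mk_eq_zero] at h0
    have h2 : x ^ n • r • D.mkQ ((φ x ^ (n + 1))⁻¹) = 0 := congrArg Subtype.val (hn _ h0)
    rw [← map_smul, ← map_smul, Submodule.mkQ_apply, Submodule.Quotient.mk_eq_zero, hsm, hsm] at h2
    obtain ⟨c, hc⟩ := h2
    have hc' : φ c = φ (x ^ n) * (φ r * (φ x ^ (n + 1))⁻¹) := hc
    have h3 : φ (x * c - r) = 0 := by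
      rw [map_sub, map_mul, hc', map_pow]
      have h6 := mul_inv_cancel₀ (pow_ne_zero (n + 1) hxne)
      linear_combination (φ r) * h6
    have h4 := hq' (h1.le ((hφ _).mp h3))
    have h5 : x * c ∈ q.asIdeal := Ideal.mul_mem_right _ _ (hq' hx1)
    have := q.asIdeal.sub_mem h5 h4
    simpa using this

end Helpers

/-- Over a semi-local noetherian ring, `FG * FS` (the FSF modules) is a Melkersson
subcategory iff `dim R ≤ 2`. -/
theorem stmt_12 {R : Type} [CommRing R] [IsNoetherianRing R]
    (hsl : {m : Ideal R | m.IsMaximal}.Finite) :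
    (∀ I : Ideal R,
        MelkerssonCondition R
          (IsExtensionIn R (FGClass R)
            (fun M : ModuleCat.{0} R => (Module.support R M).Finite)) I) ↔
      ringKrullDim R ≤ 2 := by
  constructor
  · intro h
    by_contra hd
    have h3 : ((3 : ℕ) : WithBot ℕ∞) ≤ Order.krullDim (PrimeSpectrum R) := by
      have h2 := not_le.mp hd
      rw [ringKrullDim] at h2
      generalize Order.krullDim (PrimeSpectrum R) = d at h2
      induction d with
      | bot => simp at h2
      | coe d =>
        have h4 : (2 : ℕ∞) < d := WithBot.coe_lt_coe.mp h2
        have h5 := Order.add_one_le_of_lt h4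
        exact WithBot.coe_le_coe.mpr (le_trans (by norm_num) h5)
    obtain ⟨l, hl⟩ := Order.le_krullDim_iff.mp h3
    have hlt : ∀ i j : ℕ, (hi : i < l.length + 1) → (hj : j < l.length + 1) → i < j →
        l ⟨i, hi⟩ < l ⟨j, hj⟩ := fun i j hi hj hij => l.strictMono hij
    obtain ⟨I, M, _, _, hM, hT, hN⟩ := counterexample _ _
      (hlt 0 1 (by omega) (by omega) (by omega))
      (infinite_V _ _ _ (hlt 1 2 (by omega) (by omega) (by omega))
        (hlt 2 3 (by omega) (by omega) (by omega)))
    refine hN ((isExt_iff_FSF (ModuleCat.of R M)).mp (h I (ModuleCat.of R M) hM ?_))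
    exact (isExt_iff_FSF _).mpr hT
  · intro hd I M hM hT
    rw [isExt_iff_FSF] at hT ⊢
    exact forward_FSF hsl hd I M hM hT
end

section
/- Let R be a 1-dimensional noetherian local ring and S a nonzero Serre subcategory of the category of R-modules. (1) If R has a unique minimal prime ideal p and S does not contain all Artinian R-modules, then MP[S] = {p}; in particular MP[FG] = {p}. (2) If R has at least two minimal prime ideals and every module in S is finitely generated, then MP[S] = ∅; in particular MP[FG] = ∅. -/
/-!
Common framework: a *Serre class* is a class of (bundled) `R`-modules closed under
submodules, quotient modules and extensions.  `MelkerssonCondition R P I` is the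
Melkersson condition `(C_I)`: if `Γ_I(M) = M` (every element of `M` is annihilated by
some power of `I`) and `(0 :_M I)` (the `I`-torsion-by-`I` submodule `torsionBySet`)
belongs to the class, then `M` belongs to the class.  `MP R P` is the set of prime
ideals `p` such that the class satisfies `(C_p)`.
-/

open CategoryTheory

variable (R : Type) [CommRing R]

namespace SerreClass

theorem mem_of_ker {R : Type} [CommRing R] (S : SerreClass R) {M N : Type}
    [AddCommGroup M] [Module R M] [AddCommGroup N] [Module R N] (φ : M →ₗ[R] N)
    (hk : S.mem (ModuleCat.of R (LinearMap.ker φ))) (hN : S.mem (ModuleCat.of R N)) :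
    S.mem (ModuleCat.of R M) := by
  have hr : S.mem (ModuleCat.of R (LinearMap.range φ)) :=
    S.mem_of_injective (M := ModuleCat.of R (LinearMap.range φ)) (N := ModuleCat.of R N)
      (LinearMap.range φ).subtype (Submodule.subtype_injective _) hN
  refine S.mem_of_extension (A := ModuleCat.of R (LinearMap.ker φ)) (M := ModuleCat.of R M)
    (B := ModuleCat.of R (LinearMap.range φ)) (LinearMap.ker φ).subtype φ.rangeRestrict
    (Submodule.subtype_injective _) φ.surjective_rangeRestrict ?_ hk hr
  simp

theorem mem_of_le {R : Type} [CommRing R] (S : SerreClass R) {M : Type}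
    [AddCommGroup M] [Module R M] {A B : Submodule R M} (h : A ≤ B)
    (hB : S.mem (ModuleCat.of R B)) : S.mem (ModuleCat.of R A) :=
  S.mem_of_injective (M := ModuleCat.of R A) (N := ModuleCat.of R B)
    (Submodule.inclusion h) (Submodule.inclusion_injective h) hB

theorem mem_of_subsingleton {R : Type} [CommRing R] (S : SerreClass R) {A : ModuleCat.{0} R}
    (hA : S.mem A) (M : Type) [AddCommGroup M] [Module R M] [Subsingleton M] :
    S.mem (ModuleCat.of R M) :=
  S.mem_of_injective (M := ModuleCat.of R M) (N := A) (0 : M →ₗ[R] A)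
    (Function.injective_of_subsingleton _) hA

theorem mem_pi {R : Type} [CommRing R] (S : SerreClass R) {A : Type} [AddCommGroup A]
    [Module R A] (hA : S.mem (ModuleCat.of R A)) (n : ℕ) :
    S.mem (ModuleCat.of R (Fin n → A)) := by
  induction n with
  | zero => exact S.mem_of_subsingleton hA _
  | succ n ih =>
    refine S.mem_of_ker (LinearMap.funLeft R A (Fin.succ : Fin n → Fin (n+1))) ?_ ih
    refine S.mem_of_injective (M := ModuleCat.of R _) (N := ModuleCat.of R A)
      ((LinearMap.proj (R := R) (φ := fun _ : Fin (n+1) => A) 0).comp (Submodule.subtype _)) ?_ hA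
    intro x y hxy
    apply Subtype.ext
    funext i
    have hx := x.2
    have hy := y.2
    rw [LinearMap.mem_ker] at hx hy
    refine Fin.cases ?_ (fun j => ?_) i
    · exact hxy
    · have h1 := congrFun hx j
      have h2 := congrFun hy j
      simp only [LinearMap.funLeft_apply] at h1 h2
      rw [h1, h2]

theorem mem_residue {R : Type} [CommRing R] [IsLocalRing R] (S : SerreClass R)
    (hS : ∃ M : ModuleCat.{0} R, S.mem M ∧ Nontrivial M) :
    S.mem (ModuleCat.of R (R ⧸ IsLocalRing.maximalIdeal R)) := by
  obtain ⟨M, hM, hnt⟩ := hS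
  obtain ⟨x, hx⟩ := exists_ne (0 : M)
  have h1 : S.mem (ModuleCat.of R (LinearMap.range (LinearMap.toSpanSingleton R M x))) :=
    S.mem_of_injective (M := ModuleCat.of R _) (N := M) (Submodule.subtype _)
      (Submodule.subtype_injective _) hM
  have h2 : S.mem (ModuleCat.of R (R ⧸ LinearMap.ker (LinearMap.toSpanSingleton R M x))) :=
    S.mem_of_injective (M := ModuleCat.of R _) (N := ModuleCat.of R _)
      (LinearMap.toSpanSingleton R M x).quotKerEquivRange.toLinearMap
      (LinearMap.toSpanSingleton R M x).quotKerEquivRange.injective h1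
  have hle : LinearMap.ker (LinearMap.toSpanSingleton R M x) ≤ IsLocalRing.maximalIdeal R := by
    apply IsLocalRing.le_maximalIdeal
    intro h
    apply hx
    have : (1 : R) ∈ LinearMap.ker (LinearMap.toSpanSingleton R M x) := by rw [h]; trivial
    simpa using this
  exact S.mem_of_surjective (M := ModuleCat.of R _) (N := ModuleCat.of R _)
    (Submodule.factor hle) (Submodule.factor_surjective hle) h2

theorem mem_of_isFiniteLength {R : Type} [CommRing R] [IsLocalRing R] (S : SerreClass R)
    (hS : ∃ M : ModuleCat.{0} R, S.mem M ∧ Nontrivial M) (M : Type) [AddCommGroup M] [Module R M]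
    (h : IsFiniteLength R M) : S.mem (ModuleCat.of R M) := by
  have hk := S.mem_residue hS
  induction h with
  | of_subsingleton => exact S.mem_of_subsingleton hk _
  | @of_simple_quotient M _ _ N hs _ ih =>
    refine S.mem_of_ker N.mkQ ?_ ?_
    · exact S.mem_of_le (le_of_eq (Submodule.ker_mkQ N)) ih
    · obtain ⟨I, hI, ⟨e⟩⟩ := isSimpleModule_iff_quot_maximal.mp hs
      obtain rfl := IsLocalRing.eq_maximalIdeal hI
      exact S.mem_of_injective (M := ModuleCat.of R _) (N := ModuleCat.of R _)
        e.toLinearMap e.injective hk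

/-- A Serre class satisfies `(C_p)` for nilpotent f.g. ideals. -/
theorem melkersson_of_nilpotent {R : Type} [CommRing R] [IsNoetherianRing R] (S : SerreClass R)
    (p : Ideal R) (hp : ∃ n, p ^ n = ⊥) : MelkerssonCondition R S.mem p := by
  intro M _ h0
  obtain ⟨n, hn⟩ := hp
  have key : ∀ k : ℕ, S.mem (ModuleCat.of R
      (Submodule.torsionBySet R M ((p ^ k : Ideal R) : Set R))) := by
    intro k
    induction k with
    | zero =>
      refine S.mem_of_le ?_ h0
      intro x hx
      rw [Submodule.mem_torsionBySet_iff] at hx ⊢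
      intro a
      exact hx ⟨a.1, by simp⟩
    | succ k ih =>
      obtain ⟨r, a, ha⟩ := Submodule.fg_iff_exists_fin_generating_family.mp
        (IsNoetherian.noetherian p)
      have hap : ∀ i, a i ∈ p := fun i => by
        rw [← ha]; exact Submodule.subset_span ⟨i, rfl⟩
      let T := Submodule.torsionBySet R M ((p ^ (k+1) : Ideal R) : Set R)
      let T' := Submodule.torsionBySet R M ((p ^ k : Ideal R) : Set R)
      have hmem : ∀ i (x : T), a i • (x : M) ∈ T' := by
        intro i x
        rw [Submodule.mem_torsionBySet_iff]
        intro b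
        have := (Submodule.mem_torsionBySet_iff _ _).mp x.2
          ⟨b.1 * a i, by rw [pow_succ]; exact Ideal.mul_mem_mul b.2 (hap i)⟩
        rw [← this]
        exact smul_smul b.1 (a i) (x : M)
      let φ : T →ₗ[R] (Fin r → T') := LinearMap.pi fun i =>
        LinearMap.codRestrict T' ((LinearMap.lsmul R M (a i)).comp T.subtype) (hmem i)
      refine S.mem_of_ker φ ?_ (S.mem_pi ih r)
      refine S.mem_of_injective (M := ModuleCat.of R (LinearMap.ker φ)) (N := ModuleCat.of R _)
        (LinearMap.codRestrict _ (T.subtype.comp (LinearMap.ker φ).subtype) ?_) ?_ h0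
      · intro x
        rw [Submodule.mem_torsionBySet_iff]
        rintro ⟨b, hb⟩
        have hle : p ≤ LinearMap.ker (LinearMap.toSpanSingleton R M (x.1 : M)) := by
          rw [← ha, Submodule.span_le]
          rintro _ ⟨i, rfl⟩
          have h1 := congrFun (LinearMap.mem_ker.mp x.2) i
          exact congrArg Subtype.val h1
        exact hle hb
      · intro x y hxy
        have h0 := congrArg Subtype.val hxy
        have h1 : (x.1.1 : M) = y.1.1 := h0
        exact Subtype.ext (Subtype.ext h1)
  refine S.mem_of_injective (M := M) (N := ModuleCat.of R _)
    (LinearMap.codRestrict (Submodule.torsionBySet R M ((p ^ n : Ideal R) : Set R))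
      LinearMap.id ?_) ?_ (key n)
  · intro x
    rw [Submodule.mem_torsionBySet_iff]
    rintro ⟨b, hb⟩
    rw [hn] at hb
    have : b = 0 := hb
    subst this
    exact zero_smul R x
  · intro x y hxy
    exact congrArg Subtype.val hxy

/-- If a nonzero Serre class satisfies `(C_m)`, it contains all Artinian modules. -/
theorem artinian_of_melkersson {R : Type} [CommRing R] [IsLocalRing R]
    (S : SerreClass R)
    (hS : ∃ M : ModuleCat.{0} R, S.mem M ∧ Nontrivial M)
    (hC : MelkerssonCondition R S.mem (IsLocalRing.maximalIdeal R))
    (hfg : (IsLocalRing.maximalIdeal R).FG)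
    (M : ModuleCat.{0} R) (hM : IsArtinian R M) : S.mem M := by
  apply hC M
  · intro x
    obtain ⟨n, hn⟩ := IsArtinian.monotone_stabilizes (R := R) (M := M)
      ⟨fun n => OrderDual.toDual ((IsLocalRing.maximalIdeal R ^ n) • Submodule.span R {x}),
        fun i j hij => Submodule.smul_mono_left (Ideal.pow_le_pow_right hij)⟩
    have h1 : (IsLocalRing.maximalIdeal R ^ n) • Submodule.span R {x} =
      (IsLocalRing.maximalIdeal R ^ (n+1)) • Submodule.span R {x} := hn (n+1) (Nat.le_succ n)
    have h2 : (IsLocalRing.maximalIdeal R ^ n) • Submodule.span R {x} = ⊥ := by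
      refine Submodule.eq_bot_of_le_smul_of_le_jacobson_bot (IsLocalRing.maximalIdeal R) _ ?_ ?_ ?_
      · exact Submodule.FG.smul (hfg.pow) (Submodule.fg_span_singleton x)
      · rw [← Submodule.mul_smul, ← pow_succ', ← h1]
      · exact IsLocalRing.maximalIdeal_le_jacobson _
    refine ⟨n, fun a ha => ?_⟩
    have : a • x ∈ (IsLocalRing.maximalIdeal R ^ n) • Submodule.span R {x} :=
      Submodule.smul_mem_smul ha (Submodule.mem_span_singleton_self x)
    rw [h2] at this
    exact this
  · apply S.mem_of_isFiniteLength hS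
    have hss : IsSemisimpleModule R
        (Submodule.torsionBySet R M (IsLocalRing.maximalIdeal R : Set R)) := by
      have ht := Submodule.torsionBySet_isTorsionBySet (R := R) (M := M)
        (IsLocalRing.maximalIdeal R : Set R)
      rw [← ht.isSemisimpleModule_iff]
      let _ := ht.module
      let _ := Ideal.Quotient.field (IsLocalRing.maximalIdeal R)
      infer_instance
    have : IsArtinian R (Submodule.torsionBySet R M (IsLocalRing.maximalIdeal R : Set R)) :=
      inferInstance
    exact (IsSemisimpleModule.finite_tfae.out 2 3).mp this

end SerreClass

theorem prime_quot_finite {R : Type} [CommRing R] [IsNoetherianRing R] [IsLocalRing R]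
    (hdim : ringKrullDim R = 1) (q : Ideal R) [hq : q.IsPrime] (b : R) (hb : b ∉ q) :
    (∃ n, IsLocalRing.maximalIdeal R ^ n ≤ q ⊔ Ideal.span {b}) ∧
    IsFiniteLength R (R ⧸ (q ⊔ Ideal.span {b})) := by
  have hd1 : Ring.KrullDimLE 1 R := Ring.krullDimLE_iff.mpr (by rw [hdim]; simp)
  have hmax : ∀ P : Ideal R, P.IsPrime → q ⊔ Ideal.span {b} ≤ P → P.IsMaximal := by
    intro P hP hle
    refine (Ring.krullDimLE_one_iff.mp hd1 P hP).resolve_left fun hmin => ?_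
    have hqP : q ≤ P := le_sup_left.trans hle
    have hPq : P ≤ q := hmin.2 ⟨hq, bot_le⟩ hqP
    exact hb (hPq (hle (Ideal.mem_sup_right (Ideal.mem_span_singleton_self b))))
  constructor
  · apply Ideal.exists_pow_le_of_le_radical_of_fg
    · rw [Ideal.radical_eq_sInf]
      refine le_sInf ?_
      rintro P ⟨hle, hP⟩
      exact (IsLocalRing.eq_maximalIdeal (hmax P hP hle)).ge
    · exact IsNoetherian.noetherian _
  · have h0 : Ring.KrullDimLE 0 (R ⧸ (q ⊔ Ideal.span {b})) := by
      rw [Ring.krullDimLE_zero_iff]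
      intro P hP
      have hsurj : Function.Surjective (Ideal.Quotient.mk (q ⊔ Ideal.span {b})) :=
        Ideal.Quotient.mk_surjective
      have := hmax (P.comap (Ideal.Quotient.mk (q ⊔ Ideal.span {b}))) inferInstance (by
        intro x hx
        rw [Ideal.mem_comap, Ideal.Quotient.eq_zero_iff_mem.mpr hx]
        exact P.zero_mem)
      rcases Ideal.map_eq_top_or_isMaximal_of_surjective _ hsurj this with h | h
      · rw [Ideal.map_comap_of_surjective _ hsurj] at h
        exact absurd h hP.ne_top
      · rwa [Ideal.map_comap_of_surjective _ hsurj] at h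
    have hA : IsArtinianRing (R ⧸ (q ⊔ Ideal.span {b})) :=
      isArtinianRing_iff_isNoetherianRing_krullDimLE_zero.mpr ⟨inferInstance, h0⟩
    rw [isFiniteLength_iff_isNoetherian_isArtinian]
    refine ⟨inferInstance, ?_⟩
    exact isArtinian_of_surjective_algebraMap (R := R ⧸ (q ⊔ Ideal.span {b}))
      Ideal.Quotient.mk_surjective

theorem not_maximal_of_minimal {R : Type} [CommRing R] [IsLocalRing R]
    (hdim : ringKrullDim R = 1) (q : Ideal R) (hq : q ∈ minimalPrimes R) : ¬ q.IsMaximal := by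
  intro hm
  have h0 : Ring.KrullDimLE 0 R := by
    rw [Ring.krullDimLE_zero_iff]
    intro P hP
    have h1 : P ≤ q := by
      rw [IsLocalRing.eq_maximalIdeal hm]
      exact IsLocalRing.le_maximalIdeal hP.ne_top
    have h2 : q ≤ P := hq.2 ⟨hP, bot_le⟩ h1
    rwa [le_antisymm h1 h2]
  rw [Ring.krullDimLE_iff, hdim] at h0
  exact absurd h0 (by norm_num)

/-- Key lemma: `(C_p)` fails for Serre classes of finitely generated modules if some minimal
prime does not contain `p`. -/
theorem not_melkersson {R : Type} [CommRing R] [IsNoetherianRing R] [IsLocalRing R]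
    (hdim : ringKrullDim R = 1) (S : SerreClass R)
    (hS : ∃ M : ModuleCat.{0} R, S.mem M ∧ Nontrivial M)
    (hfin : ∀ M : ModuleCat.{0} R, S.mem M → Module.Finite R M)
    (p q : Ideal R) (hp : p ≤ IsLocalRing.maximalIdeal R) (hq : q ∈ minimalPrimes R)
    (hpq : ¬ p ≤ q) : ¬ MelkerssonCondition R S.mem p := by
  intro hC
  have hqp : q.IsPrime := hq.1.1
  obtain ⟨x, hxp, hxq⟩ := Set.not_subset.mp hpq
  let D := R ⧸ q
  let K := FractionRing D
  let N : Submodule R K := LinearMap.range (IsScalarTower.toAlgHom R D K).toLinearMap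
  have hN : ∀ r : R, algebraMap R K r ∈ N := fun r =>
    ⟨Ideal.Quotient.mk q r, (IsScalarTower.algebraMap_apply R D K r).symm⟩
  have hN' : ∀ y ∈ N, ∃ r : R, algebraMap R K r = y := by
    rintro _ ⟨d, rfl⟩
    obtain ⟨r, rfl⟩ := Ideal.Quotient.mk_surjective d
    exact ⟨r, IsScalarTower.algebraMap_apply R D K r⟩
  have hzero : ∀ r : R, algebraMap R K r = 0 ↔ r ∈ q := by
    intro r
    rw [IsScalarTower.algebraMap_apply R D K r, FaithfulSMul.algebraMap_eq_zero_iff]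
    exact Ideal.Quotient.eq_zero_iff_mem
  -- elements of q + (b) multiply a / b into N
  have hJ : ∀ a b r : R, b ∉ q → r ∈ q ⊔ Ideal.span {b} →
      r • (algebraMap R K a / algebraMap R K b) ∈ N := by
    intro a b r hb hr
    obtain ⟨s, hs, t, ht, rfl⟩ := Submodule.mem_sup.mp hr
    obtain ⟨c, rfl⟩ := Ideal.mem_span_singleton'.mp ht
    have hb' : algebraMap R K b ≠ 0 := fun h => hb ((hzero b).mp h)
    have : (s + c * b) • (algebraMap R K a / algebraMap R K b) = algebraMap R K (c * a) := by
      rw [Algebra.smul_def, map_add, map_mul, map_mul, (hzero s).mpr hs]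
      rw [zero_add, mul_assoc, mul_comm (algebraMap R K b), div_mul_cancel₀ _ hb']
    rw [this]
    exact hN _
  have hrep : ∀ y : K, ∃ a b : R, b ∉ q ∧ y = algebraMap R K a / algebraMap R K b := by
    intro y
    obtain ⟨a, b, hb, rfl⟩ := IsFractionRing.div_surjective (A := D) y
    obtain ⟨a, rfl⟩ := Ideal.Quotient.mk_surjective a
    obtain ⟨b, rfl⟩ := Ideal.Quotient.mk_surjective b
    refine ⟨a, b, ?_, ?_⟩
    · intro h
      exact nonZeroDivisors.ne_zero hb (Ideal.Quotient.eq_zero_iff_mem.mpr h)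
    · rw [IsScalarTower.algebraMap_apply R D K a, IsScalarTower.algebraMap_apply R D K b]
      rfl
  have hmem : S.mem (ModuleCat.of R (K ⧸ N)) := by
    apply hC
    · intro m
      obtain ⟨y, rfl⟩ := N.mkQ_surjective m
      obtain ⟨a, b, hb, rfl⟩ := hrep y
      obtain ⟨⟨n, hn⟩, -⟩ := prime_quot_finite hdim q b hb
      refine ⟨n, fun r hr => ?_⟩
      have h1 := hJ a b r hb (hn (Ideal.pow_right_mono hp n hr))
      exact (Submodule.Quotient.mk_eq_zero N).mpr h1
    · have hfl := (prime_quot_finite hdim q x hxq).2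
      let g : R →ₗ[R] (K ⧸ N) :=
        N.mkQ.comp (LinearMap.toSpanSingleton R K (algebraMap R K 1 / algebraMap R K x))
      have hg : (q ⊔ Ideal.span {x}) ≤ LinearMap.ker g := by
        intro r hr
        exact (Submodule.Quotient.mk_eq_zero N).mpr (hJ 1 x r hxq hr)
      let f : (R ⧸ (q ⊔ Ideal.span {x})) →ₗ[R] (K ⧸ N) := Submodule.liftQ _ g hg
      have hr : S.mem (ModuleCat.of R (LinearMap.range f)) :=
        S.mem_of_surjective (M := ModuleCat.of R _) (N := ModuleCat.of R _)
          f.rangeRestrict f.surjective_rangeRestrict (S.mem_of_isFiniteLength hS _ hfl)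
      refine S.mem_of_le ?_ hr
      intro m hm
      obtain ⟨y, rfl⟩ := N.mkQ_surjective m
      have h1 : x • N.mkQ y = 0 := (Submodule.mem_torsionBySet_iff _ _).mp hm ⟨x, hxp⟩
      have h2 : x • y ∈ N := (Submodule.Quotient.mk_eq_zero N).mp h1
      obtain ⟨r, hr⟩ := hN' _ h2
      have hx' : algebraMap R K x ≠ 0 := fun h => hxq ((hzero x).mp h)
      refine ⟨Submodule.Quotient.mk r, ?_⟩
      change N.mkQ (r • (algebraMap R K 1 / algebraMap R K x)) = N.mkQ y
      congr 1
      rw [Algebra.smul_def, hr, Algebra.smul_def, map_one, mul_one_div, mul_div_cancel_left₀ _ hx']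
  have h3 : Module.Finite R (K ⧸ N) := hfin _ hmem
  have h4 : Module.Finite R N := inferInstance
  have h5 : Module.Finite R K := Module.Finite.of_submodule_quotient N
  have h6 : Module.Finite D K := Module.Finite.of_restrictScalars_finite R D K
  have h7 : IsField D := isField_of_isIntegral_of_isField
    (IsFractionRing.injective D K) (Field.toIsField K)
  exact not_maximal_of_minimal hdim q hq (Ideal.Quotient.maximal_of_isField q h7)

/-- Finitely generated modules as a Serre class. -/
def fgSerre (R : Type) [CommRing R] [IsNoetherianRing R] : SerreClass R where
  mem := FGClass R
  mem_of_injective := fun {M N} f hf h => by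
    have : Module.Finite R N := h
    exact Module.Finite.of_injective f hf
  mem_of_surjective := fun {M N} f hf h => by
    have : Module.Finite R M := h
    exact Module.Finite.of_surjective f hf
  mem_of_extension := fun {A M B} f g hf hg hfg hA hB => by
    have h1 : IsNoetherian R A := @isNoetherian_of_isNoetherianRing_of_finite R A _ _ _ _ hA
    have h2 : IsNoetherian R B := @isNoetherian_of_isNoetherianRing_of_finite R B _ _ _ _ hB
    have h3 : IsNoetherian R M := isNoetherian_of_range_eq_ker f g hfg
    exact (inferInstance : Module.Finite R M)

theorem fgSerre_nonzero (R : Type) [CommRing R] [IsNoetherianRing R] [Nontrivial R] :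
    ∃ M : ModuleCat.{0} R, (fgSerre R).mem M ∧ Nontrivial M :=
  ⟨ModuleCat.of R R, (inferInstance : Module.Finite R R), (inferInstance : Nontrivial R)⟩


/-- Over a one-dimensional noetherian local ring:
(1) with a unique minimal prime `p`, any nonzero Serre class not containing all
Artinian modules has `MP[S] = {p}`, in particular `MP[FG] = {p}`;
(2) with at least two minimal primes, any nonzero Serre class of finitely generated
modules has `MP[S] = ∅`, in particular `MP[FG] = ∅`. -/
theorem stmt_15 {R : Type} [CommRing R] [IsNoetherianRing R] [IsLocalRing R]
    (hdim : ringKrullDim R = 1) :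
    (∀ p : PrimeSpectrum R, minimalPrimes R = {p.asIdeal} →
      (∀ S : SerreClass R, (∃ M : ModuleCat.{0} R, S.mem M ∧ Nontrivial M) →
        ¬ (∀ M : ModuleCat.{0} R, IsArtinian R M → S.mem M) →
        MP R S.mem = {p}) ∧
      MP R (FGClass R) = {p}) ∧
    ((∃ p ∈ minimalPrimes R, ∃ q ∈ minimalPrimes R, p ≠ q) →
      (∀ S : SerreClass R, (∃ M : ModuleCat.{0} R, S.mem M ∧ Nontrivial M) →
        (∀ M : ModuleCat.{0} R, S.mem M → Module.Finite R M) →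
        MP R S.mem = ∅) ∧
      MP R (FGClass R) = ∅) := by
  constructor
  · intro p hp
    have hd1 : Ring.KrullDimLE 1 R := Ring.krullDimLE_iff.mpr (by rw [hdim]; simp)
    have hpmin : p.asIdeal ∈ minimalPrimes R := by rw [hp]; rfl
    have hnil : ∃ n, p.asIdeal ^ n = ⊥ := by
      obtain ⟨n, hn⟩ := Ideal.exists_pow_le_of_le_radical_of_fg (I := p.asIdeal) (J := ⊥) (by
        rw [← Ideal.sInf_minimalPrimes]
        change p.asIdeal ≤ sInf (minimalPrimes R)
        rw [hp]
        simp) (IsNoetherian.noetherian _)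
      exact ⟨n, le_bot_iff.mp hn⟩
    have hcases : ∀ P : PrimeSpectrum R, P = p ∨ P.asIdeal = IsLocalRing.maximalIdeal R := by
      intro P
      rcases Ring.krullDimLE_one_iff.mp hd1 P.asIdeal P.isPrime with h | h
      · left
        rw [hp] at h
        exact PrimeSpectrum.ext h
      · exact Or.inr (IsLocalRing.eq_maximalIdeal h)
    have hgen : ∀ S : SerreClass R,
        ¬ MelkerssonCondition R S.mem (IsLocalRing.maximalIdeal R) → MP R S.mem = {p} := by
      intro S hS
      ext P
      simp only [Set.mem_singleton_iff]
      constructor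
      · intro hP
        rcases hcases P with h | h
        · exact h
        · have hP' : MelkerssonCondition R S.mem P.asIdeal := hP
          rw [h] at hP'
          exact absurd hP' hS
      · rintro rfl
        exact S.melkersson_of_nilpotent _ hnil
    refine ⟨fun S hS hA => hgen S fun hC => hA fun M hM =>
      S.artinian_of_melkersson hS hC (IsNoetherian.noetherian _) M hM, ?_⟩
    refine hgen (fgSerre R) (not_melkersson hdim (fgSerre R) (fgSerre_nonzero R)
      (fun M h => h) _ p.asIdeal le_rfl hpmin fun hle => ?_)
    refine not_maximal_of_minimal hdim p.asIdeal hpmin ?_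
    rw [← (IsLocalRing.maximalIdeal.isMaximal R).eq_of_le p.isPrime.ne_top hle]
    exact IsLocalRing.maximalIdeal.isMaximal R
  · rintro ⟨q₁, hq₁, q₂, hq₂, hne⟩
    have hgen : ∀ S : SerreClass R, (∃ M : ModuleCat.{0} R, S.mem M ∧ Nontrivial M) →
        (∀ M : ModuleCat.{0} R, S.mem M → Module.Finite R M) → MP R S.mem = ∅ := by
      intro S hS hfin
      rw [Set.eq_empty_iff_forall_notMem]
      intro P hP
      have hPm := IsLocalRing.le_maximalIdeal P.isPrime.ne_top
      by_cases h1 : P.asIdeal ≤ q₁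
      · by_cases h2 : P.asIdeal ≤ q₂
        · apply hne
          rw [le_antisymm (hq₁.2 ⟨P.isPrime, bot_le⟩ h1) h1,
            le_antisymm (hq₂.2 ⟨P.isPrime, bot_le⟩ h2) h2]
        · exact not_melkersson hdim S hS hfin _ q₂ hPm hq₂ h2 hP
      · exact not_melkersson hdim S hS hfin _ q₁ hPm hq₁ h1 hP
    exact ⟨hgen, hgen (fgSerre R) (fgSerre_nonzero R) (fun M h => h)⟩
end
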